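/- arXiv:1310.2447 — 2 statements merged into one kernel-verified Lean document; each statement's English description precedes it below -/
import Mathlib

section
/- Let F ∈ ℝ[X,Y] be a nonzero bivariate polynomial of total degree d ≥ 1 and let G ∈ ℝ[X,Y] be a bivariate t-sparse polynomial (t ≥ 1). Then there is an absolute constant C > 0 (independent of d, t, F, G) such that the set of real solutions {(x,y) ∈ ℝ² : F(x,y) = 0 and G(x,y) = 0} has at most C·(d³·t + d²·t³) connected components. -/
open MvPolynomial

theorem two_mul_finrank_restrictTotalDegree (K : Type*) [Field K] (N : ℕ) :
    2 * Module.finrank K (restrictTotalDegree (Fin 2) K N) = (N + 1) * (N + 2) := by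
  have h : Nat.card {n : Fin 2 →₀ ℕ | (n.sum fun _ e => e) ≤ N} =
      ((Finset.range (N + 1)).sigma fun k => Finset.range (k + 1)).card := by
    rw [← Nat.card_eq_fintype_card.trans (Fintype.card_coe _)]
    refine Nat.card_congr
      { toFun := fun n => ⟨⟨n.1 0 + n.1 1, n.1 0⟩, ?_⟩
        invFun := fun p =>
          ⟨Finsupp.equivFunOnFinite.symm ![p.1.2, p.1.1 - p.1.2], ?_⟩
        left_inv := fun n => ?_
        right_inv := fun p => ?_ }
    · have := n.2
      simp [Finsupp.sum_fintype] at this ⊢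
      omega
    · obtain ⟨⟨a, b⟩, hp⟩ := p
      simp [Finsupp.sum_fintype] at hp ⊢
      omega
    · ext i
      fin_cases i <;> simp
    · have := p.2
      obtain ⟨⟨a, b⟩, hp⟩ := p
      simp at this ⊢
      omega
  rw [restrictTotalDegree,
    Module.finrank_eq_nat_card_basis (basisRestrictSupport K _), h, Finset.card_sigma]
  simp only [Finset.card_range]
  clear h
  induction N with
  | zero => rfl
  | succ N ih => rw [Finset.sum_range_succ, mul_add, ih]; ring

/-- Polynomials of degree at most the number of points interpolate arbitrary values. -/
theorem exists_eval_eq_of_totalDegree_le_card {K : Type*} [Field K] (T : Finset (K × K))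
    (g : T → K) : ∃ Q : MvPolynomial (Fin 2) K, Q.totalDegree ≤ T.card ∧
      ∀ p : T, eval ![p.1.1, p.1.2] Q = g p := by
  classical
  have key : ∀ p : T, ∃ Q : MvPolynomial (Fin 2) K, Q.totalDegree ≤ T.card ∧
      eval ![p.1.1, p.1.2] Q = 1 ∧ ∀ q : T, q ≠ p → eval ![q.1.1, q.1.2] Q = 0 := by
    intro p
    let l : K × K → MvPolynomial (Fin 2) K := fun q =>
      if q.1 = p.1.1 then X 1 - C q.2 else X 0 - C q.1
    have hl : ∀ q, (l q).totalDegree ≤ 1 := by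
      intro q
      dsimp only [l]
      split_ifs
      · exact (totalDegree_sub_C_le _ _).trans (by simp)
      · exact (totalDegree_sub_C_le _ _).trans (by simp)
    let Q₀ := ∏ q ∈ T.erase p.1, l q
    have hdeg : Q₀.totalDegree ≤ T.card := by
      refine (totalDegree_finsetProd _ _).trans ?_
      refine (Finset.sum_le_card_nsmul _ _ 1 fun q _ => hl q).trans ?_
      rw [smul_eq_mul, mul_one]
      exact Finset.card_erase_le
    have hp : eval ![p.1.1, p.1.2] Q₀ ≠ 0 := by
      simp only [Q₀, map_prod]
      refine Finset.prod_ne_zero_iff.mpr fun q hq => ?_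
      have hqp : q ≠ p.1 := (Finset.mem_erase.mp hq).1
      dsimp only [l]
      split_ifs with h
      · have : q.2 ≠ p.1.2 := fun h' => hqp (Prod.ext h h')
        simpa [sub_eq_zero] using this.symm
      · simpa [sub_eq_zero] using fun h' => h h'.symm
    have hq : ∀ q : T, q ≠ p → eval ![q.1.1, q.1.2] Q₀ = 0 := by
      intro q hqp
      simp only [Q₀, map_prod]
      refine Finset.prod_eq_zero (i := q.1) (Finset.mem_erase.mpr
        ⟨fun h => hqp (Subtype.ext h), q.2⟩) ?_
      dsimp only [l]
      split_ifs with h <;> simp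
    refine ⟨C (eval ![p.1.1, p.1.2] Q₀)⁻¹ * Q₀, ?_, by simp [hp],
      fun q hqp => by simp [hq q hqp]⟩
    refine (totalDegree_mul _ _).trans ?_
    simpa using hdeg
  choose Q hQ hQ1 hQ0 using key
  refine ⟨∑ p, g p • Q p, ?_, fun q => ?_⟩
  · exact totalDegree_finsetSum_le fun p _ => (totalDegree_smul_le _ _).trans (hQ p)
  · rw [map_sum, Finset.sum_eq_single q]
    · simp [hQ1]
    · intro p _ hpq
      simp [hQ0 p q hpq.symm]
    · simp

/-- **Bézout's inequality** for plane curves without a common component. -/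
theorem card_common_zeros_le {K : Type*} [Field K] {F P : MvPolynomial (Fin 2) K}
    (hF : Irreducible F) (hP : ¬ F ∣ P) (T : Finset (K × K))
    (hT : ∀ p ∈ T, eval ![p.1, p.2] F = 0 ∧ eval ![p.1, p.2] P = 0) :
    T.card ≤ F.totalDegree * P.totalDegree := by
  classical
  have hF0 : F ≠ 0 := hF.ne_zero
  have hP0 : P ≠ 0 := by rintro rfl; exact hP (dvd_zero F)
  have hFp : Prime F := hF.prime
  obtain ⟨d, hd⟩ : ∃ d, F.totalDegree = d := ⟨_, rfl⟩
  obtain ⟨e, he⟩ : ∃ e, P.totalDegree = e := ⟨_, rfl⟩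
  rw [hd, he]
  obtain ⟨m, hm⟩ : ∃ m, T.card = m := ⟨_, rfl⟩
  rw [hm]
  -- the evaluation map on polynomials of degree at most `m + d + e`
  let E : MvPolynomial (Fin 2) K →ₗ[K] (T → K) :=
    LinearMap.pi fun p => (aeval ![p.1.1, p.1.2] : MvPolynomial (Fin 2) K →ₐ[K] K).toLinearMap
  have hEapp : ∀ (Q : MvPolynomial (Fin 2) K) (p : T), E Q p = eval ![p.1.1, p.1.2] Q := by
    intro Q p
    simp [E, aeval_eq_eval]
  let V := fun n => restrictTotalDegree (Fin 2) K n
  let E' : V (m + d + e) →ₗ[K] (T → K) := E.comp (V (m + d + e)).subtype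
  have hsurj : Function.Surjective E' := by
    intro g
    obtain ⟨Q, hQ, hQg⟩ := exists_eval_eq_of_totalDegree_le_card T g
    refine ⟨⟨Q, (mem_restrictTotalDegree _ _ _).mpr (hQ.trans (by omega))⟩, ?_⟩
    funext p
    exact (hEapp Q p).trans (hQg p)
  -- combinations of `F` and `P` lie in the kernel of the evaluation map
  have hmul : ∀ {A B : MvPolynomial (Fin 2) K} {a b n : ℕ}, A.totalDegree ≤ a → B.totalDegree ≤ b →
      a + b ≤ n → A * B ∈ V n := fun hA hB hn =>
    (mem_restrictTotalDegree _ _ _).mpr ((totalDegree_mul _ _).trans (by omega))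
  have hmem : ∀ {n} (A : V n), A.1.totalDegree ≤ n := fun A =>
    (mem_restrictTotalDegree _ _ _).mp A.2
  let Φ : V (m + e) × V (m + d) →ₗ[K] V (m + d + e) :=
    LinearMap.codRestrict _
      ((LinearMap.mulLeft K F).comp ((V (m + e)).subtype.comp (LinearMap.fst K _ _)) +
        (LinearMap.mulLeft K P).comp ((V (m + d)).subtype.comp (LinearMap.snd K _ _)))
      (fun x => Submodule.add_mem _ (hmul hd.le (hmem x.1) (by omega))
        (hmul he.le (hmem x.2) (by omega)))
  have hΦ : ∀ x, (Φ x : MvPolynomial (Fin 2) K) = F * x.1 + P * x.2 := fun x => rfl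
  have hrange : LinearMap.range Φ ≤ LinearMap.ker E' := by
    rintro _ ⟨x, rfl⟩
    rw [LinearMap.mem_ker]
    funext p
    change E (Φ x) p = 0
    rw [hEapp, hΦ]
    simp [(hT p.1 p.2).1, (hT p.1 p.2).2]
  let Ψ : V m →ₗ[K] V (m + e) × V (m + d) :=
    LinearMap.prod
      (LinearMap.codRestrict _ ((LinearMap.mulLeft K P).comp (V m).subtype)
        (fun x => hmul he.le (hmem x) (by omega)))
      (LinearMap.codRestrict _ (-(LinearMap.mulLeft K F).comp (V m).subtype)
        (fun x => Submodule.neg_mem _ (hmul hd.le (hmem x) (by omega))))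
  have hker : LinearMap.ker Φ ≤ LinearMap.range Ψ := by
    intro x hx
    have h0 : F * (x.1 : MvPolynomial (Fin 2) K) + P * x.2 = 0 := by
      rw [← hΦ, LinearMap.mem_ker.mp hx]; rfl
    have hdvd : F ∣ P * (x.2 : MvPolynomial (Fin 2) K) :=
      ⟨-x.1, by linear_combination h0⟩
    obtain ⟨R, hR⟩ := (hFp.dvd_or_dvd hdvd).resolve_left hP
    have h1 : (x.1 : MvPolynomial (Fin 2) K) = P * (-R) := by
      refine mul_left_cancel₀ hF0 ?_
      rw [hR] at h0
      linear_combination h0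
    have hRd : (-R).totalDegree ≤ m := by
      rcases eq_or_ne R 0 with rfl | hR0
      · simp
      have := hmem x.2
      rw [hR, totalDegree_mul_of_isDomain hF0 hR0, hd] at this
      rw [totalDegree_neg]
      omega
    refine ⟨⟨-R, (mem_restrictTotalDegree _ _ _).mpr hRd⟩, ?_⟩
    refine Prod.ext (Subtype.ext ?_) (Subtype.ext ?_)
    · exact h1.symm
    · change -(F * -R) = _
      rw [hR]; ring
  have e1 := LinearMap.finrank_range_add_finrank_ker E'
  rw [LinearMap.range_eq_top.mpr hsurj, finrank_top] at e1
  have e2 := LinearMap.finrank_range_add_finrank_ker Φ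
  have e3 := Submodule.finrank_mono hrange
  have e4 := (Submodule.finrank_mono hker).trans (LinearMap.finrank_range_le Ψ)
  have e5 : Module.finrank K (T → K) = m := by simp [hm]
  rw [Module.finrank_prod] at e2
  have d1 := two_mul_finrank_restrictTotalDegree K m
  have d2 := two_mul_finrank_restrictTotalDegree K (m + e)
  have d3 := two_mul_finrank_restrictTotalDegree K (m + d)
  have d4 := two_mul_finrank_restrictTotalDegree K (m + d + e)
  simp only [V] at e1 e2 e3 e4
  rw [e5] at e1
  generalize Module.finrank K (restrictTotalDegree (Fin 2) K m) = v₁ at *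
  generalize Module.finrank K (restrictTotalDegree (Fin 2) K (m + e)) = v₂ at *
  generalize Module.finrank K (restrictTotalDegree (Fin 2) K (m + d)) = v₃ at *
  generalize Module.finrank K (restrictTotalDegree (Fin 2) K (m + d + e)) = v₄ at *
  have h1 : m + v₂ + v₃ ≤ v₁ + v₄ := by omega
  clear * - h1 d1 d2 d3 d4
  linarith

/-- The Wronskian of `f 0, …, f (k - 1)` with respect to an operator `D`. -/
def iterWronskian {A : Type*} [CommRing A] (D : A → A) (k : ℕ) (f : ℕ → A) : A :=
  Matrix.det (Matrix.of fun i j : Fin k => D^[i] (f j))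

/-- `L` is a differential operator of order at most `n` in `D`, with `n`-th coefficient `a`. -/
def IsDiffOp {A : Type*} [CommRing A] (D : A → A) (n : ℕ) (a : A) (L : A → A) : Prop :=
  ∃ c : ℕ → A, c n = a ∧ ∀ g, L g = ∑ i ∈ Finset.range (n + 1), c i * D^[i] g

namespace IsDiffOp

variable {A : Type*} [CommRing A] {D : A → A} {n : ℕ} {a b : A} {L M : A → A}

theorem const_mul (h : IsDiffOp D n a L) (b : A) : IsDiffOp D n (b * a) fun g => b * L g := by
  obtain ⟨c, hc, hL⟩ := h
  exact ⟨fun i => b * c i, by simp [hc], fun g => by simp [hL, Finset.mul_sum, mul_assoc]⟩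

theorem sub (h : IsDiffOp D n a L) (h' : IsDiffOp D n b M) :
    IsDiffOp D n (a - b) fun g => L g - M g := by
  obtain ⟨c, hc, hL⟩ := h
  obtain ⟨e, he, hM⟩ := h'
  exact ⟨fun i => c i - e i, by simp [hc, he],
    fun g => by simp [hL, hM, sub_mul, Finset.sum_sub_distrib]⟩

theorem succ (h : IsDiffOp D n a L) : IsDiffOp D (n + 1) 0 L := by
  obtain ⟨c, -, hL⟩ := h
  refine ⟨fun i => if i ≤ n then c i else 0, by simp, fun g => ?_⟩
  rw [hL, Finset.sum_range_succ _ (n + 1)]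
  simp only [add_le_iff_nonpos_right, nonpos_iff_eq_zero, one_ne_zero, if_false, zero_mul, add_zero]
  refine Finset.sum_congr rfl fun i hi => ?_
  rw [if_pos (by simpa [Nat.lt_succ_iff] using hi)]

theorem derivation_comp {R : Type*} [CommRing R] [Algebra R A] {D : Derivation R A A}
    (h : IsDiffOp D n a L) : IsDiffOp D (n + 1) a fun g => D (L g) := by
  obtain ⟨c, hc, hL⟩ := h
  refine ⟨fun i => (if i ≤ n then D (c i) else 0) + (if i = 0 then 0 else c (i - 1)),
    by simp [hc], fun g => ?_⟩
  simp only [add_mul, Finset.sum_add_distrib]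
  rw [Finset.sum_range_succ _ (n + 1), Finset.sum_range_succ' _ (n + 1)]
  simp only [hL, map_sum, Derivation.leibniz, smul_eq_mul, Finset.sum_add_distrib]
  simp only [add_le_iff_nonpos_right, nonpos_iff_eq_zero, one_ne_zero, if_false, zero_mul, add_zero,
    if_true, Nat.add_eq_zero_iff, and_false, Nat.add_sub_cancel]
  rw [add_comm]
  congr 1
  · refine Finset.sum_congr rfl fun i hi => ?_
    rw [if_pos (by simpa [Nat.lt_succ_iff] using hi), mul_comm]
  · refine Finset.sum_congr rfl fun i hi => ?_
    rw [Function.iterate_succ_apply']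

/-- A differential operator of order less than `n` that kills `n` elements with nonzero Wronskian
is zero. -/
theorem eq_zero [IsDomain A] {f : ℕ → A} (h : IsDiffOp D n 0 L)
    (hf : iterWronskian D n f ≠ 0) (hL0 : ∀ j < n, L (f j) = 0) (g : A) : L g = 0 := by
  obtain ⟨c, hc, hL⟩ := h
  have hL' : ∀ g, L g = ∑ i : Fin n, c i * D^[i] g := fun g => by
    rw [hL, Finset.sum_range_succ, hc, zero_mul, add_zero, Finset.sum_range]
  have h0 : Matrix.vecMul (fun i : Fin n => c i)
      (Matrix.of fun i j : Fin n => D^[i] (f j)) = 0 := by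
    funext j
    simpa [Matrix.vecMul, dotProduct, hL'] using hL0 j j.2
  have hc0 := Matrix.eq_zero_of_vecMul_eq_zero hf h0
  rw [hL']
  exact Finset.sum_eq_zero fun i _ => by rw [show c i = 0 from congrFun hc0 i, zero_mul]

end IsDiffOp

section Wronskian

variable {A : Type*} [CommRing A] (D : A → A)

theorem iterWronskian_congr {k : ℕ} {f f' : ℕ → A} (h : ∀ j < k, f j = f' j) :
    iterWronskian D k f = iterWronskian D k f' := by
  unfold iterWronskian
  congr 1
  ext i j
  simp [h j j.2]

theorem iterWronskian_update_of_le {k m : ℕ} (f : ℕ → A) (g : A) (h : k ≤ m) :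
    iterWronskian D k (Function.update f m g) = iterWronskian D k f :=
  iterWronskian_congr D fun j hj => Function.update_of_ne (by omega) _ _

theorem iterWronskian_eq_zero_of_eq {k i j : ℕ} {f : ℕ → A} (hi : i < k) (hj : j < k)
    (hij : i ≠ j) (h : f i = f j) : iterWronskian D k f = 0 :=
  Matrix.det_zero_of_column_eq (i := ⟨i, hi⟩) (j := ⟨j, hj⟩) (by simpa using hij)
    fun l => by simp [h]

theorem isDiffOp_iterWronskian (k : ℕ) (f : ℕ → A) :
    IsDiffOp D k (iterWronskian D k f)
      fun g => iterWronskian D (k + 1) (Function.update f k g) := by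
  refine ⟨fun i => if h : i < k + 1 then (-1) ^ (i + k) *
    Matrix.det ((Matrix.of fun i j : Fin (k + 1) => D^[i] (f j)).submatrix
      (Fin.succAbove ⟨i, h⟩) (Fin.last k).succAbove) else 0, ?_, fun g => ?_⟩
  · simp only [Nat.lt_succ_self, dif_pos, Even.neg_one_pow ⟨k, rfl⟩, one_mul]
    unfold iterWronskian
    congr 1
    ext i j
    have : (⟨k, Nat.lt_succ_self k⟩ : Fin (k + 1)) = Fin.last k := rfl
    simp [this]
  · beta_reduce
    rw [iterWronskian, Matrix.det_succ_column _ (Fin.last k), Finset.sum_range]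
    refine Finset.sum_congr rfl fun i _ => ?_
    rw [dif_pos i.2]
    simp only [Matrix.of_apply, Fin.val_last, Function.update_self]
    rw [mul_right_comm]
    congr 3
    ext i' j
    have : (j : ℕ) ≠ k := by omega
    simp [this]

theorem IsDiffOp.map_sum_smul {R ι : Type*} [CommRing R] [Algebra R A] {D : Derivation R A A}
    {n : ℕ} {a : A} {L : A → A} (h : IsDiffOp D n a L) (s : Finset ι) (r : ι → R) (g : ι → A) :
    L (∑ i ∈ s, r i • g i) = ∑ i ∈ s, r i • L (g i) := by
  obtain ⟨c, -, hL⟩ := h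
  have hD : ∀ k, D^[k] (∑ i ∈ s, r i • g i) = ∑ i ∈ s, r i • D^[k] (g i) := by
    intro k
    induction k with
    | zero => rfl
    | succ k ih => simp only [Function.iterate_succ_apply', ih, map_sum, Derivation.map_smul]
  simp only [hL, hD, Finset.mul_sum, Finset.smul_sum]
  rw [Finset.sum_comm]
  simp only [mul_smul_comm]

/-- The derivative of a quotient of consecutive Wronskians. -/
theorem iterWronskian_derivation {R : Type*} [CommRing R] [Algebra R A] [IsDomain A]
    (D : Derivation R A A) (k : ℕ) (f : ℕ → A) (hf : iterWronskian D (k + 1) f ≠ 0) (g : A) :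
    iterWronskian D (k + 1) f * D (iterWronskian D (k + 1) (Function.update f k g)) -
      iterWronskian D (k + 1) (Function.update f k g) * D (iterWronskian D (k + 1) f) =
    iterWronskian D k f * iterWronskian D (k + 2) (Function.update f (k + 1) g) := by
  have h1 := isDiffOp_iterWronskian D k f
  have h2 := isDiffOp_iterWronskian D (k + 1) f
  have h := ((h1.derivation_comp.const_mul (iterWronskian D (k + 1) f)).sub
    (h1.succ.const_mul (D (iterWronskian D (k + 1) f)))).sub (h2.const_mul (iterWronskian D k f))
  rw [mul_zero, sub_zero, mul_comm, sub_self] at h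
  have := h.eq_zero hf (fun j hj => ?_) g
  · linear_combination this
  · have e2 : iterWronskian D (k + 2) (Function.update f (k + 1) (f j)) = 0 :=
      iterWronskian_eq_zero_of_eq D (i := j) (j := k + 1) (by omega) (by omega) (by omega)
        (by simp [hj.ne])
    rcases Nat.lt_succ_iff_lt_or_eq.mp hj with hj | rfl
    · have e1 : iterWronskian D (k + 1) (Function.update f k (f j)) = 0 :=
        iterWronskian_eq_zero_of_eq D (i := j) (j := k) (by omega) (by omega) (by omega)
          (by simp [hj.ne])
      simp only [e1, e2, map_zero, mul_zero, sub_zero]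
    · simp only [Function.update_eq_self, e2]
      ring

end Wronskian

section Degree

variable {K : Type*} [Field K]

theorem totalDegree_pderiv_le {σ : Type*} (i : σ) (P : MvPolynomial σ K) :
    (pderiv i P).totalDegree ≤ P.totalDegree - 1 := by
  classical
  refine Finset.sup_le fun m hm => ?_
  have h : coeff (m + Finsupp.single i 1) P ≠ 0 := by
    intro h0
    rw [mem_support_iff, coeff_pderiv, h0, zero_mul] at hm
    exact hm rfl
  have h1 := le_totalDegree (mem_support_iff.mpr h)
  rw [Finsupp.sum_add_index' (fun _ => rfl) (fun _ _ _ => rfl),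
    Finsupp.sum_single_index rfl] at h1
  omega

/-- The derivation `xy (F_y ∂_x - F_x ∂_y)`, tangent to the level curves of `F` and sending each
monomial to a multiple of itself. -/
noncomputable def curveDerivation (F : MvPolynomial (Fin 2) K) :
    Derivation K (MvPolynomial (Fin 2) K) (MvPolynomial (Fin 2) K) :=
  (X 0 * X 1 * pderiv 1 F) • pderiv 0 - (X 0 * X 1 * pderiv 0 F) • pderiv 1

theorem curveDerivation_apply (F P : MvPolynomial (Fin 2) K) :
    curveDerivation F P =
      X 0 * X 1 * (pderiv 1 F * pderiv 0 P - pderiv 0 F * pderiv 1 P) := by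
  simp only [curveDerivation, Derivation.sub_apply, Derivation.smul_apply, smul_eq_mul]
  ring

theorem totalDegree_curveDerivation_le {F : MvPolynomial (Fin 2) K} (hF : 1 ≤ F.totalDegree)
    (P : MvPolynomial (Fin 2) K) :
    (curveDerivation F P).totalDegree ≤ P.totalDegree + F.totalDegree := by
  rcases Nat.eq_zero_or_pos P.totalDegree with h | h
  · rw [totalDegree_eq_zero_iff_eq_C.mp h, ← algebraMap_eq, Derivation.map_algebraMap]
    simp
  have h0 := totalDegree_pderiv_le 0 P
  have h1 := totalDegree_pderiv_le 1 P
  have h2 := totalDegree_pderiv_le 0 F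
  have h3 := totalDegree_pderiv_le 1 F
  have h4 := totalDegree_mul (pderiv 1 F) (pderiv 0 P)
  have h5 := totalDegree_mul (pderiv 0 F) (pderiv 1 P)
  have h6 := totalDegree_sub (pderiv 1 F * pderiv 0 P) (pderiv 0 F * pderiv 1 P)
  have h7 := totalDegree_mul (X 0 * X 1 : MvPolynomial (Fin 2) K)
    (pderiv 1 F * pderiv 0 P - pderiv 0 F * pderiv 1 P)
  have h8 := totalDegree_mul (X 0 : MvPolynomial (Fin 2) K) (X 1)
  rw [totalDegree_X, totalDegree_X] at h8
  rw [curveDerivation_apply]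
  omega

theorem curveDerivation_monomial {F : MvPolynomial (Fin 2) K} (hF : 1 ≤ F.totalDegree)
    (e : Fin 2 →₀ ℕ) : ∃ Q : MvPolynomial (Fin 2) K, Q.totalDegree ≤ F.totalDegree ∧
      curveDerivation F (monomial e 1) = monomial e 1 * Q := by
  refine ⟨e 0 • (X 1 * pderiv 1 F) - e 1 • (X 0 * pderiv 0 F), ?_, ?_⟩
  · have h2 := totalDegree_pderiv_le 0 F
    have h3 := totalDegree_pderiv_le 1 F
    have h4 := totalDegree_mul (X 1) (pderiv 1 F)
    have h5 := totalDegree_mul (X 0) (pderiv 0 F)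
    rw [totalDegree_X] at h4 h5
    refine (totalDegree_sub _ _).trans (max_le ?_ ?_)
    · exact (totalDegree_smul_le _ _).trans (by omega)
    · exact (totalDegree_smul_le _ _).trans (by omega)
  · have h0 := X_mul_pderiv_monomial (R := K) (i := (0 : Fin 2)) (m := e) (r := 1)
    have h1 := X_mul_pderiv_monomial (R := K) (i := (1 : Fin 2)) (m := e) (r := 1)
    rw [nsmul_eq_mul] at h0 h1
    rw [curveDerivation_apply, nsmul_eq_mul, nsmul_eq_mul]
    linear_combination X 1 * pderiv 1 F * h0 - X 0 * pderiv 0 F * h1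

theorem iterate_curveDerivation_monomial {F : MvPolynomial (Fin 2) K} (hF : 1 ≤ F.totalDegree)
    (e : Fin 2 →₀ ℕ) (i : ℕ) : ∃ Q : MvPolynomial (Fin 2) K, Q.totalDegree ≤ i * F.totalDegree ∧
      (curveDerivation F)^[i] (monomial e 1) = monomial e 1 * Q := by
  induction i with
  | zero => exact ⟨1, by simp, by simp⟩
  | succ i ih =>
    obtain ⟨Q, hQ, h⟩ := ih
    obtain ⟨L, hL, h'⟩ := curveDerivation_monomial hF e
    refine ⟨curveDerivation F Q + Q * L, ?_, ?_⟩
    · have h1 := totalDegree_curveDerivation_le hF Q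
      have h2 := totalDegree_mul Q L
      have h3 := totalDegree_add (curveDerivation F Q) (Q * L)
      rw [add_mul, one_mul]
      omega
    · rw [Function.iterate_succ_apply', h, Derivation.leibniz, h', smul_eq_mul, smul_eq_mul]
      ring

/-- The Wronskian of `k` monomials is their product times a polynomial of low degree. -/
theorem iterWronskian_monomial {F : MvPolynomial (Fin 2) K} (hF : 1 ≤ F.totalDegree)
    (k : ℕ) (e : ℕ → Fin 2 →₀ ℕ) : ∃ q : MvPolynomial (Fin 2) K,
      q.totalDegree ≤ k * k * F.totalDegree ∧
      iterWronskian (curveDerivation F) k (fun j => monomial (e j) 1) =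
        (∏ j : Fin k, monomial (e j) 1) * q := by
  choose Q hQ h using fun j i => iterate_curveDerivation_monomial hF (e j) i
  refine ⟨Matrix.det (Matrix.of fun i j : Fin k => Q j i), ?_, ?_⟩
  · rw [Matrix.det_apply]
    refine totalDegree_finsetSum_le fun s _ => ?_
    refine (totalDegree_smul_le _ _).trans ?_
    refine (totalDegree_finsetProd _ _).trans ?_
    refine (Finset.sum_le_card_nsmul _ _ (k * F.totalDegree) fun i _ => ?_).trans ?_
    · exact (hQ _ _).trans (Nat.mul_le_mul_right _ (s i).2.le)
    · simp [mul_assoc]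
  · rw [iterWronskian, ← Matrix.det_mul_row]
    congr 1
    ext i j : 2
    simp [h]

end Degree

section Slice

/-- A plane polynomial as a polynomial in the second variable. -/
noncomputable def inY (F : MvPolynomial (Fin 2) ℝ) : Polynomial (Polynomial ℝ) :=
  (Polynomial.Bivariate.equivMvPolynomial ℝ).symm F

/-- The restriction of a plane polynomial to a vertical line. -/
noncomputable def slice (F : MvPolynomial (Fin 2) ℝ) (x : ℝ) : Polynomial ℝ :=
  (inY F).map (Polynomial.evalRingHom x)

theorem inY_monomial (e : Fin 2 →₀ ℕ) (a : ℝ) :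
    inY (monomial e a) = Polynomial.monomial (e 1) (Polynomial.monomial (e 0) a) := by
  rw [inY, monomial_eq, Finsupp.prod_fintype _ _ (fun i => pow_zero _)]
  simp only [map_mul, map_pow, Fin.prod_univ_two,
    Polynomial.Bivariate.equivMvPolynomial_symm_X_0,
    Polynomial.Bivariate.equivMvPolynomial_symm_X_1,
    Polynomial.Bivariate.equivMvPolynomial_symm_C]
  rw [← mul_assoc, ← Polynomial.C_pow, ← Polynomial.C_mul, Polynomial.C_mul_X_pow_eq_monomial,
    Polynomial.C_mul_X_pow_eq_monomial]

theorem inY_add (F G : MvPolynomial (Fin 2) ℝ) : inY (F + G) = inY F + inY G :=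
  map_add _ F G

theorem inY_eq_zero_iff {F : MvPolynomial (Fin 2) ℝ} : inY F = 0 ↔ F = 0 :=
  map_eq_zero_iff _ (Polynomial.Bivariate.equivMvPolynomial ℝ).symm.injective

theorem coeff_coeff_inY (F : MvPolynomial (Fin 2) ℝ) (i j : ℕ) :
    ((inY F).coeff j).coeff i = F.coeff (Finsupp.equivFunOnFinite.symm ![i, j]) := by
  induction F using MvPolynomial.induction_on' with
  | add F G hF hG => simp [inY_add, hF, hG]
  | monomial e a =>
    have h : e = Finsupp.equivFunOnFinite.symm ![i, j] ↔ e 1 = j ∧ e 0 = i := by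
      rw [Equiv.eq_symm_apply, funext_iff, Fin.forall_fin_two]
      simp [and_comm]
    rw [inY_monomial, Polynomial.coeff_monomial, coeff_monomial]
    simp only [h]
    split_ifs <;> simp_all [Polynomial.coeff_monomial]

theorem add_le_totalDegree_of_coeff_inY_ne_zero {F : MvPolynomial (Fin 2) ℝ} {i j : ℕ}
    (h : ((inY F).coeff j).coeff i ≠ 0) : i + j ≤ F.totalDegree := by
  rw [coeff_coeff_inY] at h
  simpa [Finsupp.sum_fintype] using le_totalDegree (mem_support_iff.mpr h)

theorem natDegree_inY_le (F : MvPolynomial (Fin 2) ℝ) : (inY F).natDegree ≤ F.totalDegree := by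
  refine Polynomial.natDegree_le_iff_coeff_eq_zero.mpr fun j hj => ?_
  ext i
  by_contra h
  have := add_le_totalDegree_of_coeff_inY_ne_zero h
  omega

theorem natDegree_coeff_inY_le (F : MvPolynomial (Fin 2) ℝ) (j : ℕ) :
    ((inY F).coeff j).natDegree ≤ F.totalDegree := by
  refine Polynomial.natDegree_le_iff_coeff_eq_zero.mpr fun i hi => ?_
  by_contra h
  have := add_le_totalDegree_of_coeff_inY_ne_zero h
  omega

theorem eval_slice (F : MvPolynomial (Fin 2) ℝ) (x y : ℝ) :
    (slice F x).eval y = eval ![x, y] F := by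
  induction F using MvPolynomial.induction_on' with
  | add F G hF hG =>
    rw [map_add, ← hF, ← hG, slice, inY_add, Polynomial.map_add, Polynomial.eval_add]
    rfl
  | monomial e a =>
    rw [slice, inY_monomial, eval_monomial, Finsupp.prod_fintype _ _ (fun i => pow_zero _)]
    simp [mul_assoc]

theorem natDegree_slice_le (F : MvPolynomial (Fin 2) ℝ) (x : ℝ) :
    (slice F x).natDegree ≤ F.totalDegree :=
  Polynomial.natDegree_map_le.trans (natDegree_inY_le F)

theorem card_roots_slice_le (F : MvPolynomial (Fin 2) ℝ) (x : ℝ) :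
    (slice F x).roots.toFinset.card ≤ F.totalDegree :=
  (Multiset.toFinset_card_le _).trans ((Polynomial.card_roots' _).trans (natDegree_slice_le F x))

theorem mem_roots_slice {F : MvPolynomial (Fin 2) ℝ} {x y : ℝ} (h : slice F x ≠ 0) :
    y ∈ (slice F x).roots.toFinset ↔ eval ![x, y] F = 0 := by
  simp [h, Polynomial.IsRoot, eval_slice]

theorem inY_eq_C_of_pderiv_eq_zero {F : MvPolynomial (Fin 2) ℝ} (h : pderiv 1 F = 0) :
    ∃ a : Polynomial ℝ, inY F = Polynomial.C a := by
  have := Polynomial.Bivariate.pderiv_one_equivMvPolynomial (inY F)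
  rw [inY, AlgEquiv.apply_symm_apply, h, eq_comm,
    map_eq_zero_iff _ (Polynomial.Bivariate.equivMvPolynomial ℝ).injective] at this
  exact ⟨_, Polynomial.eq_C_of_derivative_eq_zero this⟩

theorem slice_ne_zero {F : MvPolynomial (Fin 2) ℝ} (hF : Irreducible F) (h : pderiv 1 F ≠ 0)
    (x : ℝ) : slice F x ≠ 0 := by
  intro h0
  have hdvd : Polynomial.C (Polynomial.X - Polynomial.C x) ∣ inY F := by
    rw [Polynomial.C_dvd_iff_dvd_coeff]
    intro j
    rw [Polynomial.dvd_iff_isRoot]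
    have := congrArg (fun p => Polynomial.coeff p j) h0
    simpa [slice] using this
  obtain ⟨u, hu⟩ := hdvd
  have hFu : F = (X 0 - C x) * Polynomial.Bivariate.equivMvPolynomial ℝ u := by
    rw [← AlgEquiv.apply_symm_apply (Polynomial.Bivariate.equivMvPolynomial ℝ) F]
    change Polynomial.Bivariate.equivMvPolynomial ℝ (inY F) = _
    rw [hu]
    simp
  rcases hF.isUnit_or_isUnit hFu with h1 | h1
  · have := h1.map (eval ![x, 0])
    simp at this
  · obtain ⟨c, hc⟩ := MvPolynomial.isUnit_iff_eq_C_of_isReduced.mp h1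
    apply h
    rw [hFu, hc.2]
    simp [Derivation.leibniz]

/-- The differential of a plane polynomial function. -/
theorem hasStrictFDerivAt_eval (F : MvPolynomial (Fin 2) ℝ) (v : ℝ × ℝ) :
    HasStrictFDerivAt (fun v : ℝ × ℝ => eval ![v.1, v.2] F)
      (eval ![v.1, v.2] (pderiv 0 F) • ContinuousLinearMap.fst ℝ ℝ ℝ +
        eval ![v.1, v.2] (pderiv 1 F) • ContinuousLinearMap.snd ℝ ℝ ℝ) v := by
  induction F using MvPolynomial.induction_on with
  | C a => simpa using hasStrictFDerivAt_const a v
  | add F G hF hG =>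
    simp only [map_add]
    exact HasStrictFDerivAt.congr_fderiv (hF.add hG) (by ext <;> simp)
  | mul_X F i hF =>
    have hX : HasStrictFDerivAt (fun v : ℝ × ℝ => eval ![v.1, v.2] (X i : MvPolynomial (Fin 2) ℝ))
        (eval ![v.1, v.2] (pderiv 0 (X i)) • ContinuousLinearMap.fst ℝ ℝ ℝ +
          eval ![v.1, v.2] (pderiv 1 (X i)) • ContinuousLinearMap.snd ℝ ℝ ℝ) v := by
      fin_cases i
      · simpa using (hasStrictFDerivAt_fst (𝕜 := ℝ) (p := v))
      · simpa using (hasStrictFDerivAt_snd (𝕜 := ℝ) (p := v))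
    simp only [map_mul]
    refine HasStrictFDerivAt.congr_fderiv (hF.mul hX) ?_
    ext <;> simp [Derivation.leibniz]

theorem continuous_eval_pair (F : MvPolynomial (Fin 2) ℝ) :
    Continuous fun v : ℝ × ℝ => eval ![v.1, v.2] F :=
  continuous_iff_continuousAt.mpr fun v => (hasStrictFDerivAt_eval F v).continuousAt

end Slice

section Branches

open Filter Topology

/-- Near a point where `∂F/∂y ≠ 0` the curve `F = 0` is the graph of a differentiable function. -/
theorem exists_implicit_branch {F : MvPolynomial (Fin 2) ℝ} {x₀ y₀ : ℝ}
    (h0 : eval ![x₀, y₀] F = 0) (h1 : eval ![x₀, y₀] (pderiv 1 F) ≠ 0) :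
    ∃ ψ : ℝ → ℝ, ψ x₀ = y₀ ∧
      HasDerivAt ψ (-(eval ![x₀, y₀] (pderiv 0 F) / eval ![x₀, y₀] (pderiv 1 F))) x₀ ∧
      ∀ᶠ v in 𝓝 ((x₀, y₀) : ℝ × ℝ), eval ![v.1, v.2] F = 0 ↔ ψ v.1 = v.2 := by
  have hs := hasStrictFDerivAt_eval F (x₀, y₀)
  have hinv : ((eval ![x₀, y₀] (pderiv 0 F) • ContinuousLinearMap.fst ℝ ℝ ℝ +
        eval ![x₀, y₀] (pderiv 1 F) • ContinuousLinearMap.snd ℝ ℝ ℝ) ∘L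
        ContinuousLinearMap.inr ℝ ℝ ℝ).IsInvertible :=
    ⟨ContinuousLinearEquiv.unitsEquivAut ℝ (Units.mk0 _ h1), by ext; simp⟩
  have hev := hs.eventually_apply_eq_iff_implicitFunctionOfProdDomain hinv
  have hd := (hs.hasStrictFDerivAt_implicitFunctionOfProdDomain hinv).hasFDerivAt.hasDerivAt
  refine ⟨hs.implicitFunctionOfProdDomain hinv, hev.self_of_nhds.mp rfl, ?_, ?_⟩
  · refine hd.congr_deriv ?_
    set L := (eval ![x₀, y₀] (pderiv 0 F) • ContinuousLinearMap.fst ℝ ℝ ℝ +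
        eval ![x₀, y₀] (pderiv 1 F) • ContinuousLinearMap.snd ℝ ℝ ℝ) with hL
    have : (L ∘L ContinuousLinearMap.inr ℝ ℝ ℝ)
        ((L ∘L ContinuousLinearMap.inr ℝ ℝ ℝ).inverse (eval ![x₀, y₀] (pderiv 0 F))) =
        eval ![x₀, y₀] (pderiv 0 F) := hinv.self_apply_inverse _
    have h2 : eval ![x₀, y₀] (pderiv 1 F) *
        (L ∘L ContinuousLinearMap.inr ℝ ℝ ℝ).inverse (eval ![x₀, y₀] (pderiv 0 F)) =
        eval ![x₀, y₀] (pderiv 0 F) := by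
      simpa [hL] using this
    have h3 : (L ∘L ContinuousLinearMap.inl ℝ ℝ ℝ) 1 = eval ![x₀, y₀] (pderiv 0 F) := by
      simp [hL]
    change -((L ∘L ContinuousLinearMap.inr ℝ ℝ ℝ).inverse ((L ∘L ContinuousLinearMap.inl ℝ ℝ ℝ) 1))
      = _
    rw [h3, neg_inj, eq_div_iff h1, mul_comm, h2]
  · simpa [h0] using hev

theorem leadingCoeff_slice_ne_zero {F : MvPolynomial (Fin 2) ℝ} {x : ℝ}
    (hx : (inY F).leadingCoeff.eval x ≠ 0) :
    (slice F x).leadingCoeff = (inY F).leadingCoeff.eval x ∧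
      (slice F x).natDegree = (inY F).natDegree ∧ slice F x ≠ 0 := by
  have h := Polynomial.leadingCoeff_map_of_leadingCoeff_ne_zero (Polynomial.evalRingHom x) hx
  refine ⟨h, Polynomial.natDegree_map_of_leadingCoeff_ne_zero (Polynomial.evalRingHom x) hx, ?_⟩
  intro h0
  rw [slice] at h0
  rw [h0] at h
  exact hx h.symm

/-- The roots of the vertical slices stay locally bounded away from the zeros of the leading
coefficient. -/
theorem eventually_root_bound {F : MvPolynomial (Fin 2) ℝ} {x₀ : ℝ}
    (hx : (inY F).leadingCoeff.eval x₀ ≠ 0) :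
    ∃ R : ℝ, ∀ᶠ x in 𝓝 x₀, ∀ y, eval ![x, y] F = 0 → y ∈ Set.Icc (-R) R := by
  have hc : ContinuousAt (fun x => (Finset.range (inY F).natDegree).sup
      (fun j => ‖((inY F).coeff j).eval x‖₊) / ‖(inY F).leadingCoeff.eval x‖₊ + 1) x₀ := by
    refine ContinuousAt.add (ContinuousAt.div₀ ?_ ?_ (by simpa using hx)) continuousAt_const
    · exact (Continuous.finset_sup_apply fun j _ =>
        ((inY F).coeff j).continuous.nnnorm).continuousAt
    · exact (inY F).leadingCoeff.continuous.nnnorm.continuousAt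
  obtain ⟨R, hR⟩ : ∃ R : NNReal, (Finset.range (inY F).natDegree).sup
      (fun j => ‖((inY F).coeff j).eval x₀‖₊) / ‖(inY F).leadingCoeff.eval x₀‖₊ + 1 < R :=
    exists_gt _
  refine ⟨R, ?_⟩
  filter_upwards [hc.eventually_lt continuousAt_const hR,
    (inY F).leadingCoeff.continuous.continuousAt.eventually_ne hx] with x hxR hx0 y hy
  obtain ⟨h1, h2, h3⟩ := leadingCoeff_slice_ne_zero hx0
  have hroot : (slice F x).IsRoot y := by rw [Polynomial.IsRoot, eval_slice, hy]
  have hb := hroot.norm_lt_cauchyBound h3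
  rw [Polynomial.cauchyBound, h1, h2] at hb
  have h4 : ‖y‖₊ < R := lt_trans (by simpa [slice] using hb) hxR
  have h5 : |y| < R := by exact_mod_cast h4
  exact abs_le.mp h5.le

/-- The real roots of a vertical slice, in increasing order. -/
noncomputable def rootList (F : MvPolynomial (Fin 2) ℝ) (x : ℝ) : List ℝ :=
  (slice F x).roots.toFinset.sort (· ≤ ·)

theorem length_rootList_le (F : MvPolynomial (Fin 2) ℝ) (x : ℝ) :
    (rootList F x).length ≤ F.totalDegree := by
  rw [rootList, Finset.length_sort]
  exact card_roots_slice_le F x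

theorem mem_rootList {F : MvPolynomial (Fin 2) ℝ} {x y : ℝ} (h : slice F x ≠ 0) :
    y ∈ rootList F x ↔ eval ![x, y] F = 0 := by
  rw [rootList, Finset.mem_sort, mem_roots_slice h]

/-- Over a regular value the ordered roots of the slices move differentiably. -/
theorem eventually_rootList_eq_map {F : MvPolynomial (Fin 2) ℝ} {x₀ : ℝ}
    (hx : (inY F).leadingCoeff.eval x₀ ≠ 0)
    (hreg : ∀ y, eval ![x₀, y] F = 0 → eval ![x₀, y] (pderiv 1 F) ≠ 0) :
    ∃ ψ : ℝ → ℝ → ℝ, (∀ y₀ ∈ rootList F x₀, ψ y₀ x₀ = y₀ ∧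
      HasDerivAt (ψ y₀) (-(eval ![x₀, y₀] (pderiv 0 F) / eval ![x₀, y₀] (pderiv 1 F))) x₀) ∧
      ∀ᶠ x in 𝓝 x₀, rootList F x = (rootList F x₀).map fun y₀ => ψ y₀ x := by
  have hs0 := (leadingCoeff_slice_ne_zero hx).2.2
  have hex : ∀ y₀, ∃ ψ : ℝ → ℝ, eval ![x₀, y₀] F = 0 → ψ x₀ = y₀ ∧
      HasDerivAt ψ (-(eval ![x₀, y₀] (pderiv 0 F) / eval ![x₀, y₀] (pderiv 1 F))) x₀ ∧
      ∀ᶠ v in 𝓝 ((x₀, y₀) : ℝ × ℝ), eval ![v.1, v.2] F = 0 ↔ ψ v.1 = v.2 := by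
    intro y₀
    by_cases h : eval ![x₀, y₀] F = 0
    · obtain ⟨ψ, hψ⟩ := exists_implicit_branch h (hreg _ h)
      exact ⟨ψ, fun _ => hψ⟩
    · exact ⟨0, fun h' => absurd h' h⟩
  choose ψ hψ using hex
  refine ⟨ψ, fun y₀ hy₀ => ?_, ?_⟩
  · have := hψ y₀ ((mem_rootList hs0).mp hy₀)
    exact ⟨this.1, this.2.1⟩
  obtain ⟨R, hR⟩ := eventually_root_bound hx
  have hcov : ∀ᶠ x in 𝓝 x₀, ∀ y ∈ Set.Icc (-R) R, eval ![x, y] F = 0 →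
      ∃ y₀ ∈ rootList F x₀, ψ y₀ x = y := by
    refine isCompact_Icc.eventually_forall_of_forall_eventually fun y _ => ?_
    by_cases h : eval ![x₀, y] F = 0
    · filter_upwards [(hψ y h).2.2] with v hv hv0
      exact ⟨y, (mem_rootList hs0).mpr h, hv.mp hv0⟩
    · filter_upwards [(continuous_eval_pair F).continuousAt.eventually_ne
        (x := ((x₀, y) : ℝ × ℝ)) h] with v hv hv0
      exact absurd hv0 hv
  have hzero : ∀ᶠ x in 𝓝 x₀, ∀ y₀ ∈ (slice F x₀).roots.toFinset, eval ![x, ψ y₀ x] F = 0 := by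
    rw [Finset.eventually_all]
    intro y₀ hy₀
    obtain ⟨h1, h2, h3⟩ := hψ y₀ ((mem_roots_slice hs0).mp hy₀)
    have hc : Tendsto (fun x => (x, ψ y₀ x)) (𝓝 x₀) (𝓝 (x₀, y₀)) := by
      have := h2.continuousAt.tendsto
      rw [h1] at this
      exact tendsto_id.prodMk_nhds this
    filter_upwards [hc.eventually h3] with x hx
    exact hx.mpr rfl
  have hord : ∀ᶠ x in 𝓝 x₀, ∀ y₀ ∈ (slice F x₀).roots.toFinset,
      ∀ y₁ ∈ (slice F x₀).roots.toFinset, y₀ < y₁ → ψ y₀ x < ψ y₁ x := by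
    rw [Finset.eventually_all]
    intro y₀ hy₀
    rw [Finset.eventually_all]
    intro y₁ hy₁
    obtain ⟨h1, h2, -⟩ := hψ y₀ ((mem_roots_slice hs0).mp hy₀)
    obtain ⟨k1, k2, -⟩ := hψ y₁ ((mem_roots_slice hs0).mp hy₁)
    by_cases hlt : y₀ < y₁
    · filter_upwards [h2.continuousAt.eventually_lt k2.continuousAt (by rwa [h1, k1])] with x hx _
        using hx
    · exact Eventually.of_forall fun x h => absurd h hlt
  filter_upwards [hR, hcov, hzero, hord,
    (inY F).leadingCoeff.continuous.continuousAt.eventually_ne hx] with x h1 h2 h3 h4 h5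
  have hs := (leadingCoeff_slice_ne_zero h5).2.2
  refine List.SortedLT.eq_of_mem_iff (Finset.sortedLT_sort _) ?_ fun y => ?_
  · refine List.Pairwise.sortedLT (List.pairwise_map.mpr ?_)
    refine (Finset.sortedLT_sort (slice F x₀).roots.toFinset).pairwise.imp_of_mem ?_
    intro a b ha hb hab
    exact h4 a ((Finset.mem_sort _).mp ha) b ((Finset.mem_sort _).mp hb) hab
  · rw [mem_rootList hs, List.mem_map]
    constructor
    · exact fun hy => h2 y (h1 y hy) hy
    · rintro ⟨y₀, hy₀, rfl⟩
      exact h3 y₀ ((Finset.mem_sort _).mp hy₀)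

/-- The number of roots of the slices is locally constant over regular values. -/
theorem eventually_length_rootList_eq {F : MvPolynomial (Fin 2) ℝ} {x₀ : ℝ}
    (hx : (inY F).leadingCoeff.eval x₀ ≠ 0)
    (hreg : ∀ y, eval ![x₀, y] F = 0 → eval ![x₀, y] (pderiv 1 F) ≠ 0) :
    ∀ᶠ x in 𝓝 x₀, (rootList F x).length = (rootList F x₀).length := by
  obtain ⟨ψ, -, h⟩ := eventually_rootList_eq_map hx hreg
  filter_upwards [h] with x hx
  rw [hx, List.length_map]

/-- The `j`-th real root of the vertical slice, counted from below. -/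
noncomputable def branch (F : MvPolynomial (Fin 2) ℝ) (j : ℕ) (x : ℝ) : ℝ :=
  (rootList F x).getD j 0

theorem branch_mem_rootList {F : MvPolynomial (Fin 2) ℝ} {j : ℕ} {x : ℝ}
    (hj : j < (rootList F x).length) : branch F j x ∈ rootList F x := by
  rw [branch, List.getD_eq_getElem _ _ hj]
  exact List.getElem_mem hj

theorem hasDerivAt_branch {F : MvPolynomial (Fin 2) ℝ} {x₀ : ℝ} {j : ℕ}
    (hx : (inY F).leadingCoeff.eval x₀ ≠ 0)
    (hreg : ∀ y, eval ![x₀, y] F = 0 → eval ![x₀, y] (pderiv 1 F) ≠ 0)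
    (hj : j < (rootList F x₀).length) :
    HasDerivAt (branch F j) (-(eval ![x₀, branch F j x₀] (pderiv 0 F) /
      eval ![x₀, branch F j x₀] (pderiv 1 F))) x₀ := by
  obtain ⟨ψ, h1, h2⟩ := eventually_rootList_eq_map hx hreg
  refine (h1 _ (branch_mem_rootList hj)).2.congr_of_eventuallyEq ?_
  filter_upwards [h2] with x hx
  rw [branch, hx, List.getD_eq_getElem _ _ (by simpa using hj), List.getElem_map, branch,
    List.getD_eq_getElem _ _ hj]

end Branches

section Arcs

open Filter Topology

/-- Away from a finite set of abscissas the curve `F = 0` is unramified over the first axis and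
avoids the coordinate axes. -/
structure IsRegularOutside (F : MvPolynomial (Fin 2) ℝ) (E : Finset ℝ) : Prop where
  leadingCoeff_ne_zero : ∀ x ∉ E, (inY F).leadingCoeff.eval x ≠ 0
  pderiv_ne_zero : ∀ x ∉ E, ∀ y, eval ![x, y] F = 0 → eval ![x, y] (pderiv 1 F) ≠ 0
  fst_ne_zero : ∀ x ∉ E, ∀ y, eval ![x, y] F = 0 → x ≠ 0
  snd_ne_zero : ∀ x ∉ E, ∀ y, eval ![x, y] F = 0 → y ≠ 0

/-- The points outside `E` with exactly `i` elements of `E` to their left. -/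
def gap (E : Finset ℝ) (i : ℕ) : Set ℝ := {x | x ∉ E ∧ (E.filter (· < x)).card = i}

theorem isPreconnected_gap (E : Finset ℝ) (i : ℕ) : IsPreconnected (gap E i) := by
  refine Set.OrdConnected.isPreconnected ⟨?_⟩
  rintro x ⟨hx, hxi⟩ y ⟨hy, hyi⟩ z ⟨hxz, hzy⟩
  have h1 : E.filter (· < x) ⊆ E.filter (· < z) :=
    Finset.monotone_filter_right _ fun e _ he => lt_of_lt_of_le he hxz
  have h2 : E.filter (· < z) ⊆ E.filter (· < y) :=
    Finset.monotone_filter_right _ fun e _ he => lt_of_lt_of_le he hzy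
  have h3 := Finset.card_le_card h1
  have h4 := Finset.card_le_card h2
  refine ⟨fun hz => ?_, by omega⟩
  have h5 := Finset.eq_of_subset_of_card_le (h1.trans h2) (by omega)
  have h6 : z ∈ E.filter (· < y) :=
    Finset.mem_filter.mpr ⟨hz, lt_of_le_of_ne hzy fun h => hy (h ▸ hz)⟩
  rw [← h5] at h6
  exact absurd (Finset.mem_filter.mp h6).2 (not_lt.mpr hxz)

theorem isOpen_gap (E : Finset ℝ) (i : ℕ) : IsOpen (gap E i) := by
  rw [isOpen_iff_mem_nhds]
  rintro x ⟨hx, hxi⟩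
  have h : ∀ᶠ z in 𝓝 x, ∀ e ∈ E, z ≠ e ∧ (e < z ↔ e < x) := by
    rw [Finset.eventually_all]
    intro e he
    rcases lt_or_gt_of_ne (fun h : x = e => hx (h ▸ he)) with h | h
    · filter_upwards [eventually_lt_nhds h] with z hz
      exact ⟨hz.ne, iff_of_false hz.le.not_gt h.le.not_gt⟩
    · filter_upwards [eventually_gt_nhds h] with z hz
      exact ⟨hz.ne', iff_of_true hz h⟩
  filter_upwards [h] with z hz
  refine ⟨fun hzE => (hz z hzE).1 rfl, ?_⟩
  rw [← hxi]
  congr 1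
  exact Finset.filter_congr fun e he => (hz e he).2

/-- The label of the arc of the curve `F = 0` that contains a given point. -/
noncomputable def arcIndex (F : MvPolynomial (Fin 2) ℝ) (E : Finset ℝ) (p : ℝ × ℝ) : ℕ × ℕ :=
  ((E.filter (· < p.1)).card, (rootList F p.1).idxOf p.2)

/-- The common zeros of `F` and `P` that do not lie over `E`. -/
def regularZeros (F : MvPolynomial (Fin 2) ℝ) (E : Finset ℝ) (P : MvPolynomial (Fin 2) ℝ) :
    Set (ℝ × ℝ) :=
  {p | p.1 ∉ E ∧ eval ![p.1, p.2] F = 0 ∧ eval ![p.1, p.2] P = 0}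

namespace IsRegularOutside

variable {F : MvPolynomial (Fin 2) ℝ} {E : Finset ℝ}

theorem mem_rootList_iff (h : IsRegularOutside F E) {x y : ℝ} (hx : x ∉ E) :
    y ∈ rootList F x ↔ eval ![x, y] F = 0 :=
  mem_rootList (leadingCoeff_slice_ne_zero (h.leadingCoeff_ne_zero x hx)).2.2

theorem idxOf_lt (h : IsRegularOutside F E) {p : ℝ × ℝ} (hp : p.1 ∉ E)
    (h0 : eval ![p.1, p.2] F = 0) : (rootList F p.1).idxOf p.2 < (rootList F p.1).length :=
  List.idxOf_lt_length_iff.mpr ((h.mem_rootList_iff hp).mpr h0)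

theorem branch_idxOf (h : IsRegularOutside F E) {p : ℝ × ℝ} (hp : p.1 ∉ E)
    (h0 : eval ![p.1, p.2] F = 0) : branch F ((rootList F p.1).idxOf p.2) p.1 = p.2 := by
  rw [branch, List.getD_eq_getElem _ _ (h.idxOf_lt hp h0), List.getElem_idxOf]

theorem eval_branch (h : IsRegularOutside F E) {x : ℝ} (hx : x ∉ E) {j : ℕ}
    (hj : j < (rootList F x).length) : eval ![x, branch F j x] F = 0 :=
  (h.mem_rootList_iff hx).mp (branch_mem_rootList hj)

theorem arcIndex_branch {i j : ℕ} {x : ℝ} (hx : x ∈ gap E i)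
    (hj : j < (rootList F x).length) : arcIndex F E (x, branch F j x) = (i, j) := by
  refine Prod.ext hx.2 ?_
  simp only [arcIndex, branch]
  rw [List.getD_eq_getElem _ _ hj]
  exact (Finset.sortedLT_sort _).nodup.idxOf_getElem _ _

theorem arcIndex_mem (h : IsRegularOutside F E) {p : ℝ × ℝ} (hp : p.1 ∉ E)
    (h0 : eval ![p.1, p.2] F = 0) :
    arcIndex F E p ∈ Finset.range (E.card + 1) ×ˢ Finset.range F.totalDegree := by
  refine Finset.mem_product.mpr ⟨Finset.mem_range.mpr ?_, Finset.mem_range.mpr ?_⟩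
  · exact Nat.lt_succ_of_le (Finset.card_filter_le _ _)
  · exact (h.idxOf_lt hp h0).trans_le (length_rootList_le F p.1)

theorem length_rootList_eq (h : IsRegularOutside F E) {i : ℕ} {x z : ℝ} (hx : x ∈ gap E i)
    (hz : z ∈ gap E i) : (rootList F x).length = (rootList F z).length := by
  refine (isPreconnected_gap E i).constant (f := fun x => (rootList F x).length)
    (fun y hy => ContinuousAt.continuousWithinAt ?_) hx hz
  refine continuousAt_const.congr (f := fun _ => (rootList F y).length) ?_
  filter_upwards [eventually_length_rootList_eq (h.leadingCoeff_ne_zero y hy.1)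
    (h.pderiv_ne_zero y hy.1)] with z hz using hz.symm

theorem continuousOn_branch (h : IsRegularOutside F E) {i j : ℕ} {x : ℝ} (hx : x ∈ gap E i)
    (hj : j < (rootList F x).length) : ContinuousOn (branch F j) (gap E i) := fun y hy =>
  (hasDerivAt_branch (h.leadingCoeff_ne_zero y hy.1) (h.pderiv_ne_zero y hy.1)
    (h.length_rootList_eq hx hy ▸ hj)).continuousAt.continuousWithinAt

/-- Along an arc, `curveDerivation` is a nonvanishing multiple of differentiation. -/
theorem hasDerivAt_eval_branch (h : IsRegularOutside F E) (P : MvPolynomial (Fin 2) ℝ) {x : ℝ}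
    (hx : x ∉ E) {j : ℕ} (hj : j < (rootList F x).length) :
    HasDerivAt (fun x => eval ![x, branch F j x] P)
      (eval ![x, branch F j x] (curveDerivation F P) /
        (x * branch F j x * eval ![x, branch F j x] (pderiv 1 F))) x := by
  have hb := hasDerivAt_branch (h.leadingCoeff_ne_zero x hx) (h.pderiv_ne_zero x hx) hj
  have h0 := h.eval_branch hx hj
  have h1 := h.pderiv_ne_zero x hx _ h0
  have h2 := h.fst_ne_zero x hx _ h0
  have h3 := h.snd_ne_zero x hx _ h0
  have hc := ((hasStrictFDerivAt_eval P (x, branch F j x)).hasFDerivAt.comp_hasDerivAt x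
    ((hasDerivAt_id x).prodMk hb))
  refine hc.congr_deriv ?_
  simp [curveDerivation_apply]
  field_simp
  ring

theorem hasDerivAt_eval_div (h : IsRegularOutside F E) (u w : MvPolynomial (Fin 2) ℝ) {x : ℝ}
    (hx : x ∉ E) {j : ℕ} (hj : j < (rootList F x).length)
    (hw : eval ![x, branch F j x] w ≠ 0) :
    HasDerivAt (fun x => eval ![x, branch F j x] u / eval ![x, branch F j x] w)
      (eval ![x, branch F j x] (w * curveDerivation F u - u * curveDerivation F w) /
        (x * branch F j x * eval ![x, branch F j x] (pderiv 1 F) *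
          eval ![x, branch F j x] w ^ 2)) x := by
  have h0 := h.eval_branch hx hj
  have h1 := h.pderiv_ne_zero x hx _ h0
  have h2 := h.fst_ne_zero x hx _ h0
  have h3 := h.snd_ne_zero x hx _ h0
  refine ((h.hasDerivAt_eval_branch u hx hj).div (h.hasDerivAt_eval_branch w hx hj)
    hw).congr_deriv ?_
  simp only [map_sub, map_mul]
  field_simp

/-- Rolle's theorem on an arc, for quotients. -/
theorem exists_eval_eq_zero (h : IsRegularOutside F E) (u w : MvPolynomial (Fin 2) ℝ) {i j : ℕ}
    {a b : ℝ} (hab : a < b) (ha : a ∈ gap E i) (hb : b ∈ gap E i)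
    (hj : j < (rootList F a).length) (hua : eval ![a, branch F j a] u = 0)
    (hub : eval ![b, branch F j b] u = 0)
    (hw : ∀ x ∈ Set.Icc a b, eval ![x, branch F j x] w ≠ 0) :
    ∃ c ∈ Set.Ioo a b,
      eval ![c, branch F j c] (w * curveDerivation F u - u * curveDerivation F w) = 0 := by
  have hgap : Set.Icc a b ⊆ gap E i := (isPreconnected_gap E i).Icc_subset ha hb
  have hd : ∀ x ∈ Set.Icc a b, HasDerivAt _ _ x := fun x hx =>
    h.hasDerivAt_eval_div u w (hgap hx).1 (h.length_rootList_eq ha (hgap hx) ▸ hj) (hw x hx)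
  obtain ⟨c, hc, hc0⟩ := exists_hasDerivAt_eq_zero hab
    (fun x hx => (hd x hx).continuousAt.continuousWithinAt) (by simp [hua, hub])
    fun x hx => hd x (Set.Ioo_subset_Icc_self hx)
  have hc' := Set.Ioo_subset_Icc_self hc
  have hcE := (hgap hc').1
  have h0 := h.eval_branch hcE (h.length_rootList_eq ha (hgap hc') ▸ hj)
  refine ⟨c, hc, (div_eq_zero_iff.mp hc0).resolve_right ?_⟩
  have := h.pderiv_ne_zero c hcE _ h0
  have := h.fst_ne_zero c hcE _ h0
  have := h.snd_ne_zero c hcE _ h0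
  have := hw c hc'
  positivity

/-- Counting zeros along the curve by Rolle's theorem. -/
theorem ncard_regularZeros_le (h : IsRegularOutside F E) {u w : MvPolynomial (Fin 2) ℝ}
    (hu : (regularZeros F E u).Finite) (hw : (regularZeros F E w).Finite)
    (hv : (regularZeros F E (w * curveDerivation F u - u * curveDerivation F w)).Finite) :
    (regularZeros F E u).ncard ≤
      (regularZeros F E (w * curveDerivation F u - u * curveDerivation F w)).ncard +
        2 * (regularZeros F E w).ncard + (E.card + 1) * F.totalDegree := by
  classical
  set v := w * curveDerivation F u - u * curveDerivation F w with hvdef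
  rw [Set.ncard_eq_toFinset_card _ hu, Set.ncard_eq_toFinset_card _ hw,
    Set.ncard_eq_toFinset_card _ hv]
  set Zu := hu.toFinset
  set Zw := hw.toFinset
  set Zv := hv.toFinset
  have key : (Zu \ Zw).card ≤ (Zv ∪ Zw).card + (E.card + 1) * F.totalDegree := by
    have hmapsu : ∀ p ∈ Zu \ Zw, arcIndex F E p ∈
        Finset.range (E.card + 1) ×ˢ Finset.range F.totalDegree := by
      intro p hp
      have hp := (Set.Finite.mem_toFinset hu).mp (Finset.mem_sdiff.mp hp).1
      exact h.arcIndex_mem hp.1 hp.2.1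
    have hmapsv : ∀ p ∈ Zv ∪ Zw, arcIndex F E p ∈
        Finset.range (E.card + 1) ×ˢ Finset.range F.totalDegree := by
      intro p hp
      rcases Finset.mem_union.mp hp with hp | hp
      · have hp := (Set.Finite.mem_toFinset hv).mp hp
        exact h.arcIndex_mem hp.1 hp.2.1
      · have hp := (Set.Finite.mem_toFinset hw).mp hp
        exact h.arcIndex_mem hp.1 hp.2.1
    rw [Finset.card_eq_sum_card_fiberwise hmapsu, Finset.card_eq_sum_card_fiberwise hmapsv]
    have hN : (E.card + 1) * F.totalDegree =
        ∑ _k ∈ Finset.range (E.card + 1) ×ˢ Finset.range F.totalDegree, 1 := by simp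
    rw [hN, ← Finset.sum_add_distrib]
    refine Finset.sum_le_sum fun k _ => ?_
    obtain ⟨i, j⟩ := k
    have hmem : ∀ p : ℝ × ℝ, p.1 ∉ E → eval ![p.1, p.2] F = 0 → arcIndex F E p = (i, j) →
        p.1 ∈ gap E i ∧ j < (rootList F p.1).length ∧ p = (p.1, branch F j p.1) := by
      intro p hpE hp0 hp
      have h1 := congrArg Prod.fst hp
      have h2 := congrArg Prod.snd hp
      simp only [arcIndex] at h1 h2
      subst h1 h2
      exact ⟨⟨hpE, rfl⟩, h.idxOf_lt hpE hp0, Prod.ext rfl (h.branch_idxOf hpE hp0).symm⟩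
    have hinj : ∀ T : Finset (ℝ × ℝ),
        (∀ p ∈ T, p.1 ∉ E ∧ eval ![p.1, p.2] F = 0 ∧ arcIndex F E p = (i, j)) →
        (T.image Prod.fst).card = T.card := by
      intro T hT
      refine Finset.card_image_of_injOn fun p hp q hq hpq => ?_
      obtain ⟨h1, h2, h3⟩ := hT p hp
      obtain ⟨k1, k2, k3⟩ := hT q hq
      rw [(hmem p h1 h2 h3).2.2, (hmem q k1 k2 k3).2.2, hpq]
    have hZu : ∀ p ∈ (Zu \ Zw).filter (arcIndex F E · = (i, j)),
        p.1 ∉ E ∧ eval ![p.1, p.2] F = 0 ∧ arcIndex F E p = (i, j) := by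
      intro p hp
      have hp := Finset.mem_filter.mp hp
      have hp' := (Set.Finite.mem_toFinset hu).mp (Finset.mem_sdiff.mp hp.1).1
      exact ⟨hp'.1, hp'.2.1, hp.2⟩
    have hZv : ∀ p ∈ (Zv ∪ Zw).filter (arcIndex F E · = (i, j)),
        p.1 ∉ E ∧ eval ![p.1, p.2] F = 0 ∧ arcIndex F E p = (i, j) := by
      intro p hp
      have hp := Finset.mem_filter.mp hp
      rcases Finset.mem_union.mp hp.1 with hp' | hp'
      · have hp' := (Set.Finite.mem_toFinset hv).mp hp'
        exact ⟨hp'.1, hp'.2.1, hp.2⟩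
      · have hp' := (Set.Finite.mem_toFinset hw).mp hp'
        exact ⟨hp'.1, hp'.2.1, hp.2⟩
    rw [← hinj _ hZu, ← hinj _ hZv]
    have hdata : ∀ x ∈ ((Zu \ Zw).filter (arcIndex F E · = (i, j))).image Prod.fst,
        x ∈ gap E i ∧ j < (rootList F x).length ∧ eval ![x, branch F j x] u = 0 ∧
          eval ![x, branch F j x] w ≠ 0 := by
      intro x hx
      obtain ⟨p, hp, rfl⟩ := Finset.mem_image.mp hx
      obtain ⟨h1, h2, h3⟩ := hZu p hp
      obtain ⟨k1, k2, k3⟩ := hmem p h1 h2 h3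
      have k4 : p.2 = branch F j p.1 := congrArg Prod.snd k3
      obtain ⟨m1, m2⟩ := Finset.mem_sdiff.mp (Finset.mem_filter.mp hp).1
      rw [← k4]
      refine ⟨k1, k2, ((Set.Finite.mem_toFinset hu).mp m1).2.2, fun hw0 => m2 ?_⟩
      exact (Set.Finite.mem_toFinset hw).mpr ⟨h1, h2, hw0⟩
    refine Finset.card_le_of_interleaved fun a ha b hb hab _ => ?_
    obtain ⟨a1, a2, a3, a4⟩ := hdata a ha
    obtain ⟨b1, b2, b3, b4⟩ := hdata b hb
    have hgap : Set.Icc a b ⊆ gap E i := (isPreconnected_gap E i).Icc_subset a1 b1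
    have hlen : ∀ x ∈ Set.Icc a b, j < (rootList F x).length := fun x hx =>
      h.length_rootList_eq a1 (hgap hx) ▸ a2
    by_cases hw0 : ∀ x ∈ Set.Icc a b, eval ![x, branch F j x] w ≠ 0
    · obtain ⟨c, hc, hc0⟩ := h.exists_eval_eq_zero u w hab a1 b1 a2 a3 b3 hw0
      have hc' := Set.Ioo_subset_Icc_self hc
      refine ⟨c, Finset.mem_image.mpr ⟨(c, branch F j c), Finset.mem_filter.mpr
        ⟨Finset.mem_union_left _ ((Set.Finite.mem_toFinset hv).mpr
          ⟨(hgap hc').1, h.eval_branch (hgap hc').1 (hlen c hc'), hc0⟩),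
          arcIndex_branch (hgap hc') (hlen c hc')⟩, rfl⟩, hc.1, hc.2⟩
    · push Not at hw0
      obtain ⟨c, hc', hc0⟩ := hw0
      refine ⟨c, Finset.mem_image.mpr ⟨(c, branch F j c), Finset.mem_filter.mpr
        ⟨Finset.mem_union_right _ ((Set.Finite.mem_toFinset hw).mpr
          ⟨(hgap hc').1, h.eval_branch (hgap hc').1 (hlen c hc'), hc0⟩),
          arcIndex_branch (hgap hc') (hlen c hc')⟩, rfl⟩, ?_, ?_⟩
      · exact lt_of_le_of_ne hc'.1 fun hac => a4 (hac ▸ hc0)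
      · exact lt_of_le_of_ne hc'.2 fun hcb => b4 (hcb ▸ hc0)
  have h1 := Finset.card_union_le Zv Zw
  have h2 := Finset.card_le_card_sdiff_add_card (s := Zu) (t := Zw)
  omega

/-- If the Wronskian of `u` and `w` vanishes on the curve, the zeros of `u` are among those
of `w`. -/
theorem regularZeros_subset (h : IsRegularOutside F E) {u w : MvPolynomial (Fin 2) ℝ}
    (hu : (regularZeros F E u).Finite)
    (hv : F ∣ w * curveDerivation F u - u * curveDerivation F w) :
    regularZeros F E u ⊆ regularZeros F E w := by
  rintro p ⟨hpE, hp0, hpu⟩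
  refine ⟨hpE, hp0, by_contra fun hpw => ?_⟩
  set j := (rootList F p.1).idxOf p.2
  have hj : j < (rootList F p.1).length := h.idxOf_lt hpE hp0
  have hpj : branch F j p.1 = p.2 := h.branch_idxOf hpE hp0
  have hgp : p.1 ∈ gap E (E.filter (· < p.1)).card := ⟨hpE, rfl⟩
  have hcw : ∀ᶠ x in 𝓝 p.1, eval ![x, branch F j x] w ≠ 0 :=
    (h.hasDerivAt_eval_branch w hpE hj).continuousAt.eventually_ne (by rwa [hpj])
  obtain ⟨ε, hε, hball⟩ := Metric.eventually_nhds_iff_ball.mp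
    (hcw.and ((isOpen_gap E _).mem_nhds hgp))
  have hlen : ∀ x ∈ Metric.ball p.1 ε, j < (rootList F x).length := fun x hx =>
    h.length_rootList_eq hgp (hball x hx).2 ▸ hj
  have hd : ∀ x ∈ Metric.ball p.1 ε, HasDerivAt
      (fun x => eval ![x, branch F j x] u / eval ![x, branch F j x] w) 0 x := fun x hx => by
    have hE := (hball x hx).2.1
    have := h.hasDerivAt_eval_div u w hE (hlen x hx) (hball x hx).1
    obtain ⟨q, hq⟩ := hv
    rwa [hq, map_mul, h.eval_branch hE (hlen x hx), zero_mul, zero_div] at this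
  have hconst : ∀ x ∈ Metric.ball p.1 ε, eval ![x, branch F j x] u = 0 := by
    intro x hx
    have h1 := Metric.isOpen_ball.is_const_of_deriv_eq_zero
      (convex_ball p.1 ε).isPreconnected
      (fun x hx => (hd x hx).differentiableAt.differentiableWithinAt)
      (fun x hx => (hd x hx).deriv) hx (Metric.mem_ball_self hε)
    rw [hpj, hpu, zero_div] at h1
    exact (div_eq_zero_iff.mp h1).resolve_right (hball x hx).1
  have hinf : (Metric.ball p.1 ε).Infinite := by
    rw [Real.ball_eq_Ioo]
    exact Set.Ioo_infinite (by linarith)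
  refine hinf (Set.Finite.subset (hu.image Prod.fst) fun x hx => ?_)
  exact ⟨(x, branch F j x), ⟨(hball x hx).2.1, h.eval_branch (hball x hx).2.1 (hlen x hx),
    hconst x hx⟩, rfl⟩

end IsRegularOutside

end Arcs

section Bound

theorem finite_and_ncard_le_of_forall_finset {α : Type*} {S : Set α} {n : ℕ}
    (h : ∀ T : Finset α, (T : Set α) ⊆ S → T.card ≤ n) : S.Finite ∧ S.ncard ≤ n := by
  have hfin : S.Finite := by
    by_contra hinf
    obtain ⟨T, hT, hc⟩ := Set.Infinite.exists_subset_card_eq hinf (n + 1)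
    have := h T hT
    omega
  refine ⟨hfin, ?_⟩
  rw [Set.ncard_eq_toFinset_card S hfin]
  exact h _ (by simp)

/-- Bézout's bound for the common zeros of an irreducible plane curve and another curve. -/
theorem ncard_common_zeros_le {F P : MvPolynomial (Fin 2) ℝ} (hF : Irreducible F)
    (hP : ¬ F ∣ P) :
    {p : ℝ × ℝ | eval ![p.1, p.2] F = 0 ∧ eval ![p.1, p.2] P = 0}.Finite ∧
      {p : ℝ × ℝ | eval ![p.1, p.2] F = 0 ∧ eval ![p.1, p.2] P = 0}.ncard ≤
        F.totalDegree * P.totalDegree :=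
  finite_and_ncard_le_of_forall_finset fun T hT => card_common_zeros_le hF hP T fun _ hp => hT hp

theorem ncard_regularZeros_le_mul {F P : MvPolynomial (Fin 2) ℝ} (hF : Irreducible F)
    (hP : ¬ F ∣ P) (E : Finset ℝ) :
    (regularZeros F E P).Finite ∧
      (regularZeros F E P).ncard ≤ F.totalDegree * P.totalDegree := by
  obtain ⟨h1, h2⟩ := ncard_common_zeros_le hF hP
  have hsub : regularZeros F E P ⊆
      {p : ℝ × ℝ | eval ![p.1, p.2] F = 0 ∧ eval ![p.1, p.2] P = 0} := fun _ hp => hp.2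
  exact ⟨h1.subset hsub, (Set.ncard_le_ncard hsub h1).trans h2⟩

theorem regularZeros_mul (F : MvPolynomial (Fin 2) ℝ) (E : Finset ℝ)
    (P Q : MvPolynomial (Fin 2) ℝ) :
    regularZeros F E (P * Q) = regularZeros F E P ∪ regularZeros F E Q := by
  ext p
  simp only [regularZeros, Set.mem_ofPred_eq, map_mul, mul_eq_zero, Set.mem_union]
  tauto

variable {F : MvPolynomial (Fin 2) ℝ} {E : Finset ℝ}

theorem ncard_regularZeros_iterWronskian_le (hF : Irreducible F) (hd : 1 ≤ F.totalDegree)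
    (h : IsRegularOutside F E) {k t : ℕ} (hk : k ≤ t) (e : ℕ → Fin 2 →₀ ℕ)
    (hW : ¬ F ∣ iterWronskian (curveDerivation F) k fun j => monomial (e j) 1) :
    (regularZeros F E (iterWronskian (curveDerivation F) k fun j => monomial (e j) 1)).Finite ∧
      (regularZeros F E (iterWronskian (curveDerivation F) k fun j => monomial (e j) 1)).ncard ≤
        F.totalDegree ^ 2 * t ^ 2 := by
  obtain ⟨q, hq, hWq⟩ := iterWronskian_monomial hd k e
  have hFq : ¬ F ∣ q := fun hdvd => hW (hWq ▸ hdvd.mul_left _)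
  obtain ⟨h1, h2⟩ := ncard_regularZeros_le_mul hF hFq E
  have hsub : regularZeros F E (iterWronskian (curveDerivation F) k fun j => monomial (e j) 1) ⊆
      regularZeros F E q := by
    rintro p ⟨hp, hp0, hpW⟩
    refine ⟨hp, hp0, ?_⟩
    rw [hWq, map_mul, map_prod] at hpW
    refine (mul_eq_zero.mp hpW).resolve_left (Finset.prod_ne_zero_iff.mpr fun j _ => ?_)
    rw [eval_monomial, Finsupp.prod_fintype _ _ (fun i => pow_zero _), Fin.prod_univ_two]
    have := h.fst_ne_zero _ hp _ hp0
    have := h.snd_ne_zero _ hp _ hp0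
    simp [*]
  refine ⟨h1.subset hsub, (Set.ncard_le_ncard hsub h1).trans (h2.trans ?_)⟩
  calc F.totalDegree * q.totalDegree ≤ F.totalDegree * (t * t * F.totalDegree) :=
        Nat.mul_le_mul_left _ (hq.trans (by gcongr))
    _ = F.totalDegree ^ 2 * t ^ 2 := by ring

theorem ncard_regularZeros_update_le (hF : Irreducible F) (hd : 1 ≤ F.totalDegree)
    (h : IsRegularOutside F E) {G : MvPolynomial (Fin 2) ℝ} {t : ℕ} (ht : G.support.card ≤ t)
    (n : ℕ) : ∀ (k : ℕ) (e : ℕ → Fin 2 →₀ ℕ), k + n = t → (∀ j < k, e j ∈ G.support) →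
      (∀ j ≤ k, ¬ F ∣ iterWronskian (curveDerivation F) j fun j => monomial (e j) 1) →
      ¬ F ∣ iterWronskian (curveDerivation F) (k + 1)
        (Function.update (fun j => monomial (e j) 1) k G) →
      (regularZeros F E (iterWronskian (curveDerivation F) (k + 1)
        (Function.update (fun j => monomial (e j) 1) k G))).ncard ≤
        n * (3 * (F.totalDegree ^ 2 * t ^ 2) + (E.card + 1) * F.totalDegree) := by
  classical
  induction n with
  | zero | succ n ih =>
    intro k e hkn he hW hG
    set D := curveDerivation F
    set f : ℕ → MvPolynomial (Fin 2) ℝ := fun j => monomial (e j) 1 with hf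
    obtain ⟨m, hm, hmW⟩ : ∃ m ∈ G.support, ¬ F ∣ iterWronskian D (k + 1)
        (Function.update f k (monomial m 1)) := by
      by_contra! hall
      apply hG
      have hsum : G = ∑ m ∈ G.support, G.coeff m • monomial m (1 : ℝ) := by
        conv_lhs => rw [G.as_sum]
        exact Finset.sum_congr rfl fun m _ => by rw [smul_monomial, smul_eq_mul, mul_one]
      rw [hsum]
      have := (isDiffOp_iterWronskian D k f).map_sum_smul G.support (fun m => G.coeff m)
        (fun m => monomial m (1 : ℝ))
      rw [this]
      exact Finset.dvd_sum fun m hm => (hall m hm).trans ⟨C (G.coeff m), by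
        rw [smul_eq_C_mul, mul_comm]⟩
    set e' := Function.update e k m with he'
    have hf' : Function.update f k (monomial m 1) = fun j => monomial (e' j) 1 := by
      funext j
      by_cases hj : j = k
      · subst hj; simp [he']
      · simp [he', hj, hf]
    have hmem : ∀ j < k + 1, e' j ∈ G.support := by
      intro j hj
      by_cases hjk : j = k
      · subst hjk; simpa [he'] using hm
      · simpa [he', hjk] using he j (by omega)
    have hcong : ∀ j ≤ k, iterWronskian D j (fun j => monomial (e' j) 1) =
        iterWronskian D j f := fun j hj => by
      rw [← hf', iterWronskian_update_of_le D f _ hj]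
    have hW' : ∀ j ≤ k + 1, ¬ F ∣ iterWronskian D j fun j => monomial (e' j) 1 := by
      intro j hj
      rcases hj.lt_or_eq with hj | rfl
      · rw [hcong j (by omega)]
        exact hW j (by omega)
      · rwa [← hf']
    have hne : iterWronskian D (k + 1) (fun j => monomial (e' j) 1) ≠ 0 := fun h0 =>
      hW' (k + 1) le_rfl (h0 ▸ dvd_zero F)
    have hcard : k + 1 ≤ G.support.card := by
      have hinj : Set.InjOn e' (Finset.range (k + 1) : Set ℕ) := by
        intro i hi j hj hij
        by_contra hne'
        exact hne (iterWronskian_eq_zero_of_eq D (by simpa using hi) (by simpa using hj) hne'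
          (by simp only [hij]))
      have := Finset.card_le_card_of_injOn e' (fun j hj => hmem j (by simpa using hj)) hinj
      simpa using this
    first
    | omega
    | have hid := iterWronskian_derivation D k (fun j => monomial (e' j) 1) hne G
      have hupd : Function.update (fun j => monomial (e' j) (1 : ℝ)) k G =
          Function.update f k G := by
        rw [← hf', Function.update_idem]
      rw [hupd, hcong k le_rfl, show k + 2 = k + 1 + 1 from rfl] at hid
      obtain ⟨hwf, hwc⟩ := ncard_regularZeros_iterWronskian_le hF hd h (by omega : k + 1 ≤ t) e'
        (hW' (k + 1) le_rfl)
      obtain ⟨hkf, hkc⟩ := ncard_regularZeros_iterWronskian_le hF hd h (by omega : k ≤ t) e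
        (hW k le_rfl)
      have huf := (ncard_regularZeros_le_mul hF hG E).1
      set B := F.totalDegree ^ 2 * t ^ 2
      set N := (E.card + 1) * F.totalDegree
      by_cases hdvd : F ∣ iterWronskian D (k + 1 + 1)
          (Function.update (fun j => monomial (e' j) 1) (k + 1) G)
      · have hsub := h.regularZeros_subset huf
          (w := iterWronskian D (k + 1) fun j => monomial (e' j) 1)
          (by rw [hid]; exact hdvd.mul_left _)
        calc _ ≤ _ := Set.ncard_le_ncard hsub hwf
          _ ≤ B := hwc
          _ ≤ (n + 1) * (3 * B + N) := by nlinarith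
      · have hrec := ih (k + 1) e' (by omega) hmem hW' hdvd
        have hvf := (ncard_regularZeros_le_mul hF hdvd E).1
        have hv := h.ncard_regularZeros_le huf hwf (by
          rw [hid, regularZeros_mul]
          exact hkf.union hvf)
        rw [hid, regularZeros_mul] at hv
        change _ ≤ _ + N at hv
        have hun := Set.ncard_union_le
          (regularZeros F E (iterWronskian D k f)) (regularZeros F E (iterWronskian D (k + 1 + 1)
            (Function.update (fun j => monomial (e' j) 1) (k + 1) G)))
        have hring : (n + 1) * (3 * B + N) = n * (3 * B + N) + 3 * B + N := by ring
        rw [hring]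
        have hkc' : (regularZeros F E (iterWronskian D k f)).ncard ≤ B := hkc
        linarith

theorem ncard_regularZeros_sparse_le (hF : Irreducible F) (hd : 1 ≤ F.totalDegree)
    (h : IsRegularOutside F E) {G : MvPolynomial (Fin 2) ℝ} {t : ℕ} (ht : G.support.card ≤ t)
    (hG : ¬ F ∣ G) :
    (regularZeros F E G).ncard ≤
      t * (3 * (F.totalDegree ^ 2 * t ^ 2) + (E.card + 1) * F.totalDegree) := by
  have hW1 : iterWronskian (curveDerivation F) (0 + 1)
      (Function.update (fun j => monomial ((fun _ => 0 : ℕ → Fin 2 →₀ ℕ) j) 1) 0 G) = G := by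
    simp [iterWronskian]
  have := ncard_regularZeros_update_le hF hd h ht t 0 (fun _ => 0) (by omega) (by simp)
    (fun j hj => by
      obtain rfl : j = 0 := by omega
      simpa [iterWronskian, ← isUnit_iff_dvd_one] using hF.not_isUnit) (by rwa [hW1])
  rwa [hW1] at this

end Bound

section Covers

/-- `S` is a union of at most `n` preconnected sets. -/
def HasPreconnectedCover {α : Type*} [TopologicalSpace α] (S : Set α) (n : ℕ) : Prop :=
  ∃ T : Finset (Set α), T.card ≤ n ∧ (∀ s ∈ T, IsPreconnected s) ∧ ⋃₀ (T : Set (Set α)) = S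

namespace HasPreconnectedCover

variable {α : Type*} [TopologicalSpace α] {S S' : Set α} {m n : ℕ}

theorem mono (h : HasPreconnectedCover S m) (hmn : m ≤ n) : HasPreconnectedCover S n := by
  obtain ⟨T, h1, h2⟩ := h
  exact ⟨T, h1.trans hmn, h2⟩

theorem empty : HasPreconnectedCover (∅ : Set α) n :=
  ⟨∅, by simp, by simp, by simp⟩

theorem of_isPreconnected (h : IsPreconnected S) : HasPreconnectedCover S 1 :=
  ⟨{S}, by simp, by simpa using h, by simp⟩

theorem union (h : HasPreconnectedCover S m) (h' : HasPreconnectedCover S' n) :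
    HasPreconnectedCover (S ∪ S') (m + n) := by
  classical
  obtain ⟨T, h1, h2, rfl⟩ := h
  obtain ⟨T', h1', h2', rfl⟩ := h'
  refine ⟨T ∪ T', (Finset.card_union_le _ _).trans (by omega), fun s hs => ?_, ?_⟩
  · exact (Finset.mem_union.mp hs).elim (h2 s) (h2' s)
  · rw [Finset.coe_union, Set.sUnion_union]

theorem biUnion {ι : Type*} (I : Finset ι) {f : ι → Set α}
    (h : ∀ i ∈ I, HasPreconnectedCover (f i) n) :
    HasPreconnectedCover (⋃ i ∈ I, f i) (I.card * n) := by
  classical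
  induction I using Finset.induction_on with
  | empty => simpa using empty
  | insert a I ha ih =>
    rw [Finset.set_biUnion_insert, Finset.card_insert_of_notMem ha, add_mul, one_mul, add_comm]
    exact (h a (Finset.mem_insert_self a I)).union
      (ih fun i hi => h i (Finset.mem_insert_of_mem hi))

theorem of_finite (hS : S.Finite) (hn : S.ncard ≤ n) : HasPreconnectedCover S n := by
  have h := biUnion (n := 1) hS.toFinset (f := fun p => {p})
    fun p _ => of_isPreconnected isPreconnected_singleton
  rw [mul_one, ← Set.ncard_eq_toFinset_card S hS] at h
  simpa using h.mono hn

theorem image {β : Type*} [TopologicalSpace β] (h : HasPreconnectedCover S n) {f : α → β}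
    (hf : Continuous f) : HasPreconnectedCover (f '' S) n := by
  classical
  obtain ⟨T, h1, h2, rfl⟩ := h
  refine ⟨T.image (Set.image f), Finset.card_image_le.trans h1, fun s hs => ?_, ?_⟩
  · obtain ⟨u, hu, rfl⟩ := Finset.mem_image.mp hs
    exact (h2 u hu).image f hf.continuousOn
  · rw [Finset.coe_image, Set.sUnion_image, Set.sUnion_eq_biUnion, Set.image_iUnion₂]

/-- A union of `n` preconnected sets has at most `n` connected components. -/
theorem card_connectedComponents_le (h : HasPreconnectedCover S n) :
    Finite (ConnectedComponents S) ∧ Nat.card (ConnectedComponents S) ≤ n := by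
  obtain ⟨T, h1, h2, hT⟩ := h
  have hex : ∀ c : ConnectedComponents S, ∃ s : T, ∃ p : S, (p : ConnectedComponents S) = c ∧
      (p : α) ∈ (s : Set α) := by
    intro c
    obtain ⟨p, rfl⟩ := ConnectedComponents.surjective_coe c
    have hp : (p : α) ∈ ⋃₀ (T : Set (Set α)) := hT ▸ p.2
    obtain ⟨s, hs, hps⟩ := hp
    exact ⟨⟨s, hs⟩, p, rfl, hps⟩
  choose s p hp hps using hex
  have hinj : Function.Injective s := by
    intro c c' hcc
    rw [← hp c, ← hp c', ConnectedComponents.coe_eq_coe]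
    refine (connectedComponent_eq ?_).symm
    have hsub : (s c : Set α) ⊆ S := hT ▸ Set.subset_sUnion_of_mem (s c).2
    have hpre : IsPreconnected ((↑) ⁻¹' (s c : Set α) : Set S) := by
      rw [← Topology.IsInducing.subtypeVal.isPreconnected_image,
        Subtype.image_preimage_coe, Set.inter_eq_right.mpr hsub]
      exact h2 _ (s c).2
    exact hpre.subset_connectedComponent (x := p c') (by
      rw [Set.mem_preimage, hcc]; exact hps c') (hps c)
  refine ⟨Finite.of_injective s hinj, (Nat.card_le_card_of_injective s hinj).trans ?_⟩
  simpa using h1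

end HasPreconnectedCover

end Covers

section Univariate

theorem signVariations_le_card_support (p : Polynomial ℝ) : p.signVariations ≤ p.support.card := by
  induction hn : p.support.card generalizing p with
  | zero => simp_all
  | succ n ih =>
    have h0 : p ≠ 0 := by rintro rfl; simp at hn
    have := Polynomial.signVariations_le_eraseLead_succ p
    have := ih p.eraseLead (Polynomial.card_support_eraseLead' hn)
    omega

theorem card_pos_roots_le (p : Polynomial ℝ) :
    (p.roots.toFinset.filter (0 < ·)).card ≤ p.support.card := by
  refine le_trans ?_ ((Polynomial.roots_countP_pos_le_signVariations p).trans
    (signVariations_le_card_support p))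
  rw [← Multiset.toFinset_filter, Multiset.countP_eq_card_filter]
  exact Multiset.toFinset_card_le _

/-- A real polynomial with `t` terms has at most `2t + 1` real roots. -/
theorem card_roots_toFinset_le_of_sparse (p : Polynomial ℝ) (hp : p ≠ 0) :
    p.roots.toFinset.card ≤ 2 * p.support.card + 1 := by
  classical
  have hq0 : p.comp (-Polynomial.X) ≠ 0 := Polynomial.comp_neg_X_eq_zero_iff.not.mpr hp
  have hsupp : (p.comp (-Polynomial.X)).support = p.support := by
    ext n
    have h : p.comp (-Polynomial.X) = p.comp (Polynomial.C (-1) * Polynomial.X) := by simp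
    simp [h, Polynomial.comp_C_mul_X_coeff]
  have hsub : p.roots.toFinset ⊆ p.roots.toFinset.filter (0 < ·) ∪
      ((p.comp (-Polynomial.X)).roots.toFinset.filter (0 < ·)).image Neg.neg ∪ {0} := by
    intro x hx
    simp only [Multiset.mem_toFinset, Polynomial.mem_roots hp, Polynomial.IsRoot] at hx
    rcases lt_trichotomy x 0 with h | h | h
    · refine Finset.mem_union_left _ (Finset.mem_union_right _ (Finset.mem_image.mpr ⟨-x, ?_, ?_⟩))
      · simp [hp, hx, h]
      · simp
    · simp [h]
    · simp [hp, hx, h]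
  refine (Finset.card_le_card hsub).trans ((Finset.card_union_le _ _).trans ?_)
  have h1 := Finset.card_union_le (p.roots.toFinset.filter (0 < ·))
    (((p.comp (-Polynomial.X)).roots.toFinset.filter (0 < ·)).image Neg.neg)
  have h2 := card_pos_roots_le p
  have h3 := card_pos_roots_le (p.comp (-Polynomial.X))
  have h4 := Finset.card_image_le (s := (p.comp (-Polynomial.X)).roots.toFinset.filter (0 < ·))
    (f := Neg.neg)
  rw [hsupp] at h3
  rw [Finset.card_singleton]
  omega

theorem hasPreconnectedCover_zeros (p : Polynomial ℝ) {t : ℕ} (ht : 1 ≤ t)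
    (hp : p.support.card ≤ t) : HasPreconnectedCover {y : ℝ | p.eval y = 0} (3 * t) := by
  by_cases h0 : p = 0
  · subst h0
    simpa using (HasPreconnectedCover.of_isPreconnected (isPreconnected_univ (α := ℝ))).mono
      (by omega)
  · have hset : {y : ℝ | p.eval y = 0} = p.roots.toFinset := by
      ext y
      simp [h0]
    have := card_roots_toFinset_le_of_sparse p h0
    rw [hset]
    refine HasPreconnectedCover.of_finite (Finset.finite_toSet _) ?_
    rw [Set.ncard_coe_finset]
    omega

end Univariate

section Irreducible

variable {F : MvPolynomial (Fin 2) ℝ}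

theorem not_dvd_X_zero (hF : Irreducible F) (h : pderiv 1 F ≠ 0) : ¬ F ∣ X 0 := by
  intro hdvd
  obtain ⟨u, hu⟩ := (hF.dvd_irreducible_iff_associated X_prime.irreducible).mp hdvd
  obtain ⟨c, hc, hcu⟩ := MvPolynomial.isUnit_iff_eq_C_of_isReduced.mp u.isUnit
  rw [hcu] at hu
  have h1 : pderiv 1 F * C c = 0 := by
    have := congrArg (pderiv 1) hu
    simpa [Derivation.leibniz, mul_comm] using this
  have h2 : (C c : MvPolynomial (Fin 2) ℝ) ≠ 0 := hcu ▸ u.ne_zero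
  exact h ((mul_eq_zero.mp h1).resolve_right h2)

theorem one_le_totalDegree_of_pderiv_ne_zero (h : pderiv 1 F ≠ 0) : 1 ≤ F.totalDegree := by
  by_contra hlt
  rw [totalDegree_eq_zero_iff_eq_C.mp (by omega : F.totalDegree = 0)] at h
  simp at h

theorem exists_isRegularOutside (hF : Irreducible F) (h : pderiv 1 F ≠ 0) (h1 : ¬ F ∣ X 1) :
    ∃ E : Finset ℝ, IsRegularOutside F E ∧ E.card ≤ 3 * F.totalDegree ^ 2 := by
  classical
  have hd := one_le_totalDegree_of_pderiv_ne_zero h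
  have hQ : ¬ F ∣ pderiv 1 F * X 0 * X 1 := by
    rw [hF.prime.dvd_mul, hF.prime.dvd_mul]
    rintro ((h' | h') | h')
    · have := totalDegree_le_of_dvd_of_isDomain h' h
      have := totalDegree_pderiv_le 1 F
      omega
    · exact not_dvd_X_zero hF h h'
    · exact h1 h'
  have hQd : (pderiv 1 F * X 0 * X 1).totalDegree ≤ F.totalDegree + 1 := by
    have h2 := totalDegree_mul (pderiv 1 F * X 0) (X 1)
    have h3 := totalDegree_mul (pderiv 1 F) (X 0)
    have h4 := totalDegree_pderiv_le 1 F
    rw [totalDegree_X] at h2 h3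
    omega
  obtain ⟨hfin, hcard⟩ := ncard_common_zeros_le hF hQ
  have hlc : (inY F).leadingCoeff ≠ 0 :=
    Polynomial.leadingCoeff_ne_zero.mpr (inY_eq_zero_iff.not.mpr hF.ne_zero)
  refine ⟨(inY F).leadingCoeff.roots.toFinset ∪ hfin.toFinset.image Prod.fst, ?_, ?_⟩
  · have hQ0 : ∀ x ∉ (inY F).leadingCoeff.roots.toFinset ∪ hfin.toFinset.image Prod.fst, ∀ y,
        eval ![x, y] F = 0 → eval ![x, y] (pderiv 1 F) * x * y ≠ 0 := by
      intro x hx y hy h0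
      refine hx (Finset.mem_union_right _ (Finset.mem_image.mpr ⟨(x, y), ?_, rfl⟩))
      rw [Set.Finite.mem_toFinset]
      exact ⟨hy, by simpa using h0⟩
    refine ⟨fun x hx h0 => hx (Finset.mem_union_left _ (by simpa [hlc] using h0)),
      fun x hx y hy h0 => hQ0 x hx y hy (by simp [h0]),
      fun x hx y hy h0 => hQ0 x hx y hy (by simp [h0]),
      fun x hx y hy h0 => hQ0 x hx y hy (by simp [h0])⟩
  · refine (Finset.card_union_le _ _).trans ?_
    have h2 : (inY F).leadingCoeff.roots.toFinset.card ≤ F.totalDegree :=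
      (Multiset.toFinset_card_le _).trans ((Polynomial.card_roots' _).trans
        (natDegree_coeff_inY_le F _))
    have h3 : (hfin.toFinset.image Prod.fst).card ≤ F.totalDegree * (F.totalDegree + 1) := by
      refine Finset.card_image_le.trans ?_
      rw [← Set.ncard_eq_toFinset_card _ hfin]
      exact hcard.trans (Nat.mul_le_mul_left _ hQd)
    nlinarith

theorem finite_and_ncard_zeros_over_le (hs : ∀ x, slice F x ≠ 0) (E : Finset ℝ) :
    {p : ℝ × ℝ | p.1 ∈ E ∧ eval ![p.1, p.2] F = 0}.Finite ∧
      {p : ℝ × ℝ | p.1 ∈ E ∧ eval ![p.1, p.2] F = 0}.ncard ≤ E.card * F.totalDegree := by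
  classical
  have hset : {p : ℝ × ℝ | p.1 ∈ E ∧ eval ![p.1, p.2] F = 0} =
      E.biUnion fun x => (slice F x).roots.toFinset.image (Prod.mk x) := by
    ext ⟨x, y⟩
    simp [hs, Polynomial.IsRoot, eval_slice, and_comm]
  rw [hset]
  refine ⟨Finset.finite_toSet _, ?_⟩
  rw [Set.ncard_coe_finset]
  exact Finset.card_biUnion_le_card_mul _ _ _ fun x _ =>
    Finset.card_image_le.trans (card_roots_slice_le F x)

/-- An irreducible curve is a union of few points and arcs. -/
theorem hasPreconnectedCover_of_dvd (hF : Irreducible F) (h : pderiv 1 F ≠ 0)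
    {E : Finset ℝ} (hE : IsRegularOutside F E) :
    HasPreconnectedCover {p : ℝ × ℝ | eval ![p.1, p.2] F = 0}
      ((E.card + 1) * F.totalDegree + E.card * F.totalDegree) := by
  classical
  obtain ⟨h1, h2⟩ := finite_and_ncard_zeros_over_le (slice_ne_zero hF h) E
  set I := Finset.range (E.card + 1) ×ˢ Finset.range F.totalDegree with hI
  have harc : ∀ k ∈ I, HasPreconnectedCover
      {p : ℝ × ℝ | p.1 ∉ E ∧ eval ![p.1, p.2] F = 0 ∧ arcIndex F E p = k} 1 := by
    rintro ⟨i, j⟩ -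
    refine HasPreconnectedCover.of_isPreconnected ?_
    rcases Set.eq_empty_or_nonempty
      {p : ℝ × ℝ | p.1 ∉ E ∧ eval ![p.1, p.2] F = 0 ∧ arcIndex F E p = (i, j)} with h0 | ⟨q, hq⟩
    · rw [h0]
      exact isPreconnected_empty
    · obtain ⟨q1, q2, q3⟩ := hq
      have hqi : q.1 ∈ gap E i := ⟨q1, congrArg Prod.fst q3⟩
      have hqj : (rootList F q.1).idxOf q.2 = j := congrArg Prod.snd q3
      have hj : j < (rootList F q.1).length := hqj ▸ hE.idxOf_lt q1 q2
      have himage : {p : ℝ × ℝ | p.1 ∉ E ∧ eval ![p.1, p.2] F = 0 ∧ arcIndex F E p = (i, j)} =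
          (fun x => (x, branch F j x)) '' gap E i := by
        ext p
        constructor
        · rintro ⟨p1, p2, p3⟩
          have hpj : (rootList F p.1).idxOf p.2 = j := congrArg Prod.snd p3
          exact ⟨p.1, ⟨p1, congrArg Prod.fst p3⟩,
            Prod.ext rfl (hpj ▸ hE.branch_idxOf p1 p2)⟩
        · rintro ⟨x, hx, rfl⟩
          have hjx := hE.length_rootList_eq hqi hx ▸ hj
          exact ⟨hx.1, hE.eval_branch hx.1 hjx, IsRegularOutside.arcIndex_branch hx hjx⟩
      rw [himage]
      exact (isPreconnected_gap E i).image _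
        (continuousOn_id.prodMk (hE.continuousOn_branch hqi hj))
  have hcov := (HasPreconnectedCover.biUnion I harc).union (HasPreconnectedCover.of_finite h1 h2)
  have hset : (⋃ k ∈ I, {p : ℝ × ℝ | p.1 ∉ E ∧ eval ![p.1, p.2] F = 0 ∧ arcIndex F E p = k}) ∪
      {p : ℝ × ℝ | p.1 ∈ E ∧ eval ![p.1, p.2] F = 0} =
      {p : ℝ × ℝ | eval ![p.1, p.2] F = 0} := by
    ext p
    simp only [Set.mem_union, Set.mem_iUnion, Set.mem_ofPred_eq, exists_prop]
    constructor
    · rintro (⟨k, -, hp⟩ | hp)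
      · exact hp.2.1
      · exact hp.2
    · intro hp
      by_cases hpE : p.1 ∈ E
      · exact Or.inr ⟨hpE, hp⟩
      · exact Or.inl ⟨_, hE.arcIndex_mem hpE hp, hpE, hp, rfl⟩
  rw [hset] at hcov
  refine hcov.mono ?_
  simp [hI]

theorem card_support_slice_le (G : MvPolynomial (Fin 2) ℝ) (c : ℝ) :
    (slice G c).support.card ≤ G.support.card := by
  classical
  refine (Finset.card_le_card fun j hj => ?_).trans
    (Finset.card_image_le (s := G.support) (f := fun e => e 1))
  rw [Polynomial.mem_support_iff, slice, Polynomial.coeff_map] at hj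
  have hne : (inY G).coeff j ≠ 0 := fun h0 => hj (by simp [h0])
  obtain ⟨i, hi⟩ := Polynomial.support_nonempty.mpr hne
  rw [Polynomial.mem_support_iff, coeff_coeff_inY] at hi
  exact Finset.mem_image.mpr ⟨_, mem_support_iff.mpr hi, by simp⟩

theorem card_support_coeff_zero_inY_le (G : MvPolynomial (Fin 2) ℝ) :
    ((inY G).coeff 0).support.card ≤ G.support.card := by
  classical
  refine (Finset.card_le_card fun i hi => ?_).trans
    (Finset.card_image_le (s := G.support) (f := fun e => e 0))
  rw [Polynomial.mem_support_iff, coeff_coeff_inY] at hi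
  exact Finset.mem_image.mpr ⟨_, mem_support_iff.mpr hi, by simp⟩

theorem eval_pair_zero (G : MvPolynomial (Fin 2) ℝ) (x : ℝ) :
    eval ![x, 0] G = ((inY G).coeff 0).eval x := by
  rw [← eval_slice, ← Polynomial.coeff_zero_eq_eval_zero, slice, Polynomial.coeff_map]
  rfl

theorem hasPreconnectedCover_of_dvd_X_one (hF : Irreducible F) (h : F ∣ X 1)
    {G : MvPolynomial (Fin 2) ℝ} {t : ℕ} (ht : 1 ≤ t) (hG : G.support.card ≤ t) :
    HasPreconnectedCover {p : ℝ × ℝ | eval ![p.1, p.2] F = 0 ∧ eval ![p.1, p.2] G = 0}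
      (3 * t) := by
  have hdvd := ((hF.dvd_irreducible_iff_associated X_prime.irreducible).mp h).symm.dvd
  have hzero : ∀ x y, eval ![x, y] F = 0 ↔ y = 0 := by
    intro x y
    constructor
    · intro h0
      obtain ⟨u, hu⟩ := h
      simpa [h0] using congrArg (eval ![x, y]) hu
    · rintro rfl
      obtain ⟨u, hu⟩ := hdvd
      simp [hu]
  have hcov := (hasPreconnectedCover_zeros ((inY G).coeff 0) ht
    ((card_support_coeff_zero_inY_le G).trans hG)).image
    (f := fun x => (x, (0 : ℝ))) (by fun_prop)
  convert hcov using 1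
  ext ⟨x, y⟩
  simp only [Set.mem_ofPred_eq, hzero, Set.mem_image, Prod.mk.injEq]
  constructor
  · rintro ⟨rfl, hx⟩
    exact ⟨x, by rwa [← eval_pair_zero], rfl, rfl⟩
  · rintro ⟨x, hx, rfl, rfl⟩
    exact ⟨rfl, by rwa [eval_pair_zero]⟩

theorem hasPreconnectedCover_of_pderiv_eq_zero (hF : F ≠ 0) (h : pderiv 1 F = 0)
    {G : MvPolynomial (Fin 2) ℝ} {t : ℕ} (ht : 1 ≤ t) (hG : G.support.card ≤ t) :
    HasPreconnectedCover {p : ℝ × ℝ | eval ![p.1, p.2] F = 0 ∧ eval ![p.1, p.2] G = 0}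
      (F.totalDegree * (3 * t)) := by
  obtain ⟨a, ha⟩ := inY_eq_C_of_pderiv_eq_zero h
  have ha0 : a ≠ 0 := by
    rintro rfl
    exact hF (inY_eq_zero_iff.mp (by simpa using ha))
  have had : a.roots.toFinset.card ≤ F.totalDegree := by
    have := natDegree_coeff_inY_le F 0
    rw [ha, Polynomial.coeff_C_zero] at this
    exact (Multiset.toFinset_card_le _).trans ((Polynomial.card_roots' _).trans this)
  have heval : ∀ x y, eval ![x, y] F = a.eval x := by
    intro x y
    rw [← eval_slice, slice, ha, Polynomial.map_C, Polynomial.eval_C]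
    rfl
  have hcov := HasPreconnectedCover.biUnion a.roots.toFinset fun c _ =>
    (hasPreconnectedCover_zeros (slice G c) ht ((card_support_slice_le G c).trans hG)).image
      (f := fun y => (c, y)) (by fun_prop)
  refine HasPreconnectedCover.mono ?_ (Nat.mul_le_mul_right _ had)
  convert hcov using 1
  ext ⟨x, y⟩
  simp [heval, eval_slice, ha0, and_comm]

theorem hasPreconnectedCover_of_irreducible (hF : Irreducible F) (hd : 1 ≤ F.totalDegree)
    {G : MvPolynomial (Fin 2) ℝ} {t : ℕ} (ht : 1 ≤ t) (hG : G.support.card ≤ t) :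
    HasPreconnectedCover {p : ℝ × ℝ | eval ![p.1, p.2] F = 0 ∧ eval ![p.1, p.2] G = 0}
      (7 * F.totalDegree ^ 3 * t + 3 * F.totalDegree ^ 2 * t ^ 3) := by
  have hd3 : F.totalDegree ≤ F.totalDegree ^ 3 := Nat.le_self_pow (by norm_num) _
  by_cases h1 : F ∣ X 1
  · refine (hasPreconnectedCover_of_dvd_X_one hF h1 ht hG).mono ?_
    have : 1 * t ≤ F.totalDegree ^ 3 * t := Nat.mul_le_mul_right _ (hd.trans hd3)
    nlinarith [Nat.zero_le (3 * F.totalDegree ^ 2 * t ^ 3)]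
  by_cases h : pderiv 1 F = 0
  · refine (hasPreconnectedCover_of_pderiv_eq_zero hF.ne_zero h ht hG).mono ?_
    have : F.totalDegree * t ≤ F.totalDegree ^ 3 * t := Nat.mul_le_mul_right _ hd3
    nlinarith [Nat.zero_le (3 * F.totalDegree ^ 2 * t ^ 3)]
  obtain ⟨E, hE, hEc⟩ := exists_isRegularOutside hF h h1
  set d := F.totalDegree with hdd
  have hover : E.card * d ≤ 3 * d ^ 3 := by
    calc E.card * d ≤ 3 * d ^ 2 * d := Nat.mul_le_mul_right _ hEc
      _ = 3 * d ^ 3 := by ring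
  have harcs : (E.card + 1) * d ≤ 4 * d ^ 3 := by linarith
  by_cases hdvd : F ∣ G
  · have hset : {p : ℝ × ℝ | eval ![p.1, p.2] F = 0 ∧ eval ![p.1, p.2] G = 0} =
        {p : ℝ × ℝ | eval ![p.1, p.2] F = 0} := by
      ext p
      obtain ⟨u, rfl⟩ := hdvd
      simp +contextual
    rw [hset]
    refine (hasPreconnectedCover_of_dvd hF h hE).mono ?_
    have : d ^ 3 * 1 ≤ d ^ 3 * t := Nat.mul_le_mul_left _ ht
    nlinarith [Nat.zero_le (3 * d ^ 2 * t ^ 3)]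
  · have hreg := ncard_regularZeros_sparse_le hF hd hE hG hdvd
    obtain ⟨hfin, -⟩ := ncard_regularZeros_le_mul hF hdvd E
    obtain ⟨hofin, hoc⟩ := finite_and_ncard_zeros_over_le (slice_ne_zero hF h) E
    have hsub : {p : ℝ × ℝ | eval ![p.1, p.2] F = 0 ∧ eval ![p.1, p.2] G = 0} ⊆
        regularZeros F E G ∪ {p : ℝ × ℝ | p.1 ∈ E ∧ eval ![p.1, p.2] F = 0} := by
      intro p hp
      by_cases hpE : p.1 ∈ E
      · exact Or.inr ⟨hpE, hp.1⟩
      · exact Or.inl ⟨hpE, hp⟩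
    have hufin := hfin.union hofin
    refine HasPreconnectedCover.of_finite (hufin.subset hsub)
      ((Set.ncard_le_ncard hsub hufin).trans ((Set.ncard_union_le _ _).trans ?_))
    have h2 : d ^ 3 * 1 ≤ d ^ 3 * t := Nat.mul_le_mul_left _ ht
    calc _ ≤ t * (3 * (d ^ 2 * t ^ 2) + 4 * d ^ 3) + 3 * d ^ 3 :=
          Nat.add_le_add (hreg.trans (Nat.mul_le_mul_left _ (Nat.add_le_add_left harcs _)))
            (hoc.trans hover)
      _ ≤ _ := by nlinarith

theorem hasPreconnectedCover_of_ne_zero (hF : F ≠ 0)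
    {G : MvPolynomial (Fin 2) ℝ} {t : ℕ} (ht : 1 ≤ t) (hG : G.support.card ≤ t) :
    HasPreconnectedCover {p : ℝ × ℝ | eval ![p.1, p.2] F = 0 ∧ eval ![p.1, p.2] G = 0}
      (7 * F.totalDegree ^ 3 * t + 3 * F.totalDegree ^ 2 * t ^ 3) := by
  induction F using UniqueFactorizationMonoid.induction_on_prime with
  | h₁ => exact absurd rfl hF
  | h₂ u hu =>
    obtain ⟨c, hc, rfl⟩ := MvPolynomial.isUnit_iff_eq_C_of_isReduced.mp hu
    simp [hc.ne_zero, HasPreconnectedCover.empty]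
  | h₃ a p ha hp ih =>
    have hset : {q : ℝ × ℝ | eval ![q.1, q.2] (p * a) = 0 ∧ eval ![q.1, q.2] G = 0} =
        {q : ℝ × ℝ | eval ![q.1, q.2] p = 0 ∧ eval ![q.1, q.2] G = 0} ∪
        {q : ℝ × ℝ | eval ![q.1, q.2] a = 0 ∧ eval ![q.1, q.2] G = 0} := by
      ext q
      simp only [map_mul, mul_eq_zero, Set.mem_ofPred_eq, Set.mem_union]
      tauto
    have hpd : 1 ≤ p.totalDegree := by
      by_contra hlt
      have hC := totalDegree_eq_zero_iff_eq_C.mp (by omega : p.totalDegree = 0)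
      have hc0 : p.coeff 0 ≠ 0 := fun h0 => hp.ne_zero (by rw [hC, h0, C_0])
      exact hp.not_isUnit (hC ▸ (isUnit_iff_ne_zero.mpr hc0).map C)
    rw [hset, totalDegree_mul_of_isDomain hp.ne_zero ha]
    refine ((hasPreconnectedCover_of_irreducible hp.irreducible hpd ht hG).union (ih ha)).mono ?_
    have hring : ∀ m n : ℕ, 7 * (m + n) ^ 3 * t + 3 * (m + n) ^ 2 * t ^ 3 =
        7 * m ^ 3 * t + 3 * m ^ 2 * t ^ 3 + (7 * n ^ 3 * t + 3 * n ^ 2 * t ^ 3) +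
          (21 * m * n * (m + n) * t + 6 * m * n * t ^ 3) := fun m n => by ring
    rw [hring]
    exact Nat.le_add_right _ _

end Irreducible

/-- **Koiran–Portier–Tavenas.** If `F ∈ ℝ[X,Y]` is nonzero of total degree `d ≥ 1` and
`G ∈ ℝ[X,Y]` is `t`-sparse (`t ≥ 1`), then the set of real solutions of
`F(x,y) = G(x,y) = 0` has at most `C · (d³t + d²t³)` connected components,
for an absolute constant `C > 0`. -/
theorem sparse_low_degree_connected_components :
    ∃ C : ℝ, 0 < C ∧
      ∀ (F G : MvPolynomial (Fin 2) ℝ) (d t : ℕ),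
        F ≠ 0 → F.totalDegree = d → 1 ≤ d → G.support.card ≤ t → 1 ≤ t →
        ∀ S : Set (ℝ × ℝ),
          S = {p : ℝ × ℝ | eval ![p.1, p.2] F = 0 ∧ eval ![p.1, p.2] G = 0} →
          Finite (ConnectedComponents S) ∧
            (Nat.card (ConnectedComponents S) : ℝ) ≤
              C * ((d : ℝ) ^ 3 * t + (d : ℝ) ^ 2 * (t : ℝ) ^ 3) := by
  refine ⟨7, by norm_num, ?_⟩
  rintro F G d t hF rfl - hG ht S rfl
  obtain ⟨h1, h2⟩ := (hasPreconnectedCover_of_ne_zero hF ht hG).card_connectedComponents_le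
  refine ⟨h1, (Nat.cast_le.mpr h2).trans ?_⟩
  push_cast
  have : (0 : ℝ) ≤ (F.totalDegree : ℝ) ^ 2 * (t : ℝ) ^ 3 := by positivity
  linarith
end

section
/- Let F ∈ ℝ[X,Y] be a nonzero bivariate polynomial of total degree d ≥ 1 that is irreducible in ℂ[X,Y], and let G ∈ ℝ[X,Y] be a bivariate t-sparse polynomial (t ≥ 1). Assume the system F(X,Y) = G(X,Y) = 0 has finitely many real solutions. Then there is an absolute constant C > 0 (independent of d, t, F, G) such that the number of distinct real solutions is at most C·(d³·t + d²·t³). -/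
open MvPolynomial

theorem two_mul_finrank_restrictTotalDegree_fin_two (K : Type*) [Field K] (k : ℕ) :
    2 * Module.finrank K (restrictTotalDegree (Fin 2) K k) = (k + 1) * (k + 2) := by
  let s : Finset (ℕ × ℕ) := (Finset.range (k + 1)).biUnion Finset.HasAntidiagonal.antidiagonal
  have e : {n : Fin 2 →₀ ℕ | (n.sum fun _ e => e) ≤ k} ≃ s :=
    (Finsupp.equivFunOnFinite.trans (finTwoArrowEquiv ℕ)).subtypeEquiv fun n => by
      simp [s, Finsupp.sum_fintype, Fin.sum_univ_two]
  have hs : s.card = ∑ i ∈ Finset.range (k + 1), (i + 1) := by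
    rw [Finset.card_biUnion]
    · simp
    · intro i _ j _ hij
      rw [Function.onFun, Finset.disjoint_left]
      intro a ha hb
      rw [Finset.HasAntidiagonal.mem_antidiagonal] at ha hb
      exact hij (ha.symm.trans hb)
  have h : Module.finrank K (restrictTotalDegree (Fin 2) K k) = s.card := by
    rw [restrictTotalDegree, Module.finrank_eq_nat_card_basis (basisRestrictSupport K _),
      Nat.card_congr e]
    simp
  rw [h, hs]
  clear_value s
  clear e hs h s
  induction k with
  | zero => simp
  | succ k ih => rw [Finset.sum_range_succ, mul_add, ih]; ring

theorem exists_totalDegree_le_card_separating {K σ : Type*} [Field K] (T : Finset (σ → K))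
    (p : σ → K) :
    ∃ H : MvPolynomial σ K, H.totalDegree ≤ T.card ∧ eval p H ≠ 0 ∧
      ∀ q ∈ T, q ≠ p → eval q H = 0 := by
  classical
  have key : ∀ q : σ → K, ∃ L : MvPolynomial σ K, L.totalDegree ≤ 1 ∧
      (q ≠ p → eval p L ≠ 0 ∧ eval q L = 0) := by
    intro q
    by_cases hq : q = p
    · exact ⟨0, by simp, fun h => absurd hq h⟩
    · obtain ⟨i, hi⟩ := Function.ne_iff.mp hq
      refine ⟨X i - C (q i), (totalDegree_sub_C_le _ _).trans (by simp), fun _ => ?_⟩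
      simpa [sub_eq_zero] using fun h => hi h.symm
  choose L hL hL' using key
  refine ⟨∏ q ∈ T.erase p, L q, ?_, ?_, ?_⟩
  · calc _ ≤ ∑ q ∈ T.erase p, (L q).totalDegree := totalDegree_finsetProd _ _
      _ ≤ ∑ q ∈ T.erase p, 1 := Finset.sum_le_sum fun q _ => hL q
      _ ≤ T.card := by simpa using Finset.card_erase_le
  · rw [map_prod, Finset.prod_ne_zero_iff]
    exact fun q hq => (hL' q (Finset.ne_of_mem_erase hq)).1
  · intro q hq hqp
    rw [map_prod]
    exact Finset.prod_eq_zero (Finset.mem_erase.mpr ⟨hqp, hq⟩) (hL' q hqp).2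

/-- The upper bound in Bézout's theorem, for finite sets of common zeros. -/
theorem card_le_totalDegree_mul_totalDegree {K : Type*} [Field K] {F H : MvPolynomial (Fin 2) K}
    (hF : Prime F) (hFH : ¬ F ∣ H) (T : Finset (Fin 2 → K))
    (hT : ∀ p ∈ T, eval p F = 0 ∧ eval p H = 0) :
    T.card ≤ F.totalDegree * H.totalDegree := by
  classical
  have hF0 : F ≠ 0 := hF.ne_zero
  have hH0 : H ≠ 0 := fun h => hFH (h ▸ dvd_zero F)
  set d := F.totalDegree with hd
  set m := H.totalDegree with hm
  set N := T.card with hN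
  let V := fun k => restrictTotalDegree (Fin 2) K k
  let ev : V (d + m + N) →ₗ[K] (T → K) :=
    LinearMap.pi fun p => (aeval (R := K) p.1).toLinearMap.comp (V (d + m + N)).subtype
  have hev : ∀ (q : V (d + m + N)) (p : T), ev q p = eval p.1 q.1 := fun q p => by
    simp [ev, aeval_eq_eval]
  have hsurj : LinearMap.range ev = ⊤ := by
    rw [eq_top_iff, ← (Pi.basisFun K T).span_eq, Submodule.span_le]
    rintro _ ⟨p, rfl⟩
    obtain ⟨L, hL, hLp, hLq⟩ := exists_totalDegree_le_card_separating T p.1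
    refine ⟨(eval p.1 L)⁻¹ • ⟨L, (mem_restrictTotalDegree _ _ _).mpr (by omega)⟩, ?_⟩
    ext q
    rw [map_smul, Pi.smul_apply, hev]
    by_cases hqp : q = p
    · subst hqp; simp [hLp]
    · simp [hLq q.1 q.2 (fun h => hqp (Subtype.ext h)), hqp]
  have hmem : ∀ ab : V (m + N) × V (d + N), ab.1.1 * F + ab.2.1 * H ∈ V (d + m + N) := by
    rintro ⟨⟨a, ha⟩, ⟨b, hb⟩⟩
    simp only [V, mem_restrictTotalDegree] at ha hb ⊢
    refine (totalDegree_add _ _).trans (max_le ?_ ?_)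
    · exact (totalDegree_mul _ _).trans (by omega)
    · exact (totalDegree_mul _ _).trans (by omega)
  let Φ : V (m + N) × V (d + N) →ₗ[K] V (d + m + N) :=
    { toFun := fun ab => ⟨_, hmem ab⟩
      map_add' := fun a b => Subtype.ext (by
        simp only [Prod.fst_add, Prod.snd_add, Submodule.coe_add]; ring)
      map_smul' := fun c a => Subtype.ext (by
        simp [smul_add]) }
  have hΦ : ∀ ab, (Φ ab).1 = ab.1.1 * F + ab.2.1 * H := fun _ => rfl
  have hmemΨ : ∀ c : V N, c.1 * H ∈ V (m + N) ∧ -(c.1 * F) ∈ V (d + N) := by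
    rintro ⟨c, hc⟩
    simp only [V, mem_restrictTotalDegree, totalDegree_neg] at hc ⊢
    exact ⟨(totalDegree_mul _ _).trans (by omega), (totalDegree_mul _ _).trans (by omega)⟩
  let Ψ : V N →ₗ[K] V (m + N) × V (d + N) :=
    { toFun := fun c => (⟨_, (hmemΨ c).1⟩, ⟨_, (hmemΨ c).2⟩)
      map_add' := fun a b => Prod.ext (Subtype.ext (by simp [add_mul]))
        (Subtype.ext (by simp [add_mul]; ring))
      map_smul' := fun c a => Prod.ext (Subtype.ext (by simp)) (Subtype.ext (by simp)) }
  have hker : LinearMap.ker Φ ≤ LinearMap.range Ψ := by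
    rintro ⟨⟨a, ha⟩, ⟨b, hb⟩⟩ hab
    have h0 : a * F + b * H = 0 := congrArg Subtype.val (LinearMap.mem_ker.mp hab)
    have hdvd : F ∣ b * H := ⟨-a, by linear_combination h0⟩
    obtain ⟨c, rfl⟩ := (hF.dvd_or_dvd hdvd).resolve_right hFH
    have hc : c.totalDegree ≤ N := by
      by_cases hc0 : c = 0
      · simp [hc0]
      · have := (mem_restrictTotalDegree _ _ _).mp hb
        rw [totalDegree_mul_of_isDomain hF0 hc0] at this
        omega
    have ha' : a = -c * H := mul_right_cancel₀ hF0 (by linear_combination h0)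
    refine ⟨-⟨c, (mem_restrictTotalDegree _ _ _).mpr hc⟩,
      Prod.ext (Subtype.ext ?_) (Subtype.ext ?_)⟩
    · simp [Ψ, ha']
    · simp [Ψ, mul_comm]
  have hrange : LinearMap.range Φ ≤ LinearMap.ker ev := by
    rintro _ ⟨ab, rfl⟩
    rw [LinearMap.mem_ker]
    ext p
    rw [hev, hΦ]
    simp [(hT p.1 p.2).1, (hT p.1 p.2).2]
  have h1 := LinearMap.finrank_range_add_finrank_ker ev
  have h2 := LinearMap.finrank_range_add_finrank_ker Φ
  have h3 := (Submodule.finrank_mono hker).trans (LinearMap.finrank_range_le Ψ)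
  have h4 := Submodule.finrank_mono hrange
  rw [hsurj, finrank_top, Module.finrank_fintype_fun_eq_card, Fintype.card_coe] at h1
  rw [Module.finrank_prod] at h2
  have e1 := two_mul_finrank_restrictTotalDegree_fin_two K (d + m + N)
  have e2 := two_mul_finrank_restrictTotalDegree_fin_two K (m + N)
  have e3 := two_mul_finrank_restrictTotalDegree_fin_two K (d + N)
  have e4 := two_mul_finrank_restrictTotalDegree_fin_two K N
  simp only [V] at h1 h2 h3 h4
  nlinarith

theorem finite_zeros_and_ncard_le {F H : MvPolynomial (Fin 2) ℝ} (hF : Prime F) (hFH : ¬ F ∣ H) :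
    {p : ℝ × ℝ | eval ![p.1, p.2] F = 0 ∧ eval ![p.1, p.2] H = 0}.Finite ∧
    {p : ℝ × ℝ | eval ![p.1, p.2] F = 0 ∧ eval ![p.1, p.2] H = 0}.ncard ≤
      F.totalDegree * H.totalDegree := by
  have hinj : Function.Injective fun p : ℝ × ℝ => ![p.1, p.2] := fun p q h =>
    Prod.ext (congrFun h 0) (congrFun h 1)
  have key : ∀ T : Finset (ℝ × ℝ),
      (∀ p ∈ T, eval ![p.1, p.2] F = 0 ∧ eval ![p.1, p.2] H = 0) →
      T.card ≤ F.totalDegree * H.totalDegree := by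
    intro T hT
    rw [← Finset.card_map ⟨_, hinj⟩]
    refine card_le_totalDegree_mul_totalDegree hF hFH _ fun p hp => ?_
    obtain ⟨q, hq, rfl⟩ := Finset.mem_map.mp hp
    exact hT q hq
  have hfin : {p : ℝ × ℝ | eval ![p.1, p.2] F = 0 ∧ eval ![p.1, p.2] H = 0}.Finite := by
    by_contra hinf
    obtain ⟨T, hTs, hTc⟩ := Set.Infinite.exists_subset_card_eq hinf
      (F.totalDegree * H.totalDegree + 1)
    have := key T fun p hp => hTs hp
    omega
  refine ⟨hfin, ?_⟩
  rw [Set.ncard_eq_toFinset_card _ hfin]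
  exact key _ fun p hp => by simpa using hp

theorem Matrix.det_mul_det_fromBlocks_fin_two {m A : Type*} [Fintype m] [DecidableEq m]
    [CommRing A] [IsDomain A] (M : Matrix m m A) (B : Matrix m (Fin 2) A) (C : Matrix (Fin 2) m A)
    (E : Matrix (Fin 2) (Fin 2) A) (hM : M.det ≠ 0) (b : Fin 2 → Fin 2 → A)
    (hb : ∀ i j, b i j = (fromBlocks M (of fun x (_ : Fin 1) => B x j)
      (of fun (_ : Fin 1) x => C i x)
      (of fun _ _ => E i j)).det) :
    M.det * (fromBlocks M B C E).det = b 0 0 * b 1 1 - b 0 1 * b 1 0 := by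
  let φ := algebraMap A (FractionRing A)
  have hφ : Function.Injective φ := IsFractionRing.injective A (FractionRing A)
  have hdet : (φ.mapMatrix M).det ≠ 0 := by
    rw [← RingHom.map_det]
    exact fun h => hM (hφ (h.trans φ.map_zero.symm))
  have := invertibleOfIsUnitDet (φ.mapMatrix M) (Ne.isUnit hdet)
  have key : ∀ i j, φ (b i j) = (φ.mapMatrix M).det *
      (φ (E i j) - (C.map φ * ⅟(φ.mapMatrix M) * B.map φ) i j) := by
    intro i j
    rw [hb, RingHom.map_det, RingHom.mapMatrix_apply, fromBlocks_map, ← RingHom.mapMatrix_apply,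
      det_fromBlocks₁₁, det_fin_one]
    rfl
  apply hφ
  rw [map_mul, map_sub, map_mul, map_mul, key, key, key, key, RingHom.map_det, RingHom.map_det,
    RingHom.mapMatrix_apply (M := fromBlocks M B C E), fromBlocks_map, ← RingHom.mapMatrix_apply,
    det_fromBlocks₁₁, det_fin_two]
  simp only [sub_apply, map_apply]
  ring

namespace Derivation

variable {R A : Type*} [CommRing R] [CommRing A] [Algebra R A] (D : Derivation R A A)

theorem map_finset_prod {ι : Type*} [DecidableEq ι] (s : Finset ι) (f : ι → A) :
    D (∏ i ∈ s, f i) = ∑ i ∈ s, ∏ j ∈ s, Function.update f i (D (f i)) j := by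
  induction s using Finset.induction_on with
  | empty => simp
  | insert a s ha ih =>
    have h1 : ∏ j ∈ s, Function.update f a (D (f a)) j = ∏ j ∈ s, f j :=
      Finset.prod_congr rfl fun j hj => Function.update_of_ne (ne_of_mem_of_not_mem hj ha) _ _
    rw [Finset.prod_insert ha, leibniz, ih, Finset.sum_insert ha, Finset.prod_insert ha, h1,
      Function.update_self, smul_eq_mul, smul_eq_mul, add_comm, mul_comm, Finset.mul_sum]
    congr 1
    refine Finset.sum_congr rfl fun i hi => ?_
    rw [Finset.prod_insert ha, Function.update_of_ne (ne_of_mem_of_not_mem hi ha).symm]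

theorem map_det {n : Type*} [Fintype n] [DecidableEq n] (M : Matrix n n A) :
    D M.det = ∑ c, (M.updateCol c fun i => D (M i c)).det := by
  simp only [Matrix.det_apply, map_sum]
  rw [Finset.sum_comm]
  refine Finset.sum_congr rfl fun σ _ => ?_
  rw [← Finset.smul_sum, Units.smul_def, Units.smul_def, map_zsmul, map_finset_prod]
  congr 1
  refine Finset.sum_congr rfl fun c _ => Finset.prod_congr rfl fun i _ => ?_
  rw [Matrix.updateCol_apply, Function.update_apply]
  split_ifs with h <;> simp [h]

/-- The Wronskian of `f 0, …, f (n - 1)` with respect to the derivation `D`. -/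
noncomputable def wronskian (f : ℕ → A) (n : ℕ) : A :=
  (Matrix.of fun j i : Fin n => D^[i] (f j)).det

theorem wronskian_congr {f g : ℕ → A} {n : ℕ} (h : ∀ j < n, f j = g j) :
    D.wronskian f n = D.wronskian g n := by
  unfold wronskian
  congr 1
  ext j i
  simp [h j j.2]

theorem wronskian_zero (f : ℕ → A) : D.wronskian f 0 = 1 := Matrix.det_isEmpty

theorem wronskian_eq_zero {f : ℕ → A} {n i j : ℕ} (hi : i < n) (hj : j < n) (hij : i ≠ j)
    (h : f i = f j) : D.wronskian f n = 0 :=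
  Matrix.det_zero_of_row_eq (i := ⟨i, hi⟩) (j := ⟨j, hj⟩) (by simpa using hij)
    (funext fun x => by simp [h])

theorem wronskian_update_sum {ι : Type*} (s : Finset ι) (f : ℕ → A) (n : ℕ) (c : ι → R)
    (g : ι → A) :
    D.wronskian (Function.update f n (∑ i ∈ s, c i • g i)) (n + 1) =
      ∑ i ∈ s, c i • D.wronskian (Function.update f n (g i)) (n + 1) := by
  let M := Matrix.of fun j i : Fin (n + 1) => D^[i] (f j)
  have h : ∀ u, D.wronskian (Function.update f n u) (n + 1) =
      (M.updateRow (Fin.last n) fun i => D^[i] u).det := by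
    intro u
    unfold wronskian
    congr 1
    ext j i
    rcases Fin.eq_castSucc_or_eq_last j with ⟨j, rfl⟩ | rfl
    · simp [M, Matrix.updateRow_apply, j.2.ne, Fin.castSucc_ne_last]
    · simp
  let L : A →ₗ[R] A :=
    ((Matrix.detRowAlternating.toMultilinearMap.toLinearMap M (Fin.last n)).restrictScalars R).comp
      (LinearMap.pi fun i : Fin (n + 1) => (D : A →ₗ[R] A) ^ (i : ℕ))
  have hL : ∀ u, L u = D.wronskian (Function.update f n u) (n + 1) := by
    intro u
    rw [h]
    have : (fun i : Fin (n + 1) => D^[i] u) =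
        (LinearMap.pi fun i : Fin (n + 1) => (D : A →ₗ[R] A) ^ (i : ℕ)) u := by
      ext i
      simp [Module.End.pow_apply]
    rw [this]
    rfl
  simp only [← hL, map_sum]
  exact Finset.sum_congr rfl fun i _ => L.map_smul _ _

theorem det_fromBlocks_eq_det_update (f : ℕ → A) (n r : ℕ) (u : A) :
    (Matrix.fromBlocks (Matrix.of fun j i : Fin n => D^[i] (f j))
      (Matrix.of fun (j : Fin n) (_ : Fin 1) => D^[r] (f j))
      (Matrix.of fun (_ : Fin 1) (i : Fin n) => D^[i] u)
      (Matrix.of fun (_ : Fin 1) (_ : Fin 1) => D^[r] u)).det =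
    (Matrix.of fun j i : Fin (n + 1) =>
      D^[if (i : ℕ) < n then i else r] (Function.update f n u j)).det := by
  rw [← Matrix.det_submatrix_equiv_self finSumFinEquiv]
  congr 1
  ext (i | i) (j | j) <;> simp [i.2.ne]

theorem map_wronskian_succ (f : ℕ → A) (n : ℕ) :
    D (D.wronskian f (n + 1)) =
      (Matrix.of fun j i : Fin (n + 1) => D^[if (i : ℕ) < n then i else n + 1] (f j)).det := by
  unfold wronskian
  rw [map_det, Finset.sum_eq_single (Fin.last n)]
  · congr 1
    ext j i
    rcases Fin.eq_castSucc_or_eq_last i with ⟨i, rfl⟩ | rfl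
    · simp [Fin.castSucc_ne_last]
    · simp [Function.iterate_succ_apply']
  · intro c _ hc
    obtain ⟨c, rfl⟩ := Fin.exists_castSucc_eq.mpr hc
    refine Matrix.det_zero_of_column_eq (i := c.castSucc) (j := c.succ) (Fin.castSucc_lt_succ).ne
      fun k => ?_
    rw [Matrix.updateCol_self, Matrix.updateCol_ne (Fin.castSucc_lt_succ).ne']
    simp [Function.iterate_succ_apply']
  · simp

theorem wronskian_mul_wronskian_add_two [IsDomain A] (f : ℕ → A) (n : ℕ)
    (hn : D.wronskian f n ≠ 0) :
    D.wronskian f n * D.wronskian f (n + 2) =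
      D.wronskian f (n + 1) * D (D.wronskian (Function.update f n (f (n + 1))) (n + 1)) -
      D (D.wronskian f (n + 1)) * D.wronskian (Function.update f n (f (n + 1))) (n + 1) := by
  have h := Matrix.det_mul_det_fromBlocks_fin_two (Matrix.of fun j i : Fin n => D^[i] (f j))
    (Matrix.of fun (j : Fin n) (i : Fin 2) => D^[n + i] (f j))
    (Matrix.of fun (j : Fin 2) (i : Fin n) => D^[i] (f (n + j)))
    (Matrix.of fun (j : Fin 2) (i : Fin 2) => D^[n + i] (f (n + j))) hn
    (fun j i => (Matrix.of fun l k : Fin (n + 1) =>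
      D^[if (k : ℕ) < n then k else n + i] (Function.update f n (f (n + j)) l)).det)
    fun j i => (D.det_fromBlocks_eq_det_update f n (n + i) (f (n + j))).symm
  have h2 : (Matrix.fromBlocks (Matrix.of fun j i : Fin n => D^[i] (f j))
      (Matrix.of fun (j : Fin n) (i : Fin 2) => D^[n + i] (f j))
      (Matrix.of fun (j : Fin 2) (i : Fin n) => D^[i] (f (n + j)))
      (Matrix.of fun (j : Fin 2) (i : Fin 2) => D^[n + i] (f (n + j)))).det =
      D.wronskian f (n + 2) := by
    unfold wronskian
    rw [← Matrix.det_submatrix_equiv_self finSumFinEquiv]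
    congr 1
    ext (i | i) (j | j) <;> simp
  have h3 : ∀ g : ℕ → A, (Matrix.of fun l k : Fin (n + 1) =>
      D^[if (k : ℕ) < n then k else n] (g l)).det = D.wronskian g (n + 1) := by
    intro g
    unfold wronskian
    congr 1
    ext l k
    rcases Fin.eq_castSucc_or_eq_last k with ⟨k, rfl⟩ | rfl <;> simp
  rw [h2] at h
  simp only [Fin.val_zero, Fin.val_one, add_zero, Function.update_eq_self, h3,
    ← map_wronskian_succ] at h
  exact h

theorem wronskian_mul_wronskian_update [IsDomain A] (f : ℕ → A) (n : ℕ) (g : A)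
    (hn : D.wronskian f n ≠ 0) :
    D.wronskian f n * D.wronskian (Function.update f (n + 1) g) (n + 2) =
      D.wronskian f (n + 1) * D (D.wronskian (Function.update f n g) (n + 1)) -
      D (D.wronskian f (n + 1)) * D.wronskian (Function.update f n g) (n + 1) := by
  have h0 : D.wronskian (Function.update f (n + 1) g) n = D.wronskian f n :=
    D.wronskian_congr fun j hj => Function.update_of_ne (by omega) _ _
  have h1 : D.wronskian (Function.update f (n + 1) g) (n + 1) = D.wronskian f (n + 1) :=
    D.wronskian_congr fun j hj => Function.update_of_ne (by omega) _ _
  have h2 : D.wronskian (Function.update (Function.update f (n + 1) g) n g) (n + 1) =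
      D.wronskian (Function.update f n g) (n + 1) :=
    D.wronskian_congr fun j hj => by
      rcases eq_or_ne j n with rfl | hjn
      · simp
      · simp [hjn, hj.ne]
  have := D.wronskian_mul_wronskian_add_two (Function.update f (n + 1) g) n (by rwa [h0])
  rwa [Function.update_self, h0, h1, h2] at this

end Derivation

open Filter Topology in
/-- The zero set of `Φ` over the open set `U` is a proper étale cover of `U`, with fibre `N x` over
`x ∈ U`; `Φx` and `Φy` are the partial derivatives of `Φ`. -/
structure IsProperEtale (Φ Φx Φy : ℝ × ℝ → ℝ) (N : ℝ → Finset ℝ) (U : Set ℝ) : Prop where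
  isOpen : IsOpen U
  hasStrictFDerivAt (v : ℝ × ℝ) : HasStrictFDerivAt Φ
    (Φx v • ContinuousLinearMap.fst ℝ ℝ ℝ + Φy v • ContinuousLinearMap.snd ℝ ℝ ℝ) v
  mem_iff {x : ℝ} (hx : x ∈ U) (y : ℝ) : y ∈ N x ↔ Φ (x, y) = 0
  ne_zero {x : ℝ} (hx : x ∈ U) {y : ℝ} (hy : y ∈ N x) : Φy (x, y) ≠ 0
  bounded {x : ℝ} (hx : x ∈ U) : ∃ K : ℝ, ∀ᶠ x' in 𝓝 x, ∀ y, Φ (x', y) = 0 → |y| ≤ K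

open Filter Topology in
theorem exists_implicit_function {Φ : ℝ × ℝ → ℝ} {a b x₀ y₀ : ℝ}
    (h : HasStrictFDerivAt Φ
      (a • ContinuousLinearMap.fst ℝ ℝ ℝ + b • ContinuousLinearMap.snd ℝ ℝ ℝ) (x₀, y₀))
    (h0 : Φ (x₀, y₀) = 0) (hb : b ≠ 0) :
    ∃ ψ : ℝ → ℝ, HasDerivAt ψ (-a / b) x₀ ∧ ψ x₀ = y₀ ∧
      ∀ᶠ v in 𝓝 (x₀, y₀), Φ v = 0 ↔ ψ v.1 = v.2 := by
  set L := a • ContinuousLinearMap.fst ℝ ℝ ℝ + b • ContinuousLinearMap.snd ℝ ℝ ℝ with hL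
  have hLr : L ∘SL ContinuousLinearMap.inr ℝ ℝ ℝ =
      (ContinuousLinearEquiv.unitsEquivAut ℝ (Units.mk0 b hb) : ℝ →L[ℝ] ℝ) := by
    ext; simp [hL]
  have hinv : (L ∘SL ContinuousLinearMap.inr ℝ ℝ ℝ).IsInvertible := ⟨_, hLr.symm⟩
  have h1 := h.eventually_apply_eq_iff_implicitFunctionOfProdDomain hinv
  have h2 := (h.hasStrictFDerivAt_implicitFunctionOfProdDomain hinv).hasFDerivAt.hasDerivAt
  simp only [h0] at h1
  refine ⟨_, ?_, h1.self_of_nhds.mp h0, h1⟩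
  have h3 : -a / b = (-(L ∘SL ContinuousLinearMap.inr ℝ ℝ ℝ).inverse ∘SL L ∘SL
      ContinuousLinearMap.inl ℝ ℝ ℝ) 1 := by
    rw [hLr, ContinuousLinearMap.inverse_equiv]
    simp [hL]
    field_simp
  rw [h3]
  exact h2

namespace IsProperEtale

open Filter Topology

variable {Φ Φx Φy : ℝ × ℝ → ℝ} {N : ℝ → Finset ℝ} {U : Set ℝ}

theorem continuous (h : IsProperEtale Φ Φx Φy N U) : Continuous Φ :=
  continuous_iff_continuousAt.mpr fun v => (h.hasStrictFDerivAt v).continuousAt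

theorem exists_implicit_function (h : IsProperEtale Φ Φx Φy N U) {x₀ y₀ : ℝ}
    (hx : x₀ ∈ U) (hy : y₀ ∈ N x₀) :
    ∃ ψ : ℝ → ℝ, HasDerivAt ψ (-Φx (x₀, y₀) / Φy (x₀, y₀)) x₀ ∧ ψ x₀ = y₀ ∧
      ∀ᶠ v in 𝓝 (x₀, y₀), Φ v = 0 ↔ ψ v.1 = v.2 :=
  _root_.exists_implicit_function (h.hasStrictFDerivAt _) ((h.mem_iff hx _).mp hy)
    (h.ne_zero hx hy)

theorem eventually_near (h : IsProperEtale Φ Φx Φy N U) {x₀ ε : ℝ} (hx : x₀ ∈ U) (hε : 0 < ε) :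
    ∀ᶠ x in 𝓝 x₀, ∀ y, Φ (x, y) = 0 → ∃ y₀ ∈ N x₀, |y - y₀| < ε := by
  obtain ⟨K, hK⟩ := h.bounded hx
  have := (isCompact_Icc (a := -K) (b := K)).eventually_forall_of_forall_eventually (x₀ := x₀)
    (P := fun x y => Φ (x, y) = 0 → ∃ y₀ ∈ N x₀, |y - y₀| < ε) fun y _ => by
      by_cases hy : Φ (x₀, y) = 0
      · have h1 : ∀ᶠ z : ℝ × ℝ in 𝓝 (x₀, y), |z.2 - y| < ε :=
          ContinuousAt.eventually_lt (by fun_prop) continuousAt_const (by simpa using hε)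
        filter_upwards [h1] with z hz _
        exact ⟨y, (h.mem_iff hx y).mpr hy, hz⟩
      · filter_upwards [h.continuous.continuousAt.eventually_ne hy] with z hz hz'
        exact absurd hz' hz
  filter_upwards [this, hK] with x h1 h2 y hy
  exact h1 y (abs_le.mp (h2 y hy)) hy

theorem exists_lift (h : IsProperEtale Φ Φx Φy N U) {x₀ y₀ ε : ℝ}
    (hx : x₀ ∈ U) (hy : y₀ ∈ N x₀) (hε : 0 < ε) :
    ∃ δ > 0, δ ≤ ε ∧ ∀ᶠ x in 𝓝 x₀, ∃ y ∈ N x, |y - y₀| < δ ∧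
      ∀ y' ∈ N x, |y' - y₀| < δ → y' = y := by
  obtain ⟨ψ, hψ, hψ0, hiff⟩ := h.exists_implicit_function hx hy
  rw [nhds_prod_eq] at hiff
  obtain ⟨p, hp, q, hq, hpq⟩ := eventually_prod_iff.mp hiff
  obtain ⟨δ, hδ, hball⟩ := Metric.eventually_nhds_iff.mp hq
  have hmin : 0 < min δ ε := lt_min hδ hε
  refine ⟨min δ ε, hmin, min_le_right _ _, ?_⟩
  have hcont : ∀ᶠ x in 𝓝 x₀, |ψ x - y₀| < min δ ε :=
    ContinuousAt.eventually_lt (by have := hψ.continuousAt; fun_prop) continuousAt_const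
      (by simpa [hψ0] using ⟨hδ, hε⟩)
  filter_upwards [hp, hcont, h.isOpen.mem_nhds hx] with x h1 h2 h3
  have h4 : ∀ y, |y - y₀| < min δ ε → (Φ (x, y) = 0 ↔ ψ x = y) := fun y hy =>
    hpq h1 (hball (by rw [Real.dist_eq]; exact hy.trans_le (min_le_left _ _)))
  refine ⟨ψ x, (h.mem_iff h3 _).mpr ((h4 _ h2).mpr rfl), h2, fun y' hy' hyδ => ?_⟩
  exact ((h4 _ hyδ).mp ((h.mem_iff h3 _).mp hy')).symm

theorem eventually_card_eq_and_exists (h : IsProperEtale Φ Φx Φy N U) {x₀ ε : ℝ}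
    (hx : x₀ ∈ U) (hε : 0 < ε) :
    ∀ᶠ x in 𝓝 x₀, (N x).card = (N x₀).card ∧ ∀ y₀ ∈ N x₀, ∃ y ∈ N x, |y - y₀| < ε ∧
      ((N x).filter (· < y)).card = ((N x₀).filter (· < y₀)).card := by
  obtain ⟨η, hη, hsep⟩ : ∃ η > 0, ∀ y ∈ N x₀, ∀ y' ∈ N x₀, y < y' → 2 * η ≤ y' - y := by
    have : ∀ᶠ η in 𝓝[>] (0 : ℝ), ∀ y ∈ N x₀, ∀ y' ∈ N x₀, y < y' → 2 * η ≤ y' - y := by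
      simp only [Finset.eventually_all]
      intro y _ y' _
      by_cases hyy : y < y'
      · have : ∀ᶠ η in 𝓝[>] (0 : ℝ), 2 * η < y' - y :=
          nhdsWithin_le_nhds (ContinuousAt.eventually_lt (by fun_prop) continuousAt_const
            (by simpa using hyy))
        filter_upwards [this] with η h1 _ using h1.le
      · simp [hyy]
    obtain ⟨η, h1, h2⟩ := (this.and self_mem_nhdsWithin).exists
    exact ⟨η, h2, h1⟩
  have hlift : ∀ y₀ : ℝ, ∃ δ > 0, δ ≤ min ε η ∧ (y₀ ∈ N x₀ → ∀ᶠ x in 𝓝 x₀, ∃ y ∈ N x, |y - y₀| < δ ∧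
      ∀ y' ∈ N x, |y' - y₀| < δ → y' = y) := by
    intro y₀
    by_cases hy : y₀ ∈ N x₀
    · obtain ⟨δ, h1, h2, h3⟩ := h.exists_lift hx hy (lt_min hε hη)
      exact ⟨δ, h1, h2, fun _ => h3⟩
    · exact ⟨min ε η, lt_min hε hη, le_rfl, fun hy' => absurd hy' hy⟩
  choose δ hδ hδle hδlift using hlift
  obtain ⟨ρ, hρ, hρle⟩ : ∃ ρ > 0, ∀ y ∈ N x₀, ρ ≤ δ y := by
    have : ∀ᶠ ρ in 𝓝[>] (0 : ℝ), ∀ y ∈ N x₀, ρ ≤ δ y := by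
      simp only [Finset.eventually_all]
      intro y _
      filter_upwards [nhdsWithin_le_nhds (Iio_mem_nhds (hδ y))] with ρ hρ using le_of_lt hρ
    obtain ⟨ρ, h1, h2⟩ := (this.and self_mem_nhdsWithin).exists
    exact ⟨ρ, h2, h1⟩
  have hall : ∀ᶠ x in 𝓝 x₀, ∀ y₀ ∈ N x₀, ∃ y ∈ N x, |y - y₀| < δ y₀ ∧
      ∀ y' ∈ N x, |y' - y₀| < δ y₀ → y' = y := by
    simp only [Finset.eventually_all]
    exact hδlift
  filter_upwards [hall, h.eventually_near hx hρ, h.isOpen.mem_nhds hx] with x h1 h2 hxU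
  choose! g hgN hgδ hguniq using h1
  have hmono : StrictMonoOn g (N x₀) := by
    intro y hy y' hy' hlt
    have e1 := hsep y hy y' hy' hlt
    have e2 := abs_lt.mp ((hgδ y hy).trans_le ((hδle y).trans (min_le_right _ _)))
    have e3 := abs_lt.mp ((hgδ y' hy').trans_le ((hδle y').trans (min_le_right _ _)))
    linarith [e2.2, e3.1]
  have himage : (N x₀).image g = N x := by
    ext z
    rw [Finset.mem_image]
    constructor
    · rintro ⟨y, hy, rfl⟩
      exact hgN y hy
    · intro hz
      obtain ⟨y, hy, hzy⟩ := h2 z ((h.mem_iff hxU z).mp hz)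
      exact ⟨y, hy, (hguniq y hy z hz (hzy.trans_le (hρle y hy))).symm⟩
  refine ⟨?_, fun y hy => ⟨g y, hgN y hy,
    (hgδ y hy).trans_le ((hδle y).trans (min_le_left _ _)), ?_⟩⟩
  · rw [← himage, Finset.card_image_of_injOn hmono.injOn]
  · rw [← Finset.card_image_of_injOn
      (hmono.injOn.mono (Finset.coe_subset.mpr (Finset.filter_subset (· < y) (N x₀)))), ← himage]
    congr 1
    ext z
    simp only [Finset.mem_filter, Finset.mem_image]
    constructor
    · rintro ⟨⟨y', hy', rfl⟩, hlt⟩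
      exact ⟨y', ⟨hy', (hmono.lt_iff_lt hy' hy).mp hlt⟩, rfl⟩
    · rintro ⟨y', ⟨hy', hlt⟩, rfl⟩
      exact ⟨⟨y', hy', rfl⟩, hmono hy' hy hlt⟩

end IsProperEtale

theorem Finset.strictMonoOn_card_filter_lt {α : Type*} [LinearOrder α] (s : Finset α) :
    StrictMonoOn (fun y => (s.filter (· < y)).card) s := by
  intro y hy y' _ hlt
  refine Finset.card_lt_card ⟨fun z hz => ?_, fun hsub => ?_⟩
  · rw [Finset.mem_filter] at hz ⊢
    exact ⟨hz.1, hz.2.trans hlt⟩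
  · exact lt_irrefl y (Finset.mem_filter.mp (hsub (Finset.mem_filter.mpr ⟨hy, hlt⟩))).2

theorem Finset.card_filter_lt_lt_card {α : Type*} [LinearOrder α] {s : Finset α} {y : α}
    (hy : y ∈ s) : (s.filter (· < y)).card < s.card :=
  Finset.card_lt_card (Finset.filter_ssubset.mpr ⟨y, hy, lt_irrefl y⟩)

theorem Finset.exists_mem_card_filter_lt_eq {α : Type*} [LinearOrder α] (s : Finset α) {i : ℕ}
    (hi : i < s.card) : ∃ y ∈ s, (s.filter (· < y)).card = i := by
  have := Finset.surjOn_of_injOn_of_card_le (s := s) (t := Finset.range s.card)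
    (fun y => (s.filter (· < y)).card)
    (fun y hy => Finset.mem_coe.mpr (Finset.mem_range.mpr (Finset.card_filter_lt_lt_card hy)))
    s.strictMonoOn_card_filter_lt.injOn (by simp)
  exact this (Finset.mem_coe.mpr (Finset.mem_range.mpr hi))

namespace IsProperEtale

open Filter Topology

variable {Φ Φx Φy : ℝ × ℝ → ℝ} {N : ℝ → Finset ℝ} {U : Set ℝ}

/-- Two points of the same rank in their fibres, over the end points of an interval contained in
`U`, are joined by a branch of the curve. -/
theorem exists_branch (h : IsProperEtale Φ Φx Φy N U) {a b ya yb : ℝ}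
    (hab : a ≤ b) (hU : Set.Icc a b ⊆ U)
    (hya : ya ∈ N a) (hyb : yb ∈ N b)
    (hrank : ((N a).filter (· < ya)).card = ((N b).filter (· < yb)).card) :
    ∃ φ : ℝ → ℝ, φ a = ya ∧ φ b = yb ∧ ∀ x ∈ Set.Icc a b,
      (φ x ∈ N x ∧ ((N x).filter (· < φ x)).card = ((N a).filter (· < ya)).card) ∧
      HasDerivAt φ (-Φx (x, φ x) / Φy (x, φ x)) x := by
  set i := ((N a).filter (· < ya)).card with hi
  have hcard : ∀ x ∈ Set.Icc a b, (N x).card = (N a).card := by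
    intro x hx
    refine isPreconnected_Icc.constant (f := fun x => (N x).card) (fun z hz => ?_) hx
      (Set.left_mem_Icc.mpr hab)
    refine (continuousAt_const.congr (f := fun _ => (N z).card) ?_).continuousWithinAt
    filter_upwards [h.eventually_card_eq_and_exists (hU hz) one_pos] with x hx using hx.1.symm
  have huniq : ∀ x y y', y ∈ N x → y' ∈ N x → ((N x).filter (· < y)).card = i →
      ((N x).filter (· < y')).card = i → y = y' := fun x y y' hy hy' e e' =>
    (N x).strictMonoOn_card_filter_lt.injOn hy hy' (e.trans e'.symm)
  have hex : ∀ x, ∃ z, ∀ y ∈ N x, ((N x).filter (· < y)).card = i → z = y := by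
    intro x
    by_cases hx : ∃ y ∈ N x, ((N x).filter (· < y)).card = i
    · obtain ⟨z, hz, hzi⟩ := hx
      exact ⟨z, fun y hy hyi => huniq x z y hz hy hzi hyi⟩
    · exact ⟨0, fun y hy hyi => absurd ⟨y, hy, hyi⟩ hx⟩
  choose φ hφ using hex
  have hmem : ∀ x ∈ Set.Icc a b, φ x ∈ N x ∧ ((N x).filter (· < φ x)).card = i := by
    intro x hx
    obtain ⟨y, hy, hyi⟩ := (N x).exists_mem_card_filter_lt_eq (i := i)
      (by rw [hcard x hx]; exact Finset.card_filter_lt_lt_card hya)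
    rw [hφ x y hy hyi]
    exact ⟨hy, hyi⟩
  refine ⟨φ, hφ a ya hya rfl, hφ b yb hyb hrank.symm, fun x hx => ⟨hmem x hx, ?_⟩⟩
  obtain ⟨hxN, hxi⟩ := hmem x hx
  have hlim : Tendsto φ (𝓝 x) (𝓝 (φ x)) := by
    rw [Metric.tendsto_nhds]
    intro ε hε
    filter_upwards [h.eventually_card_eq_and_exists (hU hx) hε] with x' hx'
    obtain ⟨y, hy, hyε, hyi⟩ := hx'.2 _ hxN
    rwa [hφ x' y hy (hyi.trans hxi), Real.dist_eq]
  obtain ⟨ψ, hψ, hψx, hiff⟩ := h.exists_implicit_function (hU hx) hxN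
  refine hψ.congr_of_eventuallyEq ?_
  filter_upwards [(tendsto_id.prodMk_nhds hlim).eventually hiff, h.isOpen.mem_nhds (hU hx),
    h.eventually_card_eq_and_exists (hU hx) one_pos] with x' h1 hU' h2
  obtain ⟨y, hy, -, hyi⟩ := h2.2 _ hxN
  have h3 := hφ x' y hy (hyi.trans hxi)
  exact (h1.mp ((h.mem_iff hU' _).mp (by simpa [h3] using hy))).symm

/-- A counting form of Rolle's theorem along the branches of a curve. -/
theorem card_le_of_branches (h : IsProperEtale Φ Φx Φy N U) {B : Finset ℝ}
    (hB : ∀ x, x ∉ B → x ∈ U) {d : ℕ}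
    (hd : ∀ x ∈ U, (N x).card ≤ d) (A T : Finset (ℝ × ℝ)) (hA : ∀ p ∈ A, p.1 ∈ U ∧ p.2 ∈ N p.1)
    (hAT : ∀ (a b : ℝ) (φ : ℝ → ℝ), a < b → (a, φ a) ∈ A → (b, φ b) ∈ A →
      (∀ x ∈ Set.Icc a b, Φ (x, φ x) = 0 ∧ Φy (x, φ x) ≠ 0 ∧
        HasDerivAt φ (-Φx (x, φ x) / Φy (x, φ x)) x) →
      ∃ x ∈ Set.Ioo a b, (x, φ x) ∈ T) :
    A.card ≤ T.card + d * (B.card + 1) := by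
  classical
  let r : ℝ × ℝ → ℕ := fun p => ((N p.1).filter (· < p.2)).card
  have hr : ∀ p ∈ A, r p ∈ Finset.range d := fun p hp => Finset.mem_range.mpr
    ((Finset.card_filter_lt_lt_card (hA p hp).2).trans_le (hd _ (hA p hp).1))
  have hstep : ∀ i, (A.filter (r · = i)).card ≤ (T.filter (r · = i)).card + (B.card + 1) := by
    intro i
    have hinj : Set.InjOn Prod.fst (A.filter (r · = i) : Set (ℝ × ℝ)) := by
      rintro ⟨x, y⟩ hp ⟨x', y'⟩ hq (rfl : x = x')
      rw [Finset.mem_coe, Finset.mem_filter] at hp hq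
      exact Prod.ext rfl ((N x).strictMonoOn_card_filter_lt.injOn (hA _ hp.1).2 (hA _ hq.1).2
        (hp.2.trans hq.2.symm))
    rw [← Finset.card_image_of_injOn hinj]
    have hle : ((A.filter (r · = i)).image Prod.fst).card ≤
        ((T.filter (r · = i)).image Prod.fst ∪ B).card + 1 := by
      refine Finset.card_le_of_interleaved fun a ha b hb hab _ => ?_
      obtain ⟨⟨a, ya⟩, hpa, rfl⟩ := Finset.mem_image.mp ha
      obtain ⟨⟨b, yb⟩, hpb, rfl⟩ := Finset.mem_image.mp hb
      rw [Finset.mem_filter] at hpa hpb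
      dsimp only at hab ⊢
      by_cases hBab : ∃ x ∈ B, a < x ∧ x < b
      · obtain ⟨x, hx, hxab⟩ := hBab
        exact ⟨x, Finset.mem_union_right _ hx, hxab⟩
      · have hU : Set.Icc a b ⊆ U := by
          intro x hx
          rcases eq_or_lt_of_le hx.1 with rfl | h1
          · exact (hA _ hpa.1).1
          rcases eq_or_lt_of_le hx.2 with rfl | h2
          · exact (hA _ hpb.1).1
          exact hB x fun hxB => hBab ⟨x, hxB, h1, h2⟩
        obtain ⟨φ, rfl, rfl, hφ⟩ := h.exists_branch hab.le hU (hA _ hpa.1).2 (hA _ hpb.1).2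
          (hpa.2.trans hpb.2.symm)
        obtain ⟨x, hx, hxT⟩ := hAT a b φ hab hpa.1 hpb.1 fun x hx =>
          ⟨(h.mem_iff (hU hx) _).mp (hφ x hx).1.1, h.ne_zero (hU hx) (hφ x hx).1.1, (hφ x hx).2⟩
        refine ⟨x, Finset.mem_union_left _ (Finset.mem_image.mpr ⟨(x, φ x),
          Finset.mem_filter.mpr ⟨hxT, ?_⟩, rfl⟩), hx⟩
        exact (hφ x (Set.Ioo_subset_Icc_self hx)).1.2.trans hpa.2
    have h1 := Finset.card_union_le ((T.filter (r · = i)).image Prod.fst) B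
    have h2 := Finset.card_image_le (s := T.filter (r · = i)) (f := Prod.fst)
    omega
  calc A.card = ∑ i ∈ Finset.range d, (A.filter (r · = i)).card :=
        Finset.card_eq_sum_card_fiberwise hr
    _ ≤ ∑ i ∈ Finset.range d, ((T.filter (r · = i)).card + (B.card + 1)) :=
        Finset.sum_le_sum fun i _ => hstep i
    _ = ∑ i ∈ Finset.range d, (T.filter (r · = i)).card + d * (B.card + 1) := by
        rw [Finset.sum_add_distrib]; simp
    _ ≤ _ := by
        gcongr
        rw [← Finset.card_biUnion]
        · exact Finset.card_le_card (Finset.biUnion_subset.mpr fun i _ => Finset.filter_subset _ _)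
        · intro i _ j _ hij
          exact Finset.disjoint_filter.mpr fun p _ h1 h2 => hij (h1.symm.trans h2)

end IsProperEtale

theorem totalDegree_X_mul_pderiv_le {σ R : Type*} [CommSemiring R] (i : σ)
    (q : MvPolynomial σ R) : (X i * pderiv i q).totalDegree ≤ q.totalDegree := by
  have h : X i * pderiv i q = ∑ s ∈ q.support, s i • monomial s (q.coeff s) := by
    conv_lhs => rw [q.as_sum, map_sum, Finset.mul_sum]
    exact Finset.sum_congr rfl fun s _ => X_mul_pderiv_monomial
  rw [h]
  refine totalDegree_finsetSum_le fun s hs => (totalDegree_smul_le _ _).trans ?_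
  exact (totalDegree_monomial_le _ _).trans (le_totalDegree hs)

theorem totalDegree_pderiv_lt {σ R : Type*} [CommRing R] [IsDomain R] {i : σ}
    {q : MvPolynomial σ R} (h : pderiv i q ≠ 0) :
    (pderiv i q).totalDegree < q.totalDegree := by
  have := totalDegree_X_mul_pderiv_le i q
  rw [totalDegree_mul_of_isDomain (X_ne_zero i) h, totalDegree_X] at this
  omega

theorem not_dvd_pderiv {σ R : Type*} [CommRing R] [IsDomain R] {i : σ}
    {q : MvPolynomial σ R} (h : pderiv i q ≠ 0) : ¬ q ∣ pderiv i q := fun hd =>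
  (totalDegree_pderiv_lt h).not_ge (totalDegree_le_of_dvd_of_isDomain hd h)

/-- The Hamiltonian vector field of `F`, multiplied by the product of the coordinates. It is tangent
to the curve `F = 0`, and each monomial divides its own derivative. -/
noncomputable def logHamiltonian (F : MvPolynomial (Fin 2) ℝ) :
    Derivation ℝ (MvPolynomial (Fin 2) ℝ) (MvPolynomial (Fin 2) ℝ) :=
  (X 0 * X 1 * pderiv 1 F) • pderiv 0 - (X 0 * X 1 * pderiv 0 F) • pderiv 1

theorem logHamiltonian_apply (F q : MvPolynomial (Fin 2) ℝ) :
    logHamiltonian F q = X 0 * X 1 * (pderiv 1 F * pderiv 0 q - pderiv 0 F * pderiv 1 q) := by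
  simp [logHamiltonian]
  ring

theorem totalDegree_logHamiltonian_le (F q : MvPolynomial (Fin 2) ℝ) :
    (logHamiltonian F q).totalDegree ≤ q.totalDegree + F.totalDegree := by
  have h : logHamiltonian F q = (X 0 * pderiv 0 q) * (X 1 * pderiv 1 F) -
      (X 1 * pderiv 1 q) * (X 0 * pderiv 0 F) := by
    rw [logHamiltonian_apply]; ring
  rw [h]
  refine (totalDegree_sub _ _).trans (max_le ?_ ?_) <;>
  exact (totalDegree_mul _ _).trans
    (add_le_add (totalDegree_X_mul_pderiv_le _ _) (totalDegree_X_mul_pderiv_le _ _))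

theorem exists_iterate_logHamiltonian_monomial (F : MvPolynomial (Fin 2) ℝ) (s : Fin 2 →₀ ℕ)
    (n : ℕ) : ∃ q : MvPolynomial (Fin 2) ℝ, q.totalDegree ≤ n * F.totalDegree ∧
      (logHamiltonian F)^[n] (monomial s 1) = monomial s 1 * q := by
  induction n with
  | zero => exact ⟨1, by simp, by simp⟩
  | succ n ih =>
    obtain ⟨q, hq, hqs⟩ := ih
    refine ⟨logHamiltonian F q + (s 0 • (X 1 * pderiv 1 F) - s 1 • (X 0 * pderiv 0 F)) * q, ?_, ?_⟩
    · rw [add_mul, one_mul]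
      refine (totalDegree_add _ _).trans (max_le ?_ ?_)
      · exact (totalDegree_logHamiltonian_le F q).trans (by omega)
      · refine (totalDegree_mul _ _).trans ?_
        have : (s 0 • (X 1 * pderiv 1 F) - s 1 • (X 0 * pderiv 0 F)).totalDegree ≤
            F.totalDegree :=
          (totalDegree_sub _ _).trans (max_le
            ((totalDegree_smul_le _ _).trans (totalDegree_X_mul_pderiv_le _ _))
            ((totalDegree_smul_le _ _).trans (totalDegree_X_mul_pderiv_le _ _)))
        omega
    · have h0 := X_mul_pderiv_monomial (R := ℝ) (i := (0 : Fin 2)) (m := s) (r := 1)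
      have h1 := X_mul_pderiv_monomial (R := ℝ) (i := (1 : Fin 2)) (m := s) (r := 1)
      rw [nsmul_eq_mul] at h0 h1
      rw [Function.iterate_succ_apply', hqs, Derivation.leibniz, smul_eq_mul, smul_eq_mul,
        logHamiltonian_apply F (monomial s 1), nsmul_eq_mul, nsmul_eq_mul]
      linear_combination q * X 1 * pderiv 1 F * h0 - q * X 0 * pderiv 0 F * h1

theorem exists_wronskian_monomial (F : MvPolynomial (Fin 2) ℝ) (s : ℕ → Fin 2 →₀ ℕ) (n : ℕ) :
    ∃ q : MvPolynomial (Fin 2) ℝ, q.totalDegree ≤ n ^ 2 * F.totalDegree ∧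
      (logHamiltonian F).wronskian (fun j => monomial (s j) 1) n =
        (∏ j : Fin n, monomial (s j) 1) * q := by
  choose q hq hqs using fun s n => exists_iterate_logHamiltonian_monomial F s n
  refine ⟨(Matrix.of fun j i : Fin n => q (s j) i).det, ?_, ?_⟩
  · rw [Matrix.det_apply]
    refine totalDegree_finsetSum_le fun σ _ => (totalDegree_smul_le _ _).trans ?_
    refine (totalDegree_finsetProd _ _).trans ?_
    calc _ ≤ ∑ i : Fin n, n * F.totalDegree := Finset.sum_le_sum fun i _ =>
          (hq _ _).trans (Nat.mul_le_mul_right _ i.2.le)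
      _ = _ := by simp; ring
  · rw [← Matrix.det_mul_column]
    simp only [Derivation.wronskian, hqs, Matrix.of_apply]

theorem exists_maximal_wronskian {F : MvPolynomial (Fin 2) ℝ} (hF : Prime F)
    (D : Derivation ℝ (MvPolynomial (Fin 2) ℝ) (MvPolynomial (Fin 2) ℝ))
    (S : Finset (Fin 2 →₀ ℕ)) :
    ∃ (s : ℕ → Fin 2 →₀ ℕ) (r : ℕ), r ≤ S.card ∧
      (∀ j ≤ r, ¬ F ∣ D.wronskian (fun j => monomial (s j) 1) j) ∧
      ∀ m ∈ S, F ∣ D.wronskian (Function.update (fun j => monomial (s j) 1) r (monomial m 1))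
        (r + 1) := by
  by_contra! hcon
  have key : ∀ r, ∃ s : ℕ → Fin 2 →₀ ℕ, (∀ j < r, s j ∈ S) ∧
      ∀ j ≤ r, ¬ F ∣ D.wronskian (fun j => monomial (s j) 1) j := by
    intro r
    induction r with
    | zero =>
      refine ⟨0, by simp, fun j hj => ?_⟩
      rw [Nat.le_zero.mp hj, Derivation.wronskian_zero]
      exact fun h => hF.not_isUnit (isUnit_of_dvd_one h)
    | succ r ih =>
      obtain ⟨s, hsS, hs⟩ := ih
      have hr : r ≤ S.card := by
        rw [← Finset.card_range r]
        refine Finset.card_le_card_of_injOn s (fun j hj => hsS j (by simpa using hj)) ?_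
        intro i hi j hj hij
        by_contra hne
        refine hs r le_rfl ?_
        rw [D.wronskian_eq_zero (by simpa using hi) (by simpa using hj) hne (by simp [hij])]
        exact dvd_zero F
      obtain ⟨m, hm, hmF⟩ := hcon s r hr hs
      have hupd : (fun j => (monomial (Function.update s r m j) 1 : MvPolynomial (Fin 2) ℝ)) =
          Function.update (fun j => monomial (s j) 1) r (monomial m 1) := by
        ext1 j
        by_cases hj : j = r
        · subst hj; simp
        · simp [hj]
      refine ⟨Function.update s r m, fun j hj => ?_, fun j hj => ?_⟩
      · rcases (Nat.lt_succ_iff.mp hj).eq_or_lt with rfl | hj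
        · simpa using hm
        · rw [Function.update_of_ne hj.ne]
          exact hsS j hj
      · rw [hupd]
        rcases hj.eq_or_lt with rfl | hj
        · exact hmF
        · have : D.wronskian (Function.update (fun j => monomial (s j) 1) r (monomial m 1)) j =
              D.wronskian (fun j => monomial (s j) 1) j :=
            D.wronskian_congr fun i hi => Function.update_of_ne (by omega) _ _
          rw [this]
          exact hs j (by omega)
  obtain ⟨s, hsS, hs⟩ := key (S.card + 1)
  obtain ⟨i, hi, j, hj, hne, hij⟩ := Finset.exists_ne_map_eq_of_card_lt_of_maps_to
    (s := Finset.range (S.card + 1)) (t := S) (by simp) (f := s)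
    (fun j hj => hsS j (by simpa using hj))
  refine hs _ le_rfl ?_
  rw [D.wronskian_eq_zero (by simpa using hi) (by simpa using hj) hne (by simp [hij])]
  exact dvd_zero F

theorem dvd_wronskian_update_of_forall_mem_support {F G : MvPolynomial (Fin 2) ℝ}
    (D : Derivation ℝ (MvPolynomial (Fin 2) ℝ) (MvPolynomial (Fin 2) ℝ))
    {f : ℕ → MvPolynomial (Fin 2) ℝ} {r : ℕ}
    (h : ∀ m ∈ G.support, F ∣ D.wronskian (Function.update f r (monomial m 1)) (r + 1)) :
    F ∣ D.wronskian (Function.update f r G) (r + 1) := by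
  have hG : G = ∑ m ∈ G.support, G.coeff m • monomial m (1 : ℝ) := by
    conv_lhs => rw [G.as_sum]
    simp [smul_monomial]
  conv_rhs => rw [hG]
  rw [D.wronskian_update_sum]
  exact Finset.dvd_sum fun m hm => dvd_smul_of_dvd _ (h m hm)

open Polynomial in
/-- A polynomial in `X 0` and `X 1`, seen as a polynomial in `X 1` over the polynomials in `X 0`. -/
noncomputable def toBivariate : MvPolynomial (Fin 2) ℝ →ₐ[ℝ] ℝ[X][X] :=
  MvPolynomial.aeval ![Polynomial.C Polynomial.X, Polynomial.X]

theorem evalEval_toBivariate (F : MvPolynomial (Fin 2) ℝ) (x y : ℝ) :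
    (toBivariate F).evalEval x y = eval ![x, y] F := by
  induction F using MvPolynomial.induction_on with
  | C a => simp [toBivariate]
  | add p q hp hq => simp [hp, hq]
  | mul_X p i hp =>
    rw [map_mul, Polynomial.evalEval_mul, hp, map_mul]
    fin_cases i <;> simp [toBivariate, Polynomial.evalEval_C]

theorem toBivariate_ne_zero {F : MvPolynomial (Fin 2) ℝ} (hF : F ≠ 0) : toBivariate F ≠ 0 := by
  refine fun h => hF (MvPolynomial.funext fun v => ?_)
  have := evalEval_toBivariate F (v 0) (v 1)
  rw [h, Polynomial.evalEval_zero, show ![v 0, v 1] = v by ext i; fin_cases i <;> rfl] at this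
  rw [← this, map_zero]

theorem toBivariate_eq_sum (F : MvPolynomial (Fin 2) ℝ) : toBivariate F =
    ∑ s ∈ F.support, Polynomial.C (Polynomial.C (F.coeff s) * Polynomial.X ^ s 0) *
      Polynomial.X ^ s 1 := by
  simp [toBivariate, aeval_def, eval₂_eq', Fin.prod_univ_two, mul_assoc]

theorem apply_le_totalDegree {σ R : Type*} [CommSemiring R] {p : MvPolynomial σ R} {s : σ →₀ ℕ}
    (hs : s ∈ p.support) (i : σ) : s i ≤ p.totalDegree :=
  (monomial_le_degreeOf i hs).trans (degreeOf_le_totalDegree p i)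

theorem natDegree_toBivariate_le (F : MvPolynomial (Fin 2) ℝ) :
    (toBivariate F).natDegree ≤ F.totalDegree := by
  rw [toBivariate_eq_sum]
  exact Polynomial.natDegree_sum_le_of_forall_le _ _ fun s hs =>
    (Polynomial.natDegree_C_mul_X_pow_le _ _).trans (apply_le_totalDegree hs 1)

theorem natDegree_coeff_toBivariate_le (F : MvPolynomial (Fin 2) ℝ) (n : ℕ) :
    ((toBivariate F).coeff n).natDegree ≤ F.totalDegree := by
  rw [toBivariate_eq_sum, Polynomial.finsetSum_coeff]
  refine Polynomial.natDegree_sum_le_of_forall_le _ _ fun s hs => ?_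
  rw [Polynomial.coeff_C_mul_X_pow]
  split_ifs
  · exact (Polynomial.natDegree_C_mul_X_pow_le _ _).trans (apply_le_totalDegree hs 0)
  · simp

open Filter Topology in
theorem eventually_forall_root_le (f : Polynomial (Polynomial ℝ)) {x : ℝ}
    (hx : f.leadingCoeff.eval x ≠ 0) :
    ∃ K : ℝ, ∀ᶠ x' in 𝓝 x, ∀ y, f.evalEval x' y = 0 → |y| ≤ K := by
  let g : ℝ → NNReal := fun x => (Finset.range f.natDegree).sup
    (fun i => ‖(f.coeff i).eval x‖₊) / ‖f.leadingCoeff.eval x‖₊ + 1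
  have hg : ContinuousAt g x := by
    refine ContinuousAt.add (ContinuousAt.div ?_ ?_ (by simpa using hx)) continuousAt_const
    · exact (Continuous.finset_sup_apply fun i _ => by fun_prop).continuousAt
    · exact (by fun_prop : Continuous _).continuousAt
  refine ⟨g x + 1, ?_⟩
  have h1 : ∀ᶠ x' in 𝓝 x, f.leadingCoeff.eval x' ≠ 0 :=
    f.leadingCoeff.continuous.continuousAt.eventually_ne hx
  filter_upwards [h1, hg.eventually_lt continuousAt_const (lt_add_one (g x))] with x' h2 h3 y hy
  have h4 : (f.map (Polynomial.evalRingHom x')).natDegree = f.natDegree :=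
    Polynomial.natDegree_map_of_leadingCoeff_ne_zero _ h2
  have h0 : f.map (Polynomial.evalRingHom x') ≠ 0 := fun h => h2 (by
    have := congrArg (Polynomial.coeff · f.natDegree) h
    simpa using this)
  have h5 : (f.map (Polynomial.evalRingHom x')).IsRoot y := by
    rw [Polynomial.IsRoot, Polynomial.eval_map]
    rw [← Polynomial.coe_evalEvalRingHom, Polynomial.evalEvalRingHom_eq] at hy
    exact hy
  have h6 := h5.norm_lt_cauchyBound h0
  have h7 : (f.map (Polynomial.evalRingHom x')).cauchyBound = g x' := by
    rw [Polynomial.cauchyBound, Polynomial.leadingCoeff, h4]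
    simp [g]
  rw [h7] at h6
  have h8 : ‖y‖₊ < g x + 1 := lt_trans h6 h3
  exact_mod_cast h8.le

/-- The common real zeros of two bivariate polynomials. -/
def commonZeros (F H : MvPolynomial (Fin 2) ℝ) : Set (ℝ × ℝ) :=
  {p | eval ![p.1, p.2] F = 0 ∧ eval ![p.1, p.2] H = 0}

theorem mem_commonZeros {F H : MvPolynomial (Fin 2) ℝ} {p : ℝ × ℝ} :
    p ∈ commonZeros F H ↔ eval ![p.1, p.2] F = 0 ∧ eval ![p.1, p.2] H = 0 := Iff.rfl

theorem finite_commonZeros {F H : MvPolynomial (Fin 2) ℝ} (hF : Prime F) (hFH : ¬ F ∣ H) :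
    (commonZeros F H).Finite := (finite_zeros_and_ncard_le hF hFH).1

theorem ncard_commonZeros_le {F H : MvPolynomial (Fin 2) ℝ} (hF : Prime F) (hFH : ¬ F ∣ H) :
    (commonZeros F H).ncard ≤ F.totalDegree * H.totalDegree := (finite_zeros_and_ncard_le hF hFH).2

theorem totalDegree_pos_of_pderiv_ne_zero {F : MvPolynomial (Fin 2) ℝ} {i : Fin 2}
    (h : pderiv i F ≠ 0) : 0 < F.totalDegree := (Nat.zero_le _).trans_lt (totalDegree_pderiv_lt h)

theorem not_dvd_X_sub_C {F : MvPolynomial (Fin 2) ℝ} (hF : Prime F) (hy : pderiv 1 F ≠ 0)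
    (c : ℝ) : ¬ F ∣ X 0 - C c := by
  rintro ⟨u, hu⟩
  have h1 := congrArg (pderiv 1) hu
  have h0 := congrArg (pderiv 0) hu
  simp [Derivation.leibniz, pderiv_X] at h0 h1
  have hFu : F ∣ u * pderiv 1 F := ⟨-pderiv 1 u, by linear_combination -h1⟩
  rcases hF.dvd_or_dvd hFu with ⟨v, rfl⟩ | h
  · exact hF.not_isUnit (isUnit_of_dvd_one ⟨pderiv 0 (F * v) + v * pderiv 0 F, by
      linear_combination h0⟩)
  · exact not_dvd_pderiv hy h

theorem exists_isProperEtale {F : MvPolynomial (Fin 2) ℝ} (hF : Prime F) (hy : pderiv 1 F ≠ 0) :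
    ∃ (N : ℝ → Finset ℝ) (B : Finset ℝ), B.card ≤ F.totalDegree ^ 2 ∧
      (∀ x, (N x).card ≤ F.totalDegree) ∧
      IsProperEtale (fun p => eval ![p.1, p.2] F) (fun p => eval ![p.1, p.2] (pderiv 0 F))
        (fun p => eval ![p.1, p.2] (pderiv 1 F)) N (↑B)ᶜ := by
  classical
  have hfin := finite_commonZeros hF (not_dvd_pderiv hy)
  have hlt := totalDegree_pderiv_lt hy
  have hcard := ncard_commonZeros_le hF (not_dvd_pderiv hy)
  rw [Set.ncard_eq_toFinset_card _ hfin] at hcard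
  set f := toBivariate F with hf
  have hf0 : f ≠ 0 := toBivariate_ne_zero hF.ne_zero
  have hlc : f.leadingCoeff ≠ 0 := Polynomial.leadingCoeff_ne_zero.mpr hf0
  have hroot : ∀ x ∉ (↑(f.leadingCoeff.roots.toFinset ∪ hfin.toFinset.image Prod.fst) : Set ℝ),
      f.leadingCoeff.eval x ≠ 0 := fun x hx h => hx (by simp [hf0, h])
  have hev : ∀ x y, (f.map (Polynomial.evalRingHom x)).eval y = eval ![x, y] F := fun x y => by
    rw [← evalEval_toBivariate, ← hf, Polynomial.eval_map, ← Polynomial.coe_evalEvalRingHom,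
      Polynomial.evalEvalRingHom_eq]
    rfl
  have hN : ∀ x ∉ (↑(f.leadingCoeff.roots.toFinset ∪ hfin.toFinset.image Prod.fst) : Set ℝ),
      ∀ y, y ∈ (f.map (Polynomial.evalRingHom x)).roots.toFinset ↔ eval ![x, y] F = 0 := by
    intro x hx y
    have h0 : f.map (Polynomial.evalRingHom x) ≠ 0 := fun h => hroot x hx (by
      simpa using congrArg (Polynomial.coeff · f.natDegree) h)
    rw [Multiset.mem_toFinset, Polynomial.mem_roots h0, Polynomial.IsRoot, hev]
  refine ⟨fun x => (f.map (Polynomial.evalRingHom x)).roots.toFinset,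
    f.leadingCoeff.roots.toFinset ∪ hfin.toFinset.image Prod.fst, ?_, fun x => ?_, ?_⟩
  · calc _ ≤ F.totalDegree + F.totalDegree * (pderiv 1 F).totalDegree := by
          refine (Finset.card_union_le _ _).trans (add_le_add ?_ (Finset.card_image_le.trans hcard))
          exact (Multiset.toFinset_card_le _).trans ((Polynomial.card_roots' _).trans
            (natDegree_coeff_toBivariate_le F _))
      _ ≤ F.totalDegree * (1 + (pderiv 1 F).totalDegree) := by linarith
      _ ≤ _ := by rw [sq]; exact Nat.mul_le_mul_left _ (by omega)
  · exact (Multiset.toFinset_card_le _).trans ((Polynomial.card_roots' _).trans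
      (Polynomial.natDegree_map_le.trans (natDegree_toBivariate_le F)))
  · refine ⟨(Finset.finite_toSet _).isClosed.isOpen_compl, hasStrictFDerivAt_eval F,
      fun hx => hN _ hx, fun {x} hx {y} hy h => hx ?_, fun {x} hx => ?_⟩
    · have : ∃ y, (x, y) ∈ commonZeros F (pderiv 1 F) := ⟨y, (hN x hx y).mp hy, h⟩
      simp [this]
    · simpa only [hf, evalEval_toBivariate] using eventually_forall_root_le f (hroot x hx)

theorem hasDerivAt_eval_graph (H : MvPolynomial (Fin 2) ℝ) {φ : ℝ → ℝ} {φ' x : ℝ}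
    (h : HasDerivAt φ φ' x) : HasDerivAt (fun x => eval ![x, φ x] H)
      (eval ![x, φ x] (pderiv 0 H) + eval ![x, φ x] (pderiv 1 H) * φ') x := by
  have := (hasStrictFDerivAt_eval H (x, φ x)).hasFDerivAt.comp_hasDerivAt x
    ((hasDerivAt_id x).prodMk h)
  exact this.congr_deriv (by simp)

theorem hasDerivAt_eval_div_eval {F W : MvPolynomial (Fin 2) ℝ} (R : MvPolynomial (Fin 2) ℝ)
    {φ : ℝ → ℝ} {x : ℝ} (hxy : eval ![x, φ x] (X 0 * X 1 : MvPolynomial (Fin 2) ℝ) ≠ 0)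
    (hW : eval ![x, φ x] W ≠ 0) (hy : eval ![x, φ x] (pderiv 1 F) ≠ 0)
    (h : HasDerivAt φ (-eval ![x, φ x] (pderiv 0 F) / eval ![x, φ x] (pderiv 1 F)) x) :
    HasDerivAt (fun x => eval ![x, φ x] R / eval ![x, φ x] W)
      (eval ![x, φ x] (W * logHamiltonian F R - logHamiltonian F W * R) /
        (eval ![x, φ x] W ^ 2 * eval ![x, φ x] (X 0 * X 1 : MvPolynomial (Fin 2) ℝ) *
          eval ![x, φ x] (pderiv 1 F))) x := by
  refine ((hasDerivAt_eval_graph R h).div (hasDerivAt_eval_graph W h) hW).congr_deriv ?_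
  simp only [logHamiltonian_apply, map_sub, map_mul] at hxy ⊢
  obtain ⟨hx, hy'⟩ := mul_ne_zero_iff.mp hxy
  field_simp
  ring

theorem ncard_commonZeros_sdiff_axes_le {F R W : MvPolynomial (Fin 2) ℝ} (hF : Prime F)
    (hy : pderiv 1 F ≠ 0) (hX : ¬ F ∣ X 1) (hR : ¬ F ∣ R) (hW : ¬ F ∣ W) {q : ℕ}
    (hq : ¬ F ∣ W * logHamiltonian F R - logHamiltonian F W * R →
      (commonZeros F (W * logHamiltonian F R - logHamiltonian F W * R) \
        commonZeros F (X 0 * X 1)).ncard ≤ q) :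
    (commonZeros F R \ commonZeros F (X 0 * X 1)).ncard ≤
      q + 2 * (commonZeros F W \ commonZeros F (X 0 * X 1)).ncard + 5 * F.totalDegree ^ 3 := by
  classical
  have hXY : ¬ F ∣ X 0 * X 1 := fun h => (hF.dvd_or_dvd h).elim
    (by simpa using not_dvd_X_sub_C hF hy 0) hX
  obtain ⟨N, B, hB, hN, hE⟩ := exists_isProperEtale hF hy
  set Q := W * logHamiltonian F R - logHamiltonian F W * R with hQ
  have hd := totalDegree_pos_of_pderiv_ne_zero hy
  have hfR := finite_commonZeros hF hR
  have hfW := finite_commonZeros hF hW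
  have hfXY := finite_commonZeros hF hXY
  have hXYcard : (commonZeros F (X 0 * X 1)).ncard ≤ F.totalDegree * 2 :=
    (ncard_commonZeros_le hF hXY).trans (Nat.mul_le_mul_left _
      ((totalDegree_mul _ _).trans (by simp)))
  obtain ⟨T₀, hT₀, hT₀q, hT₀mem⟩ : ∃ T₀ : Set (ℝ × ℝ), T₀.Finite ∧ T₀.ncard ≤ q ∧
      (¬ F ∣ Q → commonZeros F Q \ commonZeros F (X 0 * X 1) ⊆ T₀) := by
    by_cases h : F ∣ Q
    · exact ⟨∅, Set.finite_empty, by simp, fun h' => absurd h h'⟩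
    · exact ⟨_, (finite_commonZeros hF h).sdiff, hq h, fun _ => subset_rfl⟩
  set T := commonZeros F (X 0 * X 1) ∪
    ((commonZeros F W \ commonZeros F (X 0 * X 1)) ∪ T₀) with hT
  have hTfin : T.Finite := hfXY.union (hfW.sdiff.union hT₀)
  set A := (commonZeros F R \ commonZeros F (X 0 * X 1)) \
    (commonZeros F W ∪ {p | p.1 ∈ B}) with hA
  have hAfin : A.Finite := hfR.sdiff.sdiff
  have hover : (commonZeros F R ∩ {p | p.1 ∈ B}).ncard ≤ F.totalDegree ^ 3 := by
    have hsub : commonZeros F R ∩ {p | p.1 ∈ B} ⊆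
        ⋃ c ∈ B, commonZeros F (X 0 - C c) := fun p hp => by
      simpa [mem_commonZeros, hp.1.1, sub_eq_zero] using hp.2
    refine (Set.ncard_le_ncard hsub (Set.Finite.biUnion B.finite_toSet fun c _ =>
      finite_commonZeros hF (not_dvd_X_sub_C hF hy c))).trans ?_
    refine (B.set_ncard_biUnion_le _).trans ?_
    calc _ ≤ ∑ c ∈ B, F.totalDegree := Finset.sum_le_sum fun c _ => by
          refine (ncard_commonZeros_le hF (not_dvd_X_sub_C hF hy c)).trans ?_
          refine (Nat.mul_le_mul_left _ ((totalDegree_sub_C_le _ _).trans ?_)).trans_eq (mul_one _)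
          simp
      _ = B.card * F.totalDegree := by simp
      _ ≤ F.totalDegree ^ 2 * F.totalDegree := Nat.mul_le_mul_right _ hB
      _ = _ := by ring
  have hAcard := hE.card_le_of_branches (fun x hx => by simpa using hx) (fun x _ => hN x)
    hAfin.toFinset hTfin.toFinset (fun p hp => ?_) ?_
  · rw [← Set.ncard_eq_toFinset_card _ hAfin, ← Set.ncard_eq_toFinset_card _ hTfin] at hAcard
    have hTcard : T.ncard ≤ F.totalDegree * 2 +
        ((commonZeros F W \ commonZeros F (X 0 * X 1)).ncard + q) :=
      (Set.ncard_union_le _ _).trans (add_le_add hXYcard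
        ((Set.ncard_union_le _ _).trans (Nat.add_le_add_left hT₀q _)))
    have hsub : commonZeros F R \ commonZeros F (X 0 * X 1) ⊆
        A ∪ ((commonZeros F W \ commonZeros F (X 0 * X 1)) ∪
          (commonZeros F R ∩ {p | p.1 ∈ B})) := fun p hp => by
      simp only [hA, Set.mem_union, Set.mem_sdiff, Set.mem_inter_iff] at hp ⊢
      tauto
    have hcard := (Set.ncard_le_ncard hsub (hAfin.union (hfW.sdiff.union
      (hfR.inter_of_left _)))).trans ((Set.ncard_union_le _ _).trans
        (Nat.add_le_add_left (Set.ncard_union_le _ _) _))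
    have h1 : F.totalDegree * (B.card + 1) ≤ F.totalDegree * (F.totalDegree ^ 2 + 1) :=
      Nat.mul_le_mul_left _ (by omega)
    have h2 : F.totalDegree * (F.totalDegree ^ 2 + 1) = F.totalDegree ^ 3 + F.totalDegree := by
      ring
    have h3 : F.totalDegree ≤ F.totalDegree ^ 3 := Nat.le_self_pow (by omega) _
    omega
  · have hpA : p ∈ A := hAfin.mem_toFinset.mp hp
    have hpB : p.1 ∈ (↑B : Set ℝ)ᶜ := fun h => hpA.2 (Or.inr h)
    exact ⟨hpB, (hE.mem_iff hpB _).mpr hpA.1.1.1⟩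
  · intro a b φ hab ha hb hφ
    by_contra! hcon
    rw [Set.Finite.mem_toFinset] at ha hb
    have hne : ∀ x ∈ Set.Icc a b, eval ![x, φ x] (X 0 * X 1 : MvPolynomial (Fin 2) ℝ) ≠ 0 ∧
        eval ![x, φ x] W ≠ 0 := by
      have hend : ∀ x, (x, φ x) ∈ A → eval ![x, φ x] (X 0 * X 1 : MvPolynomial (Fin 2) ℝ) ≠ 0 ∧
          eval ![x, φ x] W ≠ 0 := fun x hx =>
        ⟨fun h => hx.1.2 ⟨hx.1.1.1, h⟩, fun h => hx.2 (Or.inl ⟨hx.1.1.1, h⟩)⟩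
      intro x hx
      rcases eq_or_ne x a with rfl | hxa
      · exact hend _ ha
      rcases eq_or_ne x b with rfl | hxb
      · exact hend _ hb
      have hxT := hcon x ⟨lt_of_le_of_ne hx.1 hxa.symm, lt_of_le_of_ne hx.2 hxb⟩
      rw [Set.Finite.mem_toFinset] at hxT
      have h0 := (hφ x hx).1
      have h1 : eval ![x, φ x] (X 0 * X 1 : MvPolynomial (Fin 2) ℝ) ≠ 0 :=
        fun h => hxT (Or.inl ⟨h0, h⟩)
      exact ⟨h1, fun h => hxT (Or.inr (Or.inl ⟨⟨h0, h⟩, fun h' => h1 h'.2⟩))⟩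
    have hderiv := fun x hx => hasDerivAt_eval_div_eval R (hne x hx).1 (hne x hx).2
      (hφ x hx).2.1 (hφ x hx).2.2
    rw [← hQ] at hderiv
    have hcont : ContinuousOn (fun x => eval ![x, φ x] R / eval ![x, φ x] W) (Set.Icc a b) :=
      fun x hx => (hderiv x hx).continuousAt.continuousWithinAt
    have ha0 : eval ![a, φ a] R = 0 := ha.1.1.2
    have hb0 : eval ![b, φ b] R = 0 := hb.1.1.2
    by_cases hFQ : F ∣ Q
    · have hconst := constant_of_has_deriv_right_zero hcont fun x hx => by
        have hx' := Set.Ico_subset_Icc_self hx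
        refine ((hderiv x hx').congr_deriv ?_).hasDerivWithinAt
        obtain ⟨u, hu⟩ := hFQ
        rw [hu, map_mul, (hφ x hx').1]
        simp
      refine Set.Icc_infinite hab ((hfR.image Prod.fst).subset fun x hx =>
        ⟨(x, φ x), ⟨?_, ?_⟩, rfl⟩)
      · exact (hφ x hx).1
      · have := hconst x hx
        rw [ha0, zero_div, div_eq_zero_iff] at this
        exact this.resolve_right (hne x hx).2
    · obtain ⟨c, hc, hc0⟩ := exists_hasDerivAt_eq_zero hab hcont (by rw [ha0, hb0]; simp)
        fun x hx => hderiv x (Set.Ioo_subset_Icc_self hx)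
      have hc' := Set.Ioo_subset_Icc_self hc
      refine hcon c hc (hTfin.mem_toFinset.mpr (Or.inr (Or.inr (hT₀mem hFQ ⟨⟨(hφ c hc').1, ?_⟩,
        fun h => (hne c hc').1 h.2⟩))))
      rw [div_eq_zero_iff] at hc0
      exact hc0.resolve_right (mul_ne_zero (mul_ne_zero (pow_ne_zero 2 (hne c hc').2)
        (hne c hc').1) (hφ c hc').2.1)

open Filter Topology in
theorem ncard_commonZeros_le_of_dvd {F G : MvPolynomial (Fin 2) ℝ} (hF : Prime F)
    (hy : pderiv 1 F ≠ 0) (h : F ∣ G) (hfin : (commonZeros F G).Finite) :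
    (commonZeros F G).ncard ≤ F.totalDegree ^ 2 := by
  have hsub : commonZeros F G ⊆ commonZeros F (pderiv 1 F) := by
    rintro ⟨x, y⟩ hp
    by_contra hpy
    obtain ⟨ψ, hψ, hψ0, hiff⟩ := exists_implicit_function (hasStrictFDerivAt_eval F (x, y)) hp.1
      fun h0 => hpy ⟨hp.1, h0⟩
    have hcont : ContinuousAt (fun x => (x, ψ x)) x := continuousAt_id.prodMk hψ.continuousAt
    have hmem : ∀ᶠ x' in 𝓝 x, x' ∈ Prod.fst '' commonZeros F G := by
      have hiff' : ∀ᶠ v in 𝓝 (x, ψ x), eval ![v.1, v.2] F = 0 ↔ ψ v.1 = v.2 := by rwa [hψ0]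
      filter_upwards [hcont.eventually hiff'] with x' hx'
      have h0 : eval ![x', ψ x'] F = 0 := hx'.mpr rfl
      obtain ⟨u, rfl⟩ := h
      exact ⟨(x', ψ x'), ⟨h0, by simp [h0]⟩, rfl⟩
    exact infinite_of_mem_nhds x hmem (hfin.image _)
  refine (Set.ncard_le_ncard hsub (finite_commonZeros hF (not_dvd_pderiv hy))).trans
    ((ncard_commonZeros_le hF (not_dvd_pderiv hy)).trans ?_)
  rw [sq]
  exact Nat.mul_le_mul_left _ (totalDegree_pderiv_lt hy).le

theorem ncard_commonZeros_wronskian_monomial_sdiff_axes_le {F : MvPolynomial (Fin 2) ℝ}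
    (hF : Prime F) (s : ℕ → Fin 2 →₀ ℕ) {n : ℕ}
    (hn : ¬ F ∣ (logHamiltonian F).wronskian (fun j => monomial (s j) 1) n) :
    (commonZeros F ((logHamiltonian F).wronskian (fun j => monomial (s j) 1) n) \
      commonZeros F (X 0 * X 1)).ncard ≤ n ^ 2 * F.totalDegree ^ 2 := by
  obtain ⟨q, hq, hW⟩ := exists_wronskian_monomial F s n
  rw [hW] at hn ⊢
  have hFq : ¬ F ∣ q := fun h => hn (h.mul_left _)
  have hsub : commonZeros F ((∏ j : Fin n, monomial (s j) 1) * q) \ commonZeros F (X 0 * X 1) ⊆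
      commonZeros F q := by
    rintro p ⟨⟨h1, h2⟩, h3⟩
    refine ⟨h1, ?_⟩
    rw [map_mul, map_prod, mul_eq_zero, Finset.prod_eq_zero_iff] at h2
    refine h2.resolve_left ?_
    rintro ⟨j, -, hj⟩
    have hp : p.1 * p.2 ≠ 0 := fun h => h3 ⟨h1, by simpa using h⟩
    obtain ⟨hp1, hp2⟩ := mul_ne_zero_iff.mp hp
    simp [eval_monomial, Finsupp.prod_fintype, hp1, hp2] at hj
  refine (Set.ncard_le_ncard hsub (finite_commonZeros hF hFq)).trans
    ((ncard_commonZeros_le hF hFq).trans ((Nat.mul_le_mul_left _ hq).trans_eq (by ring)))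

theorem ncard_commonZeros_le_of_not_dvd {F G : MvPolynomial (Fin 2) ℝ} (hF : Prime F)
    (hy : pderiv 1 F ≠ 0) (hX : ¬ F ∣ X 1) (hG : ¬ F ∣ G) :
    (commonZeros F G).ncard ≤ G.support.card *
      (3 * (G.support.card ^ 2 * F.totalDegree ^ 2) + 5 * F.totalDegree ^ 3) +
        2 * F.totalDegree := by
  set t := G.support.card with ht
  have hXY : ¬ F ∣ X 0 * X 1 := fun h => (hF.dvd_or_dvd h).elim
    (by simpa using not_dvd_X_sub_C hF hy 0) hX
  obtain ⟨s, r, hr, hs, hsG⟩ := exists_maximal_wronskian hF (logHamiltonian F) G.support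
  set f : ℕ → MvPolynomial (Fin 2) ℝ := fun j => monomial (s j) 1 with hf
  set R : ℕ → MvPolynomial (Fin 2) ℝ := fun j =>
    (logHamiltonian F).wronskian (Function.update f j G) (j + 1) with hR
  set M := 3 * (t ^ 2 * F.totalDegree ^ 2) + 5 * F.totalDegree ^ 3 with hM
  have hFR : F ∣ R r := dvd_wronskian_update_of_forall_mem_support _ hsG
  have hW : ∀ j ≤ r, (commonZeros F ((logHamiltonian F).wronskian f j) \
      commonZeros F (X 0 * X 1)).ncard ≤ t ^ 2 * F.totalDegree ^ 2 := fun j hj =>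
    (ncard_commonZeros_wronskian_monomial_sdiff_axes_le hF s (hs j hj)).trans
      (Nat.mul_le_mul_right _ (Nat.pow_le_pow_left (hj.trans hr) 2))
  have key : ∀ i j, j + i = r → ¬ F ∣ R j →
      (commonZeros F (R j) \ commonZeros F (X 0 * X 1)).ncard ≤ i * M := by
    intro i
    induction i with
    | zero => rintro j rfl h; exact absurd hFR h
    | succ i ih =>
      intro j hj hFj
      have hid := (logHamiltonian F).wronskian_mul_wronskian_update f j G
        fun h => hs j (by omega) (h ▸ dvd_zero F)
      have h1 := ncard_commonZeros_sdiff_axes_le (q := t ^ 2 * F.totalDegree ^ 2 + i * M) hF hy hX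
        hFj (hs (j + 1) (by omega)) (by
          rw [← hid]
          intro hQ
          have hFj1 : ¬ F ∣ R (j + 1) := fun h => hQ (h.mul_left _)
          have hFWj := hs j (by omega)
          have hsub : commonZeros F ((logHamiltonian F).wronskian f j * R (j + 1)) \
              commonZeros F (X 0 * X 1) ⊆
              (commonZeros F ((logHamiltonian F).wronskian f j) \ commonZeros F (X 0 * X 1)) ∪
                (commonZeros F (R (j + 1)) \ commonZeros F (X 0 * X 1)) := by
            rintro p ⟨⟨hp1, hp2⟩, hp3⟩
            rw [map_mul, mul_eq_zero] at hp2
            exact hp2.imp (fun h => ⟨⟨hp1, h⟩, hp3⟩) (fun h => ⟨⟨hp1, h⟩, hp3⟩)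
          refine (Set.ncard_le_ncard hsub ((finite_commonZeros hF hFWj).sdiff.union
            (finite_commonZeros hF hFj1).sdiff)).trans ((Set.ncard_union_le _ _).trans
              (add_le_add (hW j (by omega)) (ih (j + 1) (by omega) hFj1))))
      have h2 := hW (j + 1) (by omega)
      rw [add_mul, one_mul]
      omega
  have hR0 : R 0 = G := by
    simp [hR, Derivation.wronskian]
  have h0 := key r 0 (zero_add r) (by rwa [hR0])
  rw [hR0] at h0
  have hXYcard : (commonZeros F (X 0 * X 1)).ncard ≤ F.totalDegree * 2 :=
    (ncard_commonZeros_le hF hXY).trans (Nat.mul_le_mul_left _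
      ((totalDegree_mul _ _).trans (by simp)))
  have hsub : commonZeros F G ⊆
      (commonZeros F G \ commonZeros F (X 0 * X 1)) ∪ commonZeros F (X 0 * X 1) :=
    Set.subset_sdiff_union _ _
  have h1 := (Set.ncard_le_ncard hsub ((finite_commonZeros hF hG).sdiff.union
    (finite_commonZeros hF hXY))).trans (Set.ncard_union_le _ _)
  have h2 : r * M ≤ t * M := Nat.mul_le_mul_right _ hr
  omega

theorem irreducible_of_map_of_injective {σ K L : Type*} [Field K] [Field L] {f : K →+* L}
    {p : MvPolynomial σ K} (h : Irreducible (p.map f)) : Irreducible p := by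
  have : IsLocalHom (MvPolynomial.map (σ := σ) f) := ⟨fun q hq => by
    rw [isUnit_iff_totalDegree_of_isReduced] at hq ⊢
    rw [coeff_map, isUnit_iff_ne_zero, totalDegree, support_map_of_injective _ f.injective] at hq
    exact ⟨isUnit_iff_ne_zero.mpr fun h0 => hq.1 (by rw [h0, map_zero]), hq.2⟩⟩
  exact h.of_map

theorem totalDegree_X_sub_C {σ K : Type*} [Field K] (i : σ) (c : K) :
    (X i - C c : MvPolynomial σ K).totalDegree = 1 := by
  classical
  refine le_antisymm ((totalDegree_sub_C_le _ _).trans_eq (totalDegree_X i)) ?_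
  have : Finsupp.single i 1 ∈ (X i - C c : MvPolynomial σ K).support := by
    simp [mem_support_iff, coeff_C, eq_comm (a := (0 : σ →₀ ℕ))]
  simpa using le_totalDegree this

theorem prime_X_sub_C {σ K : Type*} [Field K] (i : σ) (c : K) :
    Prime (X i - C c : MvPolynomial σ K) := by
  classical
  refine (irreducible_of_totalDegree_eq_one (totalDegree_X_sub_C i c) fun x hx => ?_).prime
  have := hx (Finsupp.single i 1)
  simpa [coeff_C, eq_comm (a := (0 : σ →₀ ℕ))] using this

theorem exists_pderiv_ne_zero {σ K : Type*} [Field K] [CharZero K] {p : MvPolynomial σ K}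
    (hp : p.totalDegree ≠ 0) : ∃ i, pderiv i p ≠ 0 := by
  by_contra! h
  refine hp (totalDegree_eq_zero_iff_eq_C.mpr ?_)
  ext m
  classical
  rw [coeff_C]
  split_ifs with hm
  · rw [hm]
  · obtain ⟨i, hi⟩ := Finsupp.ne_iff.mp (Ne.symm hm)
    have := congrArg (coeff (m - Finsupp.single i 1)) (h i)
    rw [coeff_pderiv, coeff_zero, tsub_add_cancel_of_le
      (by simpa [Nat.one_le_iff_ne_zero] using hi)] at this
    exact (mul_eq_zero.mp this).resolve_right (Nat.cast_add_one_ne_zero _)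

theorem exists_eval_X_one_eq (G : MvPolynomial (Fin 2) ℝ) : ∃ g : MvPolynomial (Fin 2) ℝ,
    g.support.card ≤ G.support.card ∧ ∀ x y, eval ![x, y] g = eval ![x, 0] G := by
  classical
  refine ⟨∑ s ∈ G.support.filter (· 1 = 0), monomial s (G.coeff s), ?_, fun x y => ?_⟩
  · refine Finset.card_le_card fun s hs => ?_
    obtain ⟨m, hm, hms⟩ := Finset.mem_biUnion.mp (support_sum hs)
    have := support_monomial_subset hms
    rw [Finset.mem_singleton] at this
    exact this ▸ (Finset.mem_filter.mp hm).1
  · conv_rhs => rw [G.as_sum]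
    rw [map_sum, map_sum, Finset.sum_filter]
    refine Finset.sum_congr rfl fun s _ => ?_
    split_ifs with h
    · simp [eval_monomial, Finsupp.prod_fintype, h]
    · simp [eval_monomial, Finsupp.prod_fintype, h]

theorem ncard_commonZeros_le_of_dvd_X {F G : MvPolynomial (Fin 2) ℝ} (hF : Prime F)
    (hX : F ∣ X 1) (hfin : (commonZeros F G).Finite) :
    (commonZeros F G).ncard ≤ G.support.card * (3 * G.support.card ^ 2 + 5) + 2 := by
  obtain ⟨g, hg, hgG⟩ := exists_eval_X_one_eq G
  have hXF : X 1 ∣ F := hF.irreducible.dvd_symm X_prime.irreducible hX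
  have hF0 : ∀ p : ℝ × ℝ, eval ![p.1, p.2] F = 0 ↔ p.2 = 0 := by
    refine fun p => ⟨fun h => ?_, fun h => ?_⟩
    · obtain ⟨u, hu⟩ := hX
      simpa [h] using congrArg (eval ![p.1, p.2]) hu
    · obtain ⟨u, rfl⟩ := hXF
      simp [h]
  have hP : Prime (X 1 - 1 : MvPolynomial (Fin 2) ℝ) := prime_X_sub_C 1 1
  have hPg : ¬ X 1 - 1 ∣ g := by
    rintro ⟨u, hu⟩
    refine (Set.infinite_univ (α := ℝ)) ((hfin.image Prod.fst).subset fun x _ =>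
      ⟨(x, 0), ⟨(hF0 _).mpr rfl, ?_⟩, rfl⟩)
    simp [← hgG x 1, hu]
  have hPX : ¬ (X 1 - 1 : MvPolynomial (Fin 2) ℝ) ∣ X 1 := by
    rintro ⟨u, hu⟩
    simpa using congrArg (eval ![0, 1]) hu
  have hdeg : (X 1 - 1 : MvPolynomial (Fin 2) ℝ).totalDegree = 1 := totalDegree_X_sub_C 1 1
  have h1 := ncard_commonZeros_le_of_not_dvd hP (by simp [pderiv_X]) hPX hPg
  have h2 : (commonZeros F G).ncard ≤ (commonZeros (X 1 - 1) g).ncard := by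
    refine Set.ncard_le_ncard_of_injOn (fun p => (p.1, 1)) (fun p hp => ⟨by simp, ?_⟩) ?_
      (finite_commonZeros hP hPg)
    · have := hp.2
      rw [(hF0 p).mp hp.1] at this
      simpa [hgG] using this
    · intro p hp p' hp' h
      simp only [Prod.mk.injEq, and_true] at h
      exact Prod.ext h (((hF0 p).mp hp.1).trans ((hF0 p').mp hp'.1).symm)
  rw [hdeg] at h1
  refine h2.trans (h1.trans ?_)
  simp only [one_pow, mul_one]
  gcongr

theorem ncard_commonZeros_le_of_card_support_le {F G : MvPolynomial (Fin 2) ℝ} (hF : Prime F)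
    (hy : pderiv 1 F ≠ 0) {t : ℕ} (hGt : G.support.card ≤ t) (ht : 1 ≤ t)
    (hfin : (commonZeros F G).Finite) :
    (commonZeros F G).ncard ≤ 10 * (F.totalDegree ^ 3 * t + F.totalDegree ^ 2 * t ^ 3) := by
  have hd := totalDegree_pos_of_pderiv_ne_zero hy
  have h1 : F.totalDegree ^ 2 ≤ F.totalDegree ^ 3 * t :=
    (Nat.pow_le_pow_right hd (by norm_num)).trans (Nat.le_mul_of_pos_right _ ht)
  have h2 : F.totalDegree ≤ F.totalDegree ^ 3 * t :=
    (Nat.le_self_pow (by norm_num) _).trans (Nat.le_mul_of_pos_right _ ht)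
  by_cases hG : F ∣ G
  · exact (ncard_commonZeros_le_of_dvd hF hy hG hfin).trans (by omega)
  have h3 : G.support.card *
      (3 * (G.support.card ^ 2 * F.totalDegree ^ 2) + 5 * F.totalDegree ^ 3) +
        2 * F.totalDegree ≤ 10 * (F.totalDegree ^ 3 * t + F.totalDegree ^ 2 * t ^ 3) :=
    calc _ ≤ t * (3 * (t ^ 2 * F.totalDegree ^ 2) + 5 * F.totalDegree ^ 3) +
          2 * (F.totalDegree ^ 3 * t) := by gcongr
      _ ≤ _ := by nlinarith [Nat.zero_le (F.totalDegree ^ 2 * t ^ 3)]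
  by_cases hX : F ∣ X 1
  · refine (ncard_commonZeros_le_of_dvd_X hF hX hfin).trans (le_trans ?_ h3)
    have h4 : 1 ≤ F.totalDegree ^ 2 := Nat.one_le_pow _ _ hd
    have h5 : 1 ≤ F.totalDegree ^ 3 := Nat.one_le_pow _ _ hd
    gcongr
    · exact Nat.le_mul_of_pos_right _ h4
    · omega
    · omega
  · exact (ncard_commonZeros_le_of_not_dvd hF hy hX hG).trans h3

theorem eval_rename_swap (H : MvPolynomial (Fin 2) ℝ) (x y : ℝ) :
    eval ![x, y] (rename (Equiv.swap 0 1) H) = eval ![y, x] H := by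
  rw [eval_rename]
  congr 2
  ext i
  fin_cases i <;> simp

theorem exists_commonZeros_eq_image_swap {F G : MvPolynomial (Fin 2) ℝ} (hF : Prime F)
    (hx : pderiv 0 F ≠ 0) :
    ∃ F' G' : MvPolynomial (Fin 2) ℝ, Prime F' ∧ pderiv 1 F' ≠ 0 ∧
      F'.totalDegree = F.totalDegree ∧ G'.support.card = G.support.card ∧
      commonZeros F' G' = Prod.swap '' commonZeros F G := by
  let e := renameEquiv ℝ (Equiv.swap (0 : Fin 2) 1)
  refine ⟨e F, e G, (MulEquiv.prime_iff e).mpr hF, ?_, ?_, ?_, ?_⟩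
  · have := pderiv_rename (R := ℝ) (Equiv.swap (0 : Fin 2) 1).injective 0 F
    rw [Equiv.swap_apply_left] at this
    simp only [e, renameEquiv_apply, this]
    exact fun h => hx ((rename_injective _ (Equiv.injective _)) (by simpa using h))
  · exact totalDegree_renameEquiv _ F
  · simp only [e, renameEquiv_apply]
    rw [support_rename_of_injective (Equiv.injective _),
      Finset.card_image_of_injective _ (Finsupp.mapDomain_injective (Equiv.injective _))]
  · ext ⟨x, y⟩
    simp [mem_commonZeros, e, eval_rename_swap]

/-- If `F ∈ ℝ[X,Y]` is nonzero of total degree `d ≥ 1`, irreducible in `ℂ[X,Y]`, and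
`G ∈ ℝ[X,Y]` is `t`-sparse (`t ≥ 1`), and the system `F = G = 0` has finitely many real
solutions, then it has at most `C · (d³t + d²t³)` real solutions, for an absolute
constant `C > 0`. -/
theorem sparse_irreducible_low_degree_root_count :
    ∃ C : ℝ, 0 < C ∧
      ∀ (F G : MvPolynomial (Fin 2) ℝ) (d t : ℕ),
        F ≠ 0 → F.totalDegree = d → 1 ≤ d →
        Irreducible (F.map (algebraMap ℝ ℂ)) →
        G.support.card ≤ t → 1 ≤ t →
        ∀ S : Set (ℝ × ℝ),
          S = {p : ℝ × ℝ | eval ![p.1, p.2] F = 0 ∧ eval ![p.1, p.2] G = 0} →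
          S.Finite →
          (S.ncard : ℝ) ≤ C * ((d : ℝ) ^ 3 * t + (d : ℝ) ^ 2 * (t : ℝ) ^ 3) := by
  refine ⟨10, by norm_num, ?_⟩
  rintro F G d t - rfl hd hirr hGt ht S rfl hfin
  have hF : Prime F := (irreducible_of_map_of_injective hirr).prime
  suffices (commonZeros F G).ncard ≤
      10 * (F.totalDegree ^ 3 * t + F.totalDegree ^ 2 * t ^ 3) by exact_mod_cast this
  by_cases hy : pderiv 1 F = 0
  · obtain ⟨i, hi⟩ := exists_pderiv_ne_zero (Nat.one_le_iff_ne_zero.mp hd)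
    have hx : pderiv 0 F ≠ 0 := by
      fin_cases i
      · exact hi
      · exact absurd hy hi
    obtain ⟨F', G', hF', hy', hdeg, hcard, hswap⟩ := exists_commonZeros_eq_image_swap (G := G) hF hx
    have := ncard_commonZeros_le_of_card_support_le hF' hy' (hcard.trans_le hGt) ht
      (hswap ▸ hfin.image _)
    rwa [hswap, Set.ncard_image_of_injective _ Prod.swap_injective, hdeg] at this
  · exact ncard_commonZeros_le_of_card_support_le hF hy hGt ht hfin
end
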